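/- There exists λ₁ > 1 such that for each positive integer M the following holds provided α > 0 is small enough. Let X : [0,1) → B_α be an admissible curve. Then for Lebesgue-a.e. θ ∈ [0,1), the truncated vertical derivative satisfies ∂̂f_n(θ, X(θ))/∂x ≥ λ₁^{nM/N(α)} for all sufficiently large n. -/

import Mathlib

open Set MeasureTheory Filter
open scoped ENNReal

noncomputable section

/-- The quadratic map `f(x) = a - x²`. -/
def qm (a : ℝ) : ℝ → ℝ := fun x => a - x ^ 2

/-- The critical point `0` of `qm a` is strictly pre-periodic: its forward orbit never
returns to `0` and is eventually periodic. -/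
def StrictlyPreperiodic (a : ℝ) : Prop :=
  (∀ i : ℕ, 1 ≤ i → (qm a)^[i] 0 ≠ 0) ∧
    ∃ m p : ℕ, 1 ≤ m ∧ 1 ≤ p ∧ (qm a)^[m + p] 0 = (qm a)^[m] 0

/-- A lift of the Viana skew product `F(θ, x) = (dθ, f(x) + αφ(θ))` to `ℝ × ℝ`;
for `φ` of period `1` this is a lift of the corresponding map of `(ℝ/ℤ) × ℝ`. -/
def Viana (a : ℝ) (d : ℕ) (φ : ℝ → ℝ) (α : ℝ) : ℝ × ℝ → ℝ × ℝ :=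
  fun p => ((d : ℝ) * p.1, qm a p.2 + α * φ p.1)

/-- The fibre maps `f_n`, defined by `F^n(θ, x) = (d^n θ, f_n(θ, x))`. -/
def fn (a : ℝ) (d : ℕ) (φ : ℝ → ℝ) (α : ℝ) (n : ℕ) (θ x : ℝ) : ℝ :=
  ((Viana a d φ α)^[n] (θ, x)).2

/-- Endpoints of the shadowing intervals: `IEnd a α n` gives the endpoints of `I_{n+1}`, where
`I₁ = [c₁ - 2α, c₁ + 2α]` and `I_{n+1}` is the closed interval containing `f(I_n)` both of whose
complementary components in `I_{n+1}` have length `α`. -/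
def IEnd (a α : ℝ) : ℕ → ℝ × ℝ
  | 0 => (qm a 0 - 2 * α, qm a 0 + 2 * α)
  | n + 1 =>
      (sInf (qm a '' Set.Icc (IEnd a α n).1 (IEnd a α n).2) - α,
        sSup (qm a '' Set.Icc (IEnd a α n).1 (IEnd a α n).2) + α)

/-- The shadowing interval `I_n`, for `n ≥ 1`. -/
def Iseq (a α : ℝ) (n : ℕ) : Set ℝ := Set.Icc (IEnd a α (n - 1)).1 (IEnd a α (n - 1)).2

/-- The length `|I_{n+1}|` of the shadowing interval `I_{n+1}`. -/
def len (a α : ℝ) (n : ℕ) : ℝ := (IEnd a α n).2 - (IEnd a α n).1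

/-- `N(α)`: the maximal integer `N` such that `|I_n| < ξ₀` for all `1 ≤ n ≤ N` and
`∑_{n=1}^{N} |I_n| ≤ ξ₀`. -/
def Nal (a ξ₀ α : ℝ) : ℕ :=
  sSup {N : ℕ | (∀ n : ℕ, 1 ≤ n → n ≤ N → len a α (n - 1) < ξ₀) ∧
    ∑ n ∈ Finset.range N, len a α n ≤ ξ₀}

/-- A curve `X : [0,1) → B = [-β, β]` is admissible if it is the image of a horizontal curve
under `F^n` for some `n ≥ n₀ + 1`: there are `ω = [j/dⁿ, (j+1)/dⁿ) ∈ 𝒫_n` and `x₀ ∈ B` with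
`X(dⁿθ mod 1) = f_n(θ, x₀)` for all `θ ∈ ω`; equivalently `X(t) = f_n((t+j)/dⁿ, x₀)` on `[0,1)`. -/
def Admissible (a : ℝ) (d : ℕ) (φ : ℝ → ℝ) (α β : ℝ) (n₀ : ℕ) (X : ℝ → ℝ) : Prop :=
  ∃ n : ℕ, n₀ + 1 ≤ n ∧ ∃ j : ℕ, j < d ^ n ∧ ∃ x₀ ∈ Set.Icc (-β) β,
    ∀ θ ∈ Set.Ico (0 : ℝ) 1, X θ = fn a d φ α n ((θ + j) / (d : ℝ) ^ n) x₀

/-- A finite set `E ⊆ [-p, p]` containing the fixed point `-p` of `x ↦ a - x²`, the point `p` and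
the critical value `a`, forward invariant and avoiding the critical point. -/
structure PostcritSet (a p : ℝ) (E : Set ℝ) : Prop where
  finite : E.Finite
  apos : 0 < a
  lt : a < p
  fix : p ^ 2 = a + p
  neg_mem : -p ∈ E
  mem : p ∈ E
  abs_le_p : ∀ e ∈ E, |e| ≤ p
  crit : a ∈ E
  inv : ∀ e ∈ E, a - e ^ 2 ∈ E
  zero : (0 : ℝ) ∉ E

/-- The closest point of `E` strictly to the left of `x`. -/
def lft (E : Set ℝ) (x : ℝ) : ℝ := sSup {e | e ∈ E ∧ e < x}

/-- The closest point of `E` strictly to the right of `x`. -/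
def rgt (E : Set ℝ) (x : ℝ) : ℝ := sInf {e | e ∈ E ∧ x < e}

/-- The hyperbolic density at `x` of the interval between the neighbours of `x` in `E`. -/
def hyp (E : Set ℝ) (x : ℝ) : ℝ := 1 / (x - lft E x) + 1 / (rgt E x - x)

namespace PostcritSet

variable {a p : ℝ} {E : Set ℝ}

lemma p_pos (h : PostcritSet a p E) : 0 < p := h.apos.trans h.lt

lemma lft_mem (h : PostcritSet a p E) {x : ℝ} (hx : |x| < p) : lft E x ∈ E ∧ lft E x < x := by
  have hf : {e | e ∈ E ∧ e < x}.Finite := h.finite.subset fun e he => he.1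
  have hne : {e | e ∈ E ∧ e < x}.Nonempty := ⟨-p, h.neg_mem, (abs_lt.1 hx).1⟩
  exact hf.isClosed.csSup_mem hne hf.bddAbove

lemma rgt_mem (h : PostcritSet a p E) {x : ℝ} (hx : |x| < p) : rgt E x ∈ E ∧ x < rgt E x := by
  have hf : {e | e ∈ E ∧ x < e}.Finite := h.finite.subset fun e he => he.1
  have hne : {e | e ∈ E ∧ x < e}.Nonempty := ⟨p, h.mem, (abs_lt.1 hx).2⟩
  exact hf.isClosed.csInf_mem hne hf.bddBelow

lemma le_lft (h : PostcritSet a p E) {x e : ℝ} (he : e ∈ E) (hx : e < x) : e ≤ lft E x :=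
  le_csSup ((h.finite.subset fun _ he => he.1 : {e | e ∈ E ∧ e < x}.Finite).bddAbove) ⟨he, hx⟩

lemma rgt_le (h : PostcritSet a p E) {x e : ℝ} (he : e ∈ E) (hx : x < e) : rgt E x ≤ e :=
  csInf_le ((h.finite.subset fun _ he => he.1 : {e | e ∈ E ∧ x < e}.Finite).bddBelow) ⟨he, hx⟩

lemma abs_map_lt (h : PostcritSet a p E) {x : ℝ} (hx : |x| < p) : |a - x ^ 2| < p := by
  have h1 : x ^ 2 < p ^ 2 := sq_lt_sq' (abs_lt.1 hx).1 (abs_lt.1 hx).2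
  have := h.fix; have := h.lt; have := sq_nonneg x
  rw [abs_lt]; constructor <;> linarith

lemma hyp_pos (h : PostcritSet a p E) {x : ℝ} (hx : |x| < p) : 0 < hyp E x := by
  have h1 := sub_pos.2 (h.lft_mem hx).2
  have h2 := sub_pos.2 (h.rgt_mem hx).2
  unfold hyp; positivity

lemma exists_gap (h : PostcritSet a p E) :
    ∃ g : ℝ, 0 < g ∧ ∀ e ∈ insert 0 E, ∀ e' ∈ insert 0 E, e < e' → g ≤ e' - e := by
  have hf : (insert (0 : ℝ) E).Finite := h.finite.insert 0
  have hf2 : ((fun q : ℝ × ℝ => q.2 - q.1) '' ((insert (0 : ℝ) E) ×ˢ (insert (0 : ℝ) E))).Finite :=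
    (hf.prod hf).image _
  set D := {t | t ∈ ((fun q : ℝ × ℝ => q.2 - q.1) ''
    ((insert (0 : ℝ) E) ×ˢ (insert (0 : ℝ) E))) ∧ 0 < t} with hD
  have hDf : D.Finite := hf2.subset fun t ht => ht.1
  have hDn : D.Nonempty := ⟨p - 0, ⟨(0, p), ⟨mem_insert _ _, mem_insert_of_mem _ h.mem⟩, rfl⟩,
    by simpa using h.p_pos⟩
  have hm := hDf.isClosed.csInf_mem hDn hDf.bddBelow
  refine ⟨sInf D, hm.2, fun e he e' he' hlt => csInf_le hDf.bddBelow
    ⟨⟨(e, e'), ⟨he, he'⟩, rfl⟩, sub_pos.2 hlt⟩⟩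

lemma density_expansion {lo X R p g : ℝ} (h0 : 0 ≤ lo) (h1 : lo < X) (h2 : X < R) (h3 : R ≤ p)
    (hg : g ≤ R - lo) :
    1 / (X - lo) + 1 / (R - X) + g / (4 * p ^ 2) ≤
      2 * X * (1 / (R ^ 2 - X ^ 2) + 1 / (X ^ 2 - lo ^ 2)) := by
  have e1 : 2 * X * (1 / (R ^ 2 - X ^ 2) + 1 / (X ^ 2 - lo ^ 2)) =
      1 / (X - lo) + 1 / (R - X) + (R - lo) / ((R + X) * (X + lo)) := by
    have a1 : R - X ≠ 0 := by linarith
    have a2 : R + X ≠ 0 := by linarith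
    have a3 : X - lo ≠ 0 := by linarith
    have a4 : X + lo ≠ 0 := by linarith
    have b1 : R ^ 2 - X ^ 2 = (R - X) * (R + X) := by ring
    have b2 : X ^ 2 - lo ^ 2 = (X - lo) * (X + lo) := by ring
    rw [b1, b2]; field_simp; ring
  rw [e1]
  have : g / (4 * p ^ 2) ≤ (R - lo) / ((R + X) * (X + lo)) := by
    apply div_le_div₀ (by linarith) hg
    · have : 0 < R + X := by linarith
      have : 0 < X + lo := by linarith
      positivity
    · have : (R + X) * (X + lo) ≤ (2 * p) * (2 * p) := by
        apply mul_le_mul <;> linarith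
      linarith
  linarith

lemma exists_hyp_step (h : PostcritSet a p E) :
    ∃ g : ℝ, 0 < g ∧ ∀ x : ℝ, |x| < p → x ≠ 0 → hyp E x + g ≤ 2 * |x| * hyp E (a - x ^ 2) := by
  obtain ⟨g, hg, hgap⟩ := h.exists_gap
  have hp := h.p_pos
  refine ⟨g / (4 * p ^ 2), by positivity, ?_⟩
  have core : ∀ x lo X R : ℝ, |x| < p → X ^ 2 = x ^ 2 → 0 ≤ lo → lo < X → X < R → R ≤ p →
      g ≤ R - lo → a - R ^ 2 ∈ E → a - lo ^ 2 ∈ E →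
      hyp E x ≤ 1 / (X - lo) + 1 / (R - X) →
      hyp E x + g / (4 * p ^ 2) ≤ 2 * X * hyp E (a - x ^ 2) := by
    intro x lo X R hx hXx h0 h1 h2 h3 hgl hR hlo hh
    have hy := h.abs_map_lt hx
    have k1 : a - R ^ 2 < a - x ^ 2 := by rw [← hXx]; nlinarith
    have k2 : a - x ^ 2 < a - lo ^ 2 := by rw [← hXx]; nlinarith
    have m1 := h.le_lft hR k1
    have m2 := h.rgt_le hlo k2
    have n1 := (h.lft_mem hy).2
    have n2 := (h.rgt_mem hy).2
    have := density_expansion h0 h1 h2 h3 hgl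
    have q1 : 1 / (R ^ 2 - X ^ 2) ≤ 1 / (a - x ^ 2 - lft E (a - x ^ 2)) :=
      one_div_le_one_div_of_le (by linarith) (by linarith)
    have q2 : 1 / (X ^ 2 - lo ^ 2) ≤ 1 / (rgt E (a - x ^ 2) - (a - x ^ 2)) :=
      one_div_le_one_div_of_le (by linarith) (by linarith)
    have q3 : 2 * X * (1 / (R ^ 2 - X ^ 2) + 1 / (X ^ 2 - lo ^ 2)) ≤ 2 * X * hyp E (a - x ^ 2) := by
      apply mul_le_mul_of_nonneg_left _ (by linarith)
      unfold hyp; linarith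
    linarith
  intro x hx hx0
  obtain ⟨l1, l2⟩ := h.lft_mem hx
  obtain ⟨r1, r2⟩ := h.rgt_mem hx
  have hz : ∀ e ∈ insert (0 : ℝ) E, a - e ^ 2 ∈ E := by
    rintro e (rfl | he)
    · simpa using h.crit
    · exact h.inv e he
  rcases lt_or_gt_of_ne hx0 with hn | hpos
  · rw [abs_of_neg hn]
    have hm : min (rgt E x) 0 ∈ insert (0 : ℝ) E := by
      rcases min_choice (rgt E x) 0 with e | e <;> rw [e]
      · exact mem_insert_of_mem _ r1
      · exact mem_insert _ _
    have hmx : x < min (rgt E x) 0 := lt_min r2 hn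
    have hm0 : min (rgt E x) 0 ≤ 0 := min_le_right _ _
    apply core x (-min (rgt E x) 0) (-x) (-lft E x) hx (by ring) (by linarith) (by linarith)
      (by linarith) (by linarith [(abs_le.1 (h.abs_le_p _ l1)).1])
    · have := hgap _ (mem_insert_of_mem _ l1) _ hm (l2.trans hmx)
      linarith
    · rw [neg_sq]; exact h.inv _ l1
    · rw [neg_sq]; exact hz _ hm
    · have q : 1 / (rgt E x - x) ≤ 1 / (-x - -min (rgt E x) 0) :=
        one_div_le_one_div_of_le (by linarith) (by linarith [min_le_left (rgt E x) 0])
      have q' : 1 / (-lft E x - -x) = 1 / (x - lft E x) := by congr 1; ring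
      unfold hyp; linarith
  · rw [abs_of_pos hpos]
    have hm : max (lft E x) 0 ∈ insert (0 : ℝ) E := by
      rcases max_choice (lft E x) 0 with e | e <;> rw [e]
      · exact mem_insert_of_mem _ l1
      · exact mem_insert _ _
    have hmx : max (lft E x) 0 < x := max_lt l2 hpos
    apply core x (max (lft E x) 0) x (rgt E x) hx rfl (le_max_right _ _) hmx r2
      (by linarith [(abs_le.1 (h.abs_le_p _ r1)).2])
    · exact hgap _ hm _ (mem_insert_of_mem _ r1) (hmx.trans r2)
    · exact h.inv _ r1
    · exact hz _ hm
    · have q : 1 / (x - lft E x) ≤ 1 / (x - max (lft E x) 0) :=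
        one_div_le_one_div_of_le (by linarith) (by linarith [le_max_left (lft E x) 0])
      unfold hyp; linarith

end PostcritSet

open Classical in
/-- A regularised distance to `E`: the inverse of the hyperbolic density, vanishing on `E`. -/
def hdist (E : Set ℝ) (x : ℝ) : ℝ := if x ∈ E then 0 else 1 / hyp E x

namespace PostcritSet

variable {a p : ℝ} {E : Set ℝ}

lemma hdist_of_mem {x : ℝ} (hx : x ∈ E) : hdist E x = 0 := by simp [hdist, hx]

lemma hdist_eq (h : PostcritSet a p E) {x : ℝ} (hx : |x| < p) (hE : x ∉ E) :
    hdist E x = (x - lft E x) * (rgt E x - x) / (rgt E x - lft E x) := by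
  have h1 := sub_pos.2 (h.lft_mem hx).2
  have h2 := sub_pos.2 (h.rgt_mem hx).2
  have h3 : rgt E x - lft E x ≠ 0 := by linarith
  simp only [hdist, hE, if_false, hyp]
  field_simp
  ring

lemma hdist_nonneg (h : PostcritSet a p E) {x : ℝ} (hx : |x| < p) : 0 ≤ hdist E x := by
  unfold hdist; split_ifs
  · exact le_rfl
  · exact (one_div_pos.2 (h.hyp_pos hx)).le

lemma hdist_le (h : PostcritSet a p E) {x e : ℝ} (hx : |x| < p) (he : e ∈ E) :
    hdist E x ≤ |x - e| := by
  by_cases hE : x ∈ E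
  · rw [hdist_of_mem hE]; exact abs_nonneg _
  have h1 := sub_pos.2 (h.lft_mem hx).2
  have h2 := sub_pos.2 (h.rgt_mem hx).2
  rw [h.hdist_eq hx hE, div_le_iff₀ (by linarith)]
  have hne : e ≠ x := fun hh => hE (hh ▸ he)
  rcases lt_or_gt_of_ne hne with hlt | hgt
  · have := h.le_lft he hlt
    rw [abs_of_pos (by linarith)]
    apply mul_le_mul <;> linarith
  · have := h.rgt_le he hgt
    rw [abs_of_neg (by linarith), mul_comm]
    apply mul_le_mul <;> linarith

lemma hdist_lipschitz (h : PostcritSet a p E) {x y : ℝ} (hx : |x| < p) (hy : |y| < p) :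
    hdist E y ≤ hdist E x + |y - x| := by
  by_cases hb : ∃ e ∈ E, (x ≤ e ∧ e ≤ y) ∨ (y ≤ e ∧ e ≤ x)
  · obtain ⟨e, he, hh⟩ := hb
    have h1 := h.hdist_le hy he
    have h2 := h.hdist_nonneg hx
    have h3 : |y - e| ≤ |y - x| := by
      rcases hh with hh | hh
      · rw [abs_of_nonneg (by linarith), abs_of_nonneg (by linarith)]; linarith
      · rw [abs_of_nonpos (by linarith), abs_of_nonpos (by linarith)]; linarith
    linarith
  push Not at hb
  have hxE : x ∉ E := fun hh => by
    rcases le_total x y with k | k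
    · exact absurd k (not_le.2 ((hb x hh).1 le_rfl))
    · exact absurd le_rfl (not_le.2 ((hb x hh).2 k))
  have hyE : y ∉ E := fun hh => by
    rcases le_total x y with k | k
    · exact absurd le_rfl (not_le.2 ((hb y hh).1 k))
    · exact absurd k (not_le.2 ((hb y hh).2 le_rfl))
  have key : ∀ e ∈ E, (e < x ↔ e < y) ∧ (x < e ↔ y < e) := by
    intro e he
    have := hb e he
    have n1 : e ≠ x := fun hh => hxE (hh ▸ he)
    have n2 : e ≠ y := fun hh => hyE (hh ▸ he)
    refine ⟨⟨fun k => ?_, fun k => ?_⟩, ⟨fun k => ?_, fun k => ?_⟩⟩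
    · by_contra hc; exact absurd k.le (not_le.2 (this.2 (not_lt.1 hc)))
    · by_contra hc; exact absurd k.le (not_le.2 (this.1 (not_lt.1 hc)))
    · exact this.1 k.le
    · exact this.2 k.le
  have hl : lft E y = lft E x := by
    unfold lft; congr 1; ext e
    exact ⟨fun k => ⟨k.1, (key e k.1).1.2 k.2⟩, fun k => ⟨k.1, (key e k.1).1.1 k.2⟩⟩
  have hr : rgt E y = rgt E x := by
    unfold rgt; congr 1; ext e
    exact ⟨fun k => ⟨k.1, (key e k.1).2.2 k.2⟩, fun k => ⟨k.1, (key e k.1).2.1 k.2⟩⟩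
  have h1 := (h.lft_mem hx).2
  have h2 := (h.rgt_mem hx).2
  have h3 := (h.lft_mem hy).2
  have h4 := (h.rgt_mem hy).2
  rw [hl] at h3
  rw [hr] at h4
  rw [h.hdist_eq hx hxE, h.hdist_eq hy hyE, hl, hr]
  set l := lft E x
  set r := rgt E x
  have hw : 0 < r - l := by linarith
  rw [← sub_le_iff_le_add', ← sub_div, div_le_iff₀ hw]
  have : (y - l) * (r - y) - (x - l) * (r - x) = (y - x) * (r + l - x - y) := by ring
  rw [this]
  calc (y - x) * (r + l - x - y) ≤ |(y - x) * (r + l - x - y)| := le_abs_self _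
    _ = |y - x| * |r + l - x - y| := abs_mul _ _
    _ ≤ |y - x| * (r - l) := by
      apply mul_le_mul_of_nonneg_left _ (abs_nonneg _)
      rw [abs_le]; constructor <;> linarith

lemma half_le_hdist (h : PostcritSet a p E) {x r : ℝ} (hx : |x| < p) (hr : 0 < r)
    (hE : ∀ e ∈ E, r ≤ |x - e|) : r / 2 ≤ hdist E x := by
  have hxE : x ∉ E := fun hh => by have := hE x hh; simp at this; linarith
  obtain ⟨l1, l2⟩ := h.lft_mem hx
  obtain ⟨r1, r2⟩ := h.rgt_mem hx
  have k1 := hE _ l1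
  have k2 := hE _ r1
  rw [abs_of_pos (by linarith)] at k1
  rw [abs_of_neg (by linarith)] at k2
  simp only [hdist, hxE, if_false]
  rw [le_one_div (by positivity) (h.hyp_pos hx)]
  unfold hyp
  have q1 : 1 / (x - lft E x) ≤ 1 / r := one_div_le_one_div_of_le hr k1
  have q2 : 1 / (rgt E x - x) ≤ 1 / r := one_div_le_one_div_of_le hr (by linarith)
  have : 1 / (r / 2) = 1 / r + 1 / r := by field_simp; norm_num
  linarith

lemma hdist_step (h : PostcritSet a p E) {g : ℝ}
    (hg : ∀ x : ℝ, |x| < p → x ≠ 0 → hyp E x + g ≤ 2 * |x| * hyp E (a - x ^ 2)) (hg0 : 0 < g)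
    {x : ℝ} (hx : |x| < p) (hx0 : x ≠ 0) :
    hdist E (a - x ^ 2) * (1 + g * hdist E x) ≤ 2 * |x| * hdist E x := by
  have hn := h.hdist_nonneg hx
  by_cases hE : a - x ^ 2 ∈ E
  · rw [hdist_of_mem hE]; simp; positivity
  have hxE : x ∉ E := fun hh => hE (h.inv x hh)
  have h1 := h.hyp_pos hx
  have h2 := h.hyp_pos (h.abs_map_lt hx)
  simp only [hdist, hE, hxE, if_false]
  have := hg x hx hx0
  rw [show 1 / hyp E (a - x ^ 2) * (1 + g * (1 / hyp E x)) =
    (hyp E x + g) / (hyp E (a - x ^ 2) * hyp E x) by field_simp,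
    show 2 * |x| * (1 / hyp E x) =
      (2 * |x| * hyp E (a - x ^ 2)) / (hyp E (a - x ^ 2) * hyp E x) by field_simp]
  gcongr

end PostcritSet

lemma qm_iterate_finite {a : ℝ} (hpre : StrictlyPreperiodic a) :
    (Set.range fun i : ℕ => (qm a)^[i + 1] 0).Finite := by
  obtain ⟨-, m, p, hm, hp, h⟩ := hpre
  have key : ∀ i : ℕ, ∃ j < m + p, (qm a)^[j] 0 = (qm a)^[i] 0 := by
    intro i
    induction i using Nat.strong_induction_on with
    | _ i ih =>
      by_cases hi : i < m + p
      · exact ⟨i, hi, rfl⟩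
      · obtain ⟨j, hj, e⟩ := ih (i - p) (by omega)
        refine ⟨j, hj, e.trans ?_⟩
        have e1 : i - p = (i - p - m) + m := by omega
        have e2 : i = (i - p - m) + (m + p) := by omega
        rw [e1]
        conv_rhs => rw [e2]
        rw [Function.iterate_add_apply, Function.iterate_add_apply, h]
  refine ((Finset.range (m + p)).finite_toSet.image fun j => (qm a)^[j] 0).subset ?_
  rintro _ ⟨i, rfl⟩
  obtain ⟨j, hj, e⟩ := key (i + 1)
  exact ⟨j, by simpa using hj, e⟩

lemma exists_postcritSet {a : ℝ} (ha : a ∈ Set.Ioo (1 : ℝ) 2) (hpre : StrictlyPreperiodic a)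
    {p : ℝ} (hp : p = (1 + Real.sqrt (1 + 4 * a)) / 2) :
    ∃ E : Set ℝ, PostcritSet a p E ∧ (∀ i : ℕ, (qm a)^[i + 1] 0 ∈ E) ∧
      ∀ i : ℕ, |(qm a)^[i + 1] 0| < p := by
  obtain ⟨ha1, ha2⟩ := ha
  have hs := Real.sq_sqrt (show 0 ≤ 1 + 4 * a by linarith)
  have hs0 := Real.sqrt_nonneg (1 + 4 * a)
  set s := Real.sqrt (1 + 4 * a)
  have hs2 : 2 < s := by nlinarith
  have hs3 : s < 3 := by nlinarith
  have hfix : p ^ 2 = a + p := by rw [hp]; nlinarith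
  have hlt : a < p := by rw [hp]; nlinarith
  have hp1 : 1 < p := by rw [hp]; linarith
  have hc : ∀ i : ℕ, |(qm a)^[i + 1] 0| < p := by
    intro i
    induction i with
    | zero => simp [qm]; rw [abs_lt]; constructor <;> linarith
    | succ i ih =>
      rw [Function.iterate_succ_apply']
      simp only [qm] at ih ⊢
      rw [abs_lt] at ih ⊢
      have := sq_lt_sq' ih.1 ih.2
      constructor <;> nlinarith
  refine ⟨(Set.range fun i : ℕ => (qm a)^[i + 1] 0) ∪ {-p, p}, ⟨?_, by linarith, hlt, hfix,
    by simp, by simp, ?_, Or.inl ⟨0, by simp [qm]⟩, ?_, ?_⟩, fun i => Or.inl ⟨i, rfl⟩, hc⟩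
  · exact (qm_iterate_finite hpre).union (by simp)
  · rintro e (⟨i, rfl⟩ | he)
    · exact (hc i).le
    · rcases he with rfl | he
      · rw [abs_neg, abs_of_pos (by linarith)]
      · rw [mem_singleton_iff] at he; rw [he, abs_of_pos (by linarith)]
  · rintro e (⟨i, rfl⟩ | he)
    · left; refine ⟨i + 1, ?_⟩
      simp only []
      rw [Function.iterate_succ_apply']; rfl
    · right; left
      have : e ^ 2 = p ^ 2 := by
        rcases he with rfl | he
        · ring
        · rw [mem_singleton_iff] at he; rw [he]
      linarith
  · rintro (⟨i, hi⟩ | he)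
    · exact hpre.1 (i + 1) (by omega) hi
    · rcases he with he | he
      · linarith
      · rw [mem_singleton_iff] at he; linarith

/-- The interval `[-β, β]` is invariant under small perturbations of `qm a`. -/
lemma exists_trap {a β : ℝ} (hβ : 1 < β)
    (hβmap : ∀ x ∈ Set.Icc (-β) β, qm a x ∈ Set.Ioo (-β) β) :
    ∃ α₀ > 0, ∀ α : ℝ, 0 < α → α < α₀ → ∀ x ∈ Set.Icc (-β) β, ∀ ψ : ℝ, |ψ| ≤ 1 →
      a - x ^ 2 + α * ψ ∈ Set.Icc (-β) β := by
  have h0 := hβmap 0 ⟨by linarith, by linarith⟩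
  have h1 := hβmap β ⟨by linarith, le_rfl⟩
  simp only [qm, mem_Ioo] at h0 h1
  refine ⟨min (β - a) (a - β ^ 2 + β), lt_min (by nlinarith) (by linarith), ?_⟩
  intro α hα hα0 x hx ψ hψ
  rw [lt_min_iff] at hα0
  have hs : x ^ 2 ≤ β ^ 2 := sq_le_sq' hx.1 hx.2
  have hq : |α * ψ| ≤ α := by
    rw [abs_mul, abs_of_pos hα]; nlinarith
  rw [abs_le] at hq
  constructor <;> nlinarith [sq_nonneg x]

lemma le_mul_density_of_ratios {γ ν ν₁ T T₁ y U V lam : ℝ} (h0 : 0 ≤ γ) (h1 : γ ≤ 1)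
    (hν : 0 < ν) (hT : 0 < T) (hT₁ : 0 < T₁) (hy : 0 < y) (hU : 0 < U) (hν₁ : 0 < ν₁)
    (hV : 0 < V) (h₁ : U * ν ≤ y * ν₁) (h₂ : V * T₁ ≤ y * T)
    (hl : lam ≤ U ^ (1 - γ) * V ^ γ) :
    lam * (ν ^ (1 - γ) * T ^ (-γ)) ≤ y * (ν₁ ^ (1 - γ) * T₁ ^ (-γ)) := by
  have e1 : y * (ν₁ ^ (1 - γ) * T₁ ^ (-γ)) = (y * ν₁) ^ (1 - γ) * (y / T₁) ^ γ := by
    rw [Real.mul_rpow hy.le hν₁.le, Real.div_rpow hy.le hT₁.le, Real.rpow_neg hT₁.le]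
    have : y = y ^ (1 - γ) * y ^ γ := by
      rw [← Real.rpow_add hy]; simp
    nth_rewrite 1 [this]
    field_simp
  have e2 : (U ^ (1 - γ) * V ^ γ) * (ν ^ (1 - γ) * T ^ (-γ)) =
      (U * ν) ^ (1 - γ) * (V / T) ^ γ := by
    rw [Real.mul_rpow hU.le hν.le, Real.div_rpow hV.le hT.le, Real.rpow_neg hT.le]
    field_simp
  calc _ ≤ (U ^ (1 - γ) * V ^ γ) * (ν ^ (1 - γ) * T ^ (-γ)) := by gcongr
    _ = _ := e2
    _ ≤ (y * ν₁) ^ (1 - γ) * (y / T₁) ^ γ := by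
      have : V / T ≤ y / T₁ := by rw [div_le_div_iff₀ hT hT₁]; exact h₂
      have h3 : 0 ≤ 1 - γ := by linarith
      gcongr
    _ = _ := e1.symm

lemma exists_small_ratio_bound {m₁ m₃ : ℝ} (h₁ : 0 < m₁) (h₃ : 0 < m₃) :
    ∃ η₀ > 0, ∀ w : ℝ, 0 < w → w < η₀ → ∀ γ : ℝ, 3 / 4 ≤ γ → γ ≤ 1 →
      2 ≤ (m₁ * w) ^ (1 - γ) * (m₃ * w ^ (-(2 / 3) : ℝ)) ^ γ := by
  have t0 : Tendsto (fun w : ℝ => m₁ * w) (nhdsWithin 0 (Ioi 0)) (nhds 0) := by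
    have : Tendsto (fun w : ℝ => m₁ * w) (nhds 0) (nhds (m₁ * 0)) := by
      apply Continuous.tendsto; fun_prop
    rw [mul_zero] at this
    exact this.mono_left nhdsWithin_le_nhds
  have t1 : Tendsto (fun w : ℝ => m₃ * w ^ (-(2 / 3) : ℝ)) (nhdsWithin 0 (Ioi 0)) atTop :=
    (tendsto_rpow_neg_nhdsGT_zero (by norm_num)).const_mul_atTop h₃
  have t2 : Tendsto (fun w : ℝ => (m₁ ^ (1 / 4 : ℝ) * m₃ ^ (3 / 4 : ℝ)) * w ^ (-(1 / 4) : ℝ))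
      (nhdsWithin 0 (Ioi 0)) atTop :=
    (tendsto_rpow_neg_nhdsGT_zero (by norm_num)).const_mul_atTop (by positivity)
  have := ((t0.eventually_le_const zero_lt_one).and
    ((t1.eventually_ge_atTop 1).and (t2.eventually_ge_atTop 2)))
  obtain ⟨η₀, hη, hs⟩ := mem_nhdsGT_iff_exists_Ioo_subset.1 this
  refine ⟨η₀, hη, fun w hw hw' γ hγ hγ' => ?_⟩
  obtain ⟨a1, a2, a3⟩ := hs ⟨hw, hw'⟩
  refine a3.trans ?_
  calc (m₁ ^ (1 / 4 : ℝ) * m₃ ^ (3 / 4 : ℝ)) * w ^ (-(1 / 4) : ℝ)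
      = (m₁ * w) ^ (1 / 4 : ℝ) * (m₃ * w ^ (-(2 / 3) : ℝ)) ^ (3 / 4 : ℝ) := by
        rw [Real.mul_rpow h₁.le hw.le, Real.mul_rpow h₃.le (by positivity),
          ← Real.rpow_mul hw.le,
          show (-(1 / 4) : ℝ) = 1 / 4 + (-(2 / 3)) * (3 / 4) by norm_num, Real.rpow_add hw]
        ring
    _ ≤ _ := by
      gcongr ?_ * ?_
      · exact Real.rpow_le_rpow_of_exponent_ge (by positivity) a1 (by linarith)
      · exact Real.rpow_le_rpow_of_exponent_le a2 hγ

namespace PostcritSet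

variable {a p : ℝ} {E : Set ℝ}

lemma exists_continuous_interp (h : PostcritSet a p E) :
    ∃ ν : ℝ → ℝ, Continuous ν ∧ (∀ x, 0 < ν x) ∧ ∀ e ∈ E, |e| < p → ν e = hyp E e := by
  classical
  let q : Polynomial ℝ := Lagrange.interpolate h.finite.toFinset id fun e => Real.log (hyp E e)
  refine ⟨fun x => Real.exp (q.eval x), by fun_prop, fun x => Real.exp_pos _, fun e he hep => ?_⟩
  have : q.eval (id e) = Real.log (hyp E e) :=
    Lagrange.eval_interpolate_at_node _ (Function.injective_id.injOn) (by simpa using he)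
  simp only [id] at this
  simp only [this]
  exact Real.exp_log (h.hyp_pos hep)

/-- Uniform expansion of the interpolated density along the postcritical set, stable under
perturbation. -/
lemma exists_expansion_near (h : PostcritSet a p E) {ν : ℝ → ℝ} (hc : Continuous ν)
    (hν : ∀ e ∈ E, |e| < p → ν e = hyp E e) :
    ∃ b η : ℝ, 1 < b ∧ 0 < η ∧ ∀ e ∈ E, |e| < p → ∀ x t : ℝ, |x - e| < η → |t| < η →
      b * ν x ≤ 2 * |x| * ν (a - x ^ 2 + t) := by
  obtain ⟨g, hg, hstep⟩ := h.exists_hyp_step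
  have hPf : {e | e ∈ E ∧ |e| < p}.Finite := h.finite.subset fun e he => he.1
  have h1 : ∀ e ∈ {e | e ∈ E ∧ |e| < p}, ∀ᶠ b in nhdsWithin (1 : ℝ) (Ioi 1),
      b * ν e < 2 * |e| * ν (a - e ^ 2) := by
    rintro e ⟨he, hep⟩
    have hs := hstep e hep (fun h0 => h.zero (h0 ▸ he))
    have ht : Tendsto (fun b : ℝ => b * ν e) (nhdsWithin 1 (Ioi 1)) (nhds (1 * ν e)) :=
      ((continuous_id.mul continuous_const).tendsto 1).mono_left nhdsWithin_le_nhds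
    apply ht.eventually_lt_const
    rw [hν e he hep, hν _ (h.inv e he) (h.abs_map_lt hep)]
    linarith
  have h2 := ((hPf.eventually_all).2 h1).and self_mem_nhdsWithin
  obtain ⟨b, hb, hb1⟩ := h2.exists
  have h3 : ∀ e ∈ {e | e ∈ E ∧ |e| < p}, ∀ᶠ η in nhdsWithin (0 : ℝ) (Ioi 0),
      ∀ x t : ℝ, |x - e| < η → |t| < η → b * ν x ≤ 2 * |x| * ν (a - x ^ 2 + t) := by
    intro e he
    have ho : IsOpen {z : ℝ × ℝ | b * ν z.1 < 2 * |z.1| * ν (a - z.1 ^ 2 + z.2)} :=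
      isOpen_lt (by fun_prop) (by fun_prop)
    have hm : (e, (0 : ℝ)) ∈ {z : ℝ × ℝ | b * ν z.1 < 2 * |z.1| * ν (a - z.1 ^ 2 + z.2)} := by
      simpa using hb e he
    obtain ⟨η, hη, hs⟩ := Metric.isOpen_iff.1 ho _ hm
    filter_upwards [Ioo_mem_nhdsGT hη] with η' hη' x t hx ht
    have : (x, t) ∈ Metric.ball (e, (0 : ℝ)) η := by
      rw [Metric.mem_ball, Prod.dist_eq, max_lt_iff, Real.dist_eq, Real.dist_eq]
      simp only [sub_zero]
      exact ⟨hx.trans hη'.2, ht.trans hη'.2⟩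
    exact (hs this).le
  obtain ⟨η, hη, hη0⟩ := (((hPf.eventually_all).2 h3).and self_mem_nhdsWithin).exists
  exact ⟨b, η, hb1, hη0, fun e he hep => hη e ⟨he, hep⟩⟩

end PostcritSet

lemma exists_exponent {m g : ℝ} (hm : 0 < m) (hg : 0 < g) :
    ∃ γ lam : ℝ, 3 / 4 ≤ γ ∧ γ < 1 ∧ 1 < lam ∧ lam ≤ m ^ (1 - γ) * (1 + g) ^ γ := by
  have hc : Continuous fun γ : ℝ => m ^ (1 - γ) * (1 + g) ^ γ := by
    have h1 : 0 < 1 + g := by linarith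
    refine Continuous.mul ?_ ?_
    · exact continuous_const.rpow (by fun_prop) fun _ => Or.inl hm.ne'
    · exact continuous_const.rpow (by fun_prop) fun _ => Or.inl h1.ne'
  have ht : Tendsto (fun γ : ℝ => m ^ (1 - γ) * (1 + g) ^ γ) (nhdsWithin 1 (Iio 1))
      (nhds (m ^ (1 - 1 : ℝ) * (1 + g) ^ (1 : ℝ))) := (hc.tendsto 1).mono_left nhdsWithin_le_nhds
  have hev := (ht.eventually_const_lt (u := 1 + g / 2) (by simp; linarith)).and
    (Ioo_mem_nhdsLT (show (3 / 4 : ℝ) < 1 by norm_num))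
  obtain ⟨γ, h1, h2⟩ := hev.exists
  exact ⟨γ, 1 + g / 2, h2.1.le, h2.2, by linarith, h1.le⟩

set_option maxHeartbeats 1600000 in
/-- There is a family of metrics `ρ |dx|`, expanded by all perturbed maps outside the
critical window, bounded near the critical point and bounded below. -/
lemma PostcritSet.exists_expanding_metric {a p β : ℝ} {E : Set ℝ} (h : PostcritSet a p E)
    (hβp : β < p)
    (htrap : ∃ α₀ > 0, ∀ α : ℝ, 0 < α → α < α₀ → ∀ x ∈ Set.Icc (-β) β, ∀ ψ : ℝ, |ψ| ≤ 1 →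
      a - x ^ 2 + α * ψ ∈ Set.Icc (-β) β) :
    ∃ lam c C : ℝ, 1 < lam ∧ 0 < c ∧ 0 < C ∧ ∀ᶠ α in nhdsWithin (0 : ℝ) (Ioi 0),
      ∃ ρ : ℝ → ℝ, (∀ x ∈ Icc (-β) β, c ≤ ρ x) ∧ (∃ K : ℝ, ∀ x ∈ Icc (-β) β, ρ x ≤ K) ∧
        (∀ x ∈ Icc (-β) β, |x| ≤ 2 * α ^ (0.6 : ℝ) → ρ x ≤ C) ∧
        ∀ x ∈ Icc (-β) β, ∀ ψ : ℝ, |ψ| ≤ 1 → α ^ (0.6 : ℝ) ≤ |x| →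
          lam * ρ x ≤ 2 * |x| * ρ (a - x ^ 2 + α * ψ) := by
  obtain ⟨ν, hνc, hνpos, hν⟩ := h.exists_continuous_interp
  obtain ⟨b, η, hb, hη, hexp⟩ := h.exists_expansion_near hνc hν
  obtain ⟨g, hg, hstep⟩ := h.exists_hyp_step
  obtain ⟨z, hz, hgap⟩ := h.exists_gap
  obtain ⟨α₁, hα₁, htr⟩ := htrap
  have hp := h.p_pos
  have hpne : (Icc (-p) p).Nonempty := ⟨0, by constructor <;> linarith⟩
  obtain ⟨xm, -, hxm⟩ := isCompact_Icc.exists_isMinOn hpne hνc.continuousOn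
  obtain ⟨xM, -, hxM⟩ := isCompact_Icc.exists_isMaxOn hpne hνc.continuousOn
  set νm := ν xm
  set νM := ν xM
  have hνm : 0 < νm := hνpos _
  have hνM : 0 < νM := hνpos _
  have lo : ∀ x, |x| ≤ p → νm ≤ ν x := fun x hx => hxm (abs_le.1 hx)
  have hi : ∀ x, |x| ≤ p → ν x ≤ νM := fun x hx => hxM (abs_le.1 hx)
  have hB : ∀ x ∈ Icc (-β) β, |x| < p := fun x hx => (abs_le.2 hx).trans_lt hβp
  set A := νM / (b - 1) with hA
  have hA0 : 0 < A := div_pos hνM (by linarith)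
  set K := 1 + A / νm with hK
  have hK0 : 0 < K := by positivity
  set m₁ := 2 * νm / νM with hm₁
  have hm₁0 : 0 < m₁ := by positivity
  set m₃ := (z / 2) / (1 + K) with hm₃
  have hm₃0 : 0 < m₃ := by positivity
  obtain ⟨η₁, hη₁, hreg3⟩ := exists_small_ratio_bound hm₁0 hm₃0
  set η₀ := min (min η₁ (z / 2)) 1 with hη₀
  have hη₀0 : 0 < η₀ := by positivity
  set r := min η (p - β) with hr
  have hr0 : 0 < r := lt_min hη (by linarith)
  set G := g * (r / 2) with hG
  have hG0 : 0 < G := by positivity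
  obtain ⟨γ, lam₂, hγ, hγ1, hlam₂, hlam₂'⟩ :=
    exists_exponent (show 0 < m₁ * η₀ by positivity) (show 0 < G / 2 by positivity)
  have hbγ : 1 < b ^ (1 - γ) := Real.one_lt_rpow hb (by linarith)
  have near0 : ∀ x, |x| < p → |x| ≤ z / 2 → z / 4 ≤ hdist E x := by
    intro x hx hx2
    have := h.half_le_hdist hx (half_pos hz) (fun e he => by
      have hez : z ≤ |e| := by
        rcases lt_trichotomy e 0 with hn | hn | hn
        · rw [abs_of_neg hn]
          have := hgap e (mem_insert_of_mem _ he) 0 (mem_insert _ _) hn; linarith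
        · exact absurd he (hn ▸ h.zero)
        · rw [abs_of_pos hn]
          have := hgap 0 (mem_insert _ _) e (mem_insert_of_mem _ he) hn; linarith
      have : |e| - |x| ≤ |x - e| := by rw [abs_sub_comm]; exact abs_sub_abs_le_abs_sub e x
      linarith)
    linarith
  refine ⟨min (min (b ^ (1 - γ)) lam₂) 2, νm ^ (1 - γ) * (2 * p + A / νm) ^ (-γ),
    νM ^ (1 - γ) * (z / 4) ^ (-γ), lt_min (lt_min hbγ hlam₂) (by norm_num), by positivity,
    by positivity, ?_⟩
  have s1 : Tendsto (fun α : ℝ => 2 * α ^ (0.6 : ℝ)) (nhdsWithin 0 (Ioi 0)) (nhds 0) := by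
    have : Tendsto (fun α : ℝ => 2 * α ^ (0.6 : ℝ)) (nhds 0) (nhds (2 * 0 ^ (0.6 : ℝ))) :=
      ((Real.continuous_rpow_const (by norm_num)).const_mul 2).tendsto 0
    rw [Real.zero_rpow (by norm_num), mul_zero] at this
    exact this.mono_left nhdsWithin_le_nhds
  have s2 : Tendsto (fun α : ℝ => (1 + G / 2) * K * α * (1 + G)) (nhdsWithin 0 (Ioi 0))
      (nhds 0) := by
    have : Tendsto (fun α : ℝ => (1 + G / 2) * K * α * (1 + G)) (nhds 0)
        (nhds ((1 + G / 2) * K * 0 * (1 + G))) := by apply Continuous.tendsto; fun_prop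
    simp only [mul_zero, zero_mul] at this
    exact this.mono_left nhdsWithin_le_nhds
  filter_upwards [Ioo_mem_nhdsGT hα₁, Ioo_mem_nhdsGT zero_lt_one, Ioo_mem_nhdsGT hη,
    s1.eventually_le_const (half_pos hz),
    s2.eventually_le_const (show 0 < η₀ * r * (G / 2) by positivity)] with α hαt hα1 hαη hα6 hαG
  have hα : 0 < α := hαt.1
  set T : ℝ → ℝ := fun x => hdist E x + A * α / ν x with hT
  have hT0 : ∀ x, |x| < p → A * α / νM ≤ T x := fun x hx => by
    have h1 := h.hdist_nonneg hx
    have h2 : A * α / νM ≤ A * α / ν x :=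
      div_le_div_of_nonneg_left (by positivity) (hνpos x) (hi x hx.le)
    simp only [hT]; linarith
  have hTpos : ∀ x, |x| < p → 0 < T x := fun x hx => lt_of_lt_of_le (by positivity) (hT0 x hx)
  have hTH : ∀ x, hdist E x ≤ T x := fun x => by
    have : 0 < A * α / ν x := div_pos (by positivity) (hνpos x)
    simp only [hT]; linarith
  have hTup : ∀ x, |x| < p → T x ≤ hdist E x + A * α / νm := fun x hx => by
    have : A * α / ν x ≤ A * α / νm :=
      div_le_div_of_nonneg_left (by positivity) hνm (lo x hx.le)
    simp only [hT]; linarith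
  have hs0 : 0 ≤ 1 - γ := by linarith
  refine ⟨fun x => ν x ^ (1 - γ) * T x ^ (-γ), ?_, ⟨νM ^ (1 - γ) * (A * α / νM) ^ (-γ), ?_⟩,
    ?_, ?_⟩
  · intro x hx
    have hxp := hB x hx
    have h1 : T x ≤ 2 * p + A / νm := by
      have h2 := hTup x hxp
      have h3 := h.hdist_le hxp h.mem
      have h4 : |x - p| ≤ 2 * p := by
        rw [abs_lt] at hxp; rw [abs_le]; constructor <;> linarith
      have h5 : A * α / νm ≤ A / νm := by
        gcongr; nlinarith [hα1.2]
      linarith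
    have h0 := hTpos x hxp
    have := hνpos x
    have := lo x hxp.le
    refine mul_le_mul (Real.rpow_le_rpow (by positivity) (by assumption) hs0) ?_
      (by positivity) (by positivity)
    exact Real.rpow_le_rpow_of_nonpos (by assumption) h1 (by linarith)
  · intro x hx
    have hxp := hB x hx
    have := hi x hxp.le
    have := hνpos x
    have h0 := hTpos x hxp
    refine mul_le_mul (Real.rpow_le_rpow (by positivity) (by assumption) hs0) ?_
      (by positivity) (by positivity)
    exact Real.rpow_le_rpow_of_nonpos (by positivity) (hT0 x hxp) (by linarith)
  · intro x hx hx6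
    have hxp := hB x hx
    have := hi x hxp.le
    have := hνpos x
    have h0 := hTpos x hxp
    refine mul_le_mul (Real.rpow_le_rpow (by positivity) (by assumption) hs0) ?_
      (by positivity) (by positivity)
    exact Real.rpow_le_rpow_of_nonpos (by positivity)
        ((near0 x hxp (hx6.trans hα6)).trans (hTH x)) (by linarith)
  · intro x hx ψ hψ hx6
    have hxp := hB x hx
    have hx₁ := hB _ (htr α hα hαt.2 x hx ψ hψ)
    have hw : 0 < |x| := lt_of_lt_of_le (by positivity) hx6
    have hx0 : x ≠ 0 := abs_pos.1 hw
    have hfp := h.abs_map_lt hxp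
    have ht : |α * ψ| ≤ α := by rw [abs_mul, abs_of_pos hα]; nlinarith
    have hH1 : hdist E (a - x ^ 2 + α * ψ) ≤ hdist E (a - x ^ 2) + α := by
      have := h.hdist_lipschitz hfp hx₁
      rw [add_sub_cancel_left] at this
      linarith
    have hst := h.hdist_step hstep hg hxp hx0
    have hHx := h.hdist_nonneg hxp
    have hHf := h.hdist_nonneg hfp
    set x₁ := a - x ^ 2 + α * ψ with hx₁def
    have hν₁lo := lo x₁ hx₁.le
    have hνhi := hi x hxp.le
    have hT1K : T x₁ ≤ hdist E (a - x ^ 2) + K * α := by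
      have := hTup x₁ hx₁
      rw [hK, show (1 + A / νm) * α = α + A * α / νm by ring]
      linarith
    have fin : ∀ U V lam : ℝ, 0 < U → 0 < V → U * ν x ≤ 2 * |x| * ν x₁ →
        V * T x₁ ≤ 2 * |x| * T x → lam ≤ U ^ (1 - γ) * V ^ γ →
        lam * (ν x ^ (1 - γ) * T x ^ (-γ)) ≤ 2 * |x| * (ν x₁ ^ (1 - γ) * T x₁ ^ (-γ)) :=
      fun U V lam hU hV e1 e2 e3 => le_mul_density_of_ratios (by linarith) hγ1.le (hνpos x)
        (hTpos x hxp) (hTpos x₁ hx₁) (by positivity) hU (hνpos x₁) hV e1 e2 e3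
    have hUgen : ∀ w, 0 ≤ w → w ≤ |x| → m₁ * w * ν x ≤ 2 * |x| * ν x₁ := fun w hw0 hwx => by
      calc m₁ * w * ν x ≤ m₁ * |x| * νM := by
            have := (hνpos x).le
            gcongr
        _ = 2 * |x| * νm := by rw [hm₁]; field_simp
        _ ≤ _ := by gcongr
    by_cases hnear : ∃ e ∈ E, |e| < p ∧ |x - e| < η
    · obtain ⟨e, he, hep, hxe⟩ := hnear
      have hU := hexp e he hep x (α * ψ) hxe (ht.trans_lt hαη.2)
      apply fin b 1 _ (by linarith) one_pos hU _ ((min_le_left _ _).trans ((min_le_left _ _).trans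
        (by simp)))
      rw [one_mul]
      have h1 : hdist E (a - x ^ 2) ≤ 2 * |x| * hdist E x := by
        have : 0 ≤ hdist E (a - x ^ 2) * (g * hdist E x) := by positivity
        linarith
      have h2 : b * (A * α / ν x₁) ≤ 2 * |x| * (A * α / ν x) := by
        rw [mul_div_assoc', mul_div_assoc', div_le_div_iff₀ (hνpos _) (hνpos _)]
        have := mul_le_mul_of_nonneg_left hU (show 0 ≤ A * α by positivity)
        linarith
      have h3 : α ≤ (b - 1) * (A * α / ν x₁) := by
        have hb1 : 0 < b - 1 := by linarith
        have := hνpos x₁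
        rw [hA, show (b - 1) * (νM / (b - 1) * α / ν x₁) = α * (νM / ν x₁) by field_simp]
        have : 1 ≤ νM / ν x₁ := by rw [one_le_div this]; exact hi x₁ hx₁.le
        nlinarith
      simp only [hT]
      linarith
    · by_cases hsm : |x| < η₀
      · have hlt1 : |x| < η₁ := hsm.trans_le ((min_le_left _ _).trans (min_le_left _ _))
        have hlt2 : |x| < z / 2 := hsm.trans_le ((min_le_left _ _).trans (min_le_right _ _))
        have hlt3 : |x| < 1 := hsm.trans_le (min_le_right _ _)
        apply fin (m₁ * |x|) (m₃ * |x| ^ (-(2 / 3) : ℝ)) _ (by positivity) (by positivity)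
          (hUgen _ hw.le le_rfl) _ ((min_le_right _ _).trans (hreg3 _ hw hlt1 γ hγ hγ1.le))
        have hαx : α ≤ |x| ^ (5 / 3 : ℝ) := by
          have := Real.rpow_le_rpow (by positivity) hx6 (show (0 : ℝ) ≤ 5 / 3 by norm_num)
          rw [← Real.rpow_mul hα.le] at this
          norm_num at this
          exact this
        have hxx : x ^ 2 ≤ |x| ^ (5 / 3 : ℝ) := by
          rw [← sq_abs, ← Real.rpow_natCast]
          exact Real.rpow_le_rpow_of_exponent_ge hw hlt3.le (by norm_num)
        have hf0 : hdist E (a - x ^ 2) ≤ x ^ 2 := by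
          have := h.hdist_le hfp h.crit
          rwa [show a - x ^ 2 - a = -x ^ 2 by ring, abs_neg, abs_of_nonneg (sq_nonneg x)] at this
        have hT1 : T x₁ ≤ (1 + K) * |x| ^ (5 / 3 : ℝ) := by
          have := mul_le_mul_of_nonneg_left hαx hK0.le
          linarith
        calc m₃ * |x| ^ (-(2 / 3) : ℝ) * T x₁
            ≤ m₃ * |x| ^ (-(2 / 3) : ℝ) * ((1 + K) * |x| ^ (5 / 3 : ℝ)) := by gcongr
          _ = (m₃ * (1 + K)) * (|x| ^ (-(2 / 3) : ℝ) * |x| ^ (5 / 3 : ℝ)) := by ring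
          _ = (z / 2) * |x| := by
            rw [← Real.rpow_add hw, hm₃, show (-(2 / 3) : ℝ) + 5 / 3 = 1 by norm_num,
              Real.rpow_one]
            field_simp
          _ ≤ 2 * |x| * T x := by
            have := (near0 x hxp hlt2.le).trans (hTH x)
            nlinarith
      · push Not at hsm hnear
        have hfar : r / 2 ≤ hdist E x := by
          apply h.half_le_hdist hxp hr0
          intro e he
          by_cases hep : |e| < p
          · exact (min_le_left _ _).trans (hnear e he hep)
          · have h1 : |e| - |x| ≤ |x - e| := by
              rw [abs_sub_comm]; exact abs_sub_abs_le_abs_sub e x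
            have h2 := abs_le.2 hx
            have h3 := min_le_right η (p - β)
            linarith
        apply fin (m₁ * η₀) (1 + G / 2) _ (by positivity) (by positivity)
          (hUgen _ hη₀0.le hsm) _ ((min_le_left _ _).trans ((min_le_right _ _).trans hlam₂'))
        have h1 : hdist E (a - x ^ 2) * (1 + G) ≤ 2 * |x| * hdist E x := by
          refine le_trans ?_ hst
          gcongr
          rw [hG]; gcongr
        have h2 : η₀ * r ≤ 2 * |x| * hdist E x := by
          calc η₀ * r = 2 * η₀ * (r / 2) := by ring
            _ ≤ _ := by gcongr
        have h3 : (1 + G / 2) * K * α * (1 + G) ≤ 2 * |x| * hdist E x * (G / 2) :=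
          hαG.trans (by gcongr)
        have h4 : (1 + G / 2) * T x₁ ≤ 2 * |x| * hdist E x := by
          have h5 : (1 + G / 2) * T x₁ * (1 + G) ≤ 2 * |x| * hdist E x * (1 + G) := by
            calc (1 + G / 2) * T x₁ * (1 + G)
                ≤ (1 + G / 2) * (hdist E (a - x ^ 2) + K * α) * (1 + G) := by gcongr
              _ = (1 + G / 2) * (hdist E (a - x ^ 2) * (1 + G)) +
                  (1 + G / 2) * K * α * (1 + G) := by ring
              _ ≤ (1 + G / 2) * (2 * |x| * hdist E x) + 2 * |x| * hdist E x * (G / 2) := by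
                gcongr
              _ = _ := by ring
          exact le_of_mul_le_mul_right h5 (by linarith)
        exact h4.trans (by gcongr; exact hTH x)

lemma prod_abs_one_add_le {t : ℕ → ℝ} {n : ℕ} {τ : ℝ}
    (hs : ∑ k ∈ Finset.range n, |t k| ≤ τ) :
    ∏ k ∈ Finset.range n, |1 + t k| ≤ Real.exp τ := by
  calc ∏ k ∈ Finset.range n, |1 + t k| ≤ ∏ k ∈ Finset.range n, Real.exp |t k| := by
        apply Finset.prod_le_prod (fun _ _ => abs_nonneg _)
        intro k _
        have h1 := abs_add_le 1 (t k)
        rw [abs_one] at h1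
        have := Real.add_one_le_exp |t k|
        linarith
    _ = Real.exp (∑ k ∈ Finset.range n, |t k|) := (Real.exp_sum _ _).symm
    _ ≤ _ := Real.exp_le_exp.2 hs

lemma exp_neg_le_prod_abs_one_add {t : ℕ → ℝ} {n : ℕ} {τ : ℝ}
    (h : ∀ k < n, |t k| ≤ 1 / 2) (hs : ∑ k ∈ Finset.range n, |t k| ≤ τ) :
    Real.exp (-(2 * τ)) ≤ ∏ k ∈ Finset.range n, |1 + t k| := by
  calc Real.exp (-(2 * τ)) ≤ Real.exp (∑ k ∈ Finset.range n, -(2 * |t k|)) := by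
        apply Real.exp_le_exp.2
        rw [Finset.sum_neg_distrib, ← Finset.mul_sum]
        linarith
    _ = ∏ k ∈ Finset.range n, Real.exp (-(2 * |t k|)) := Real.exp_sum _ _
    _ ≤ _ := by
      apply Finset.prod_le_prod (fun _ _ => (Real.exp_pos _).le)
      intro k hk
      have hk' := h k (Finset.mem_range.1 hk)
      have h1 : 1 - |t k| ≤ |1 + t k| := by
        have := abs_sub_abs_le_abs_sub 1 (-t k)
        rwa [abs_one, abs_neg, sub_neg_eq_add] at this
      refine le_trans ?_ h1
      have h0 := abs_nonneg (t k)
      have h2 : 1 + 2 * |t k| ≤ Real.exp (2 * |t k|) := by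
        have := Real.add_one_le_exp (2 * |t k|); linarith
      rw [Real.exp_neg, inv_le_comm₀ (Real.exp_pos _) (by linarith)]
      refine le_trans ?_ h2
      rw [inv_le_iff_one_le_mul₀ (by linarith)]
      nlinarith

lemma abs_prod_one_add_sub_one_le {t : ℕ → ℝ} {n : ℕ} {τ : ℝ}
    (hs : ∑ k ∈ Finset.range n, |t k| ≤ τ) :
    |∏ k ∈ Finset.range n, (1 + t k) - 1| ≤ τ * Real.exp τ := by
  have h1 := Finset.norm_prod_one_add_sub_one_le (Finset.range n) t
  simp only [Real.norm_eq_abs] at h1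
  have h2 : Real.exp (∑ k ∈ Finset.range n, |t k|) ≤ Real.exp τ := Real.exp_le_exp.2 hs
  have h3 : Real.exp τ - 1 ≤ τ * Real.exp τ := by
    have := Real.add_one_le_exp (-τ)
    have h4 : Real.exp (-τ) * Real.exp τ = 1 := by rw [← Real.exp_add]; simp
    nlinarith [Real.exp_pos τ]
  linarith

/-- Along two sequences that separate at a definite rate, up to an error `2α`, the total distance
is controlled by the final distance. -/
lemma sum_abs_sub_le {x X w : ℕ → ℝ} {μ m W α : ℝ} {n : ℕ} (hμ : 1 < μ) (hm : 0 < m)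
    (hw : ∀ k, m ≤ w k ∧ w k ≤ W) (hα : 0 ≤ α)
    (hexp : ∀ k < n, μ * w k ≤ |x k + X k| * w (k + 1))
    (hd : ∀ k < n, |x (k + 1) - X (k + 1) + (x k ^ 2 - X k ^ 2)| ≤ 2 * α) :
    ∑ k ∈ Finset.range n, |x k - X k| ≤ W / (m * (μ - 1)) * (|x n - X n| + 2 * α * n) := by
  have hW : 0 < W := hm.trans_le ((hw 0).1.trans (hw 0).2)
  have step : ∀ k < n,
      μ * (w k * |x k - X k|) ≤ w (k + 1) * |x (k + 1) - X (k + 1)| + 2 * α * W := by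
    intro k hk
    have h1 := hexp k hk
    have h2 := hd k hk
    have h3 : |x k + X k| * |x k - X k| ≤ |x (k + 1) - X (k + 1)| + 2 * α := by
      rw [← abs_mul]
      have : (x k + X k) * (x k - X k) = (x (k + 1) - X (k + 1) + (x k ^ 2 - X k ^ 2)) -
        (x (k + 1) - X (k + 1)) := by ring
      rw [this]
      linarith [abs_sub (x (k + 1) - X (k + 1) + (x k ^ 2 - X k ^ 2)) (x (k + 1) - X (k + 1))]
    calc μ * (w k * |x k - X k|) = μ * w k * |x k - X k| := by ring
      _ ≤ |x k + X k| * w (k + 1) * |x k - X k| := by gcongr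
      _ = w (k + 1) * (|x k + X k| * |x k - X k|) := by ring
      _ ≤ w (k + 1) * (|x (k + 1) - X (k + 1)| + 2 * α) := by
        have := hm.le.trans (hw (k + 1)).1
        gcongr
      _ ≤ _ := by nlinarith [(hw (k + 1)).2]
  set S := ∑ k ∈ Finset.range n, w k * |x k - X k| with hS
  have hsum : μ * S ≤
      ∑ k ∈ Finset.range n, w (k + 1) * |x (k + 1) - X (k + 1)| + n * (2 * α * W) := by
    rw [hS, Finset.mul_sum]
    refine (Finset.sum_le_sum fun k hk => step k (Finset.mem_range.1 hk)).trans ?_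
    rw [Finset.sum_add_distrib]
    simp
  have htel : ∑ k ∈ Finset.range n, w (k + 1) * |x (k + 1) - X (k + 1)| =
      S + w n * |x n - X n| - w 0 * |x 0 - X 0| := by
    have := Finset.sum_range_sub (fun k => w k * |x k - X k|) n
    rw [Finset.sum_sub_distrib] at this
    linarith
  have h0 : 0 ≤ w 0 * |x 0 - X 0| := mul_nonneg (hm.le.trans (hw 0).1) (abs_nonneg _)
  have hn : w n * |x n - X n| ≤ W * |x n - X n| := by gcongr; exact (hw n).2
  have h1 : (μ - 1) * S ≤ W * (|x n - X n| + 2 * α * n) := by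
    rw [htel] at hsum; nlinarith
  have h2 : m * ∑ k ∈ Finset.range n, |x k - X k| ≤ S := by
    rw [hS, Finset.mul_sum]
    exact Finset.sum_le_sum fun k _ => by gcongr; exact (hw k).1
  have h3 : 0 < m * (μ - 1) := mul_pos hm (by linarith)
  rw [div_mul_eq_mul_div, le_div_iff₀ h3]
  nlinarith

/-- An expanding (weighted) orbit of `x ↦ a - x²`. -/
structure ExpandingOrbit (a : ℝ) (c w : ℕ → ℝ) (μ m W cm p : ℝ) : Prop where
  one_lt : 1 < μ
  m_pos : 0 < m
  cm_pos : 0 < cm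
  weight : ∀ k, m ≤ w k ∧ w k ≤ W
  orbit : ∀ k, c (k + 1) = a - c k ^ 2
  expand : ∀ k, μ * w k ≤ 2 * |c k| * w (k + 1)
  away : ∀ k, cm ≤ |c k|
  bound : ∀ k, |c k| ≤ p

lemma PostcritSet.expandingOrbit {a p : ℝ} {E : Set ℝ} (h : PostcritSet a p E) {c : ℕ → ℝ}
    (hcE : ∀ k, c k ∈ E) (hcp : ∀ k, |c k| < p) (hc : ∀ k, c (k + 1) = a - c k ^ 2) :
    ∃ w μ m W cm, ExpandingOrbit a c w μ m W cm p := by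
  obtain ⟨g, hg, hstep⟩ := h.exists_hyp_step
  obtain ⟨z, hz, hgap⟩ := h.exists_gap
  have hPf : {e | e ∈ E ∧ |e| < p}.Finite := h.finite.subset fun e he => he.1
  have hPn : {e | e ∈ E ∧ |e| < p}.Nonempty := ⟨c 0, hcE 0, hcp 0⟩
  obtain ⟨em, hem, hmin⟩ := Set.exists_min_image _ (hyp E) hPf hPn
  obtain ⟨eM, heM, hmax⟩ := Set.exists_max_image _ (hyp E) hPf hPn
  have hm := h.hyp_pos hem.2
  have hM := h.hyp_pos heM.2
  refine ⟨fun k => hyp E (c k), 1 + g / hyp E eM, hyp E em, hyp E eM, z, ?_, hm, hz,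
    fun k => ⟨hmin _ ⟨hcE k, hcp k⟩, hmax _ ⟨hcE k, hcp k⟩⟩, hc, ?_, ?_, fun k => (hcp k).le⟩
  · have : 0 < g / hyp E eM := by positivity
    linarith
  · intro k
    have h1 := hstep (c k) (hcp k) (fun h0 => h.zero (h0 ▸ hcE k))
    simp only [hc]
    refine le_trans ?_ h1
    have h2 : hyp E (c k) ≤ hyp E eM := hmax _ ⟨hcE k, hcp k⟩
    have : g / hyp E eM * hyp E (c k) ≤ g := by
      rw [div_mul_eq_mul_div, div_le_iff₀ hM]; gcongr
    linarith
  · intro k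
    have hne : c k ≠ 0 := fun h0 => h.zero (h0 ▸ hcE k)
    rcases lt_or_gt_of_ne hne with hn | hn
    · rw [abs_of_neg hn]
      have := hgap (c k) (mem_insert_of_mem _ (hcE k)) 0 (mem_insert _ _) hn; linarith
    · rw [abs_of_pos hn]
      have := hgap 0 (mem_insert _ _) (c k) (mem_insert_of_mem _ (hcE k)) hn; linarith

/-- `x 0, …, x N` is an `α`-pseudo-orbit of `x ↦ a - x²` starting close to `c₀`. -/
def PseudoOrbit (a α c₀ : ℝ) (N : ℕ) (x : ℕ → ℝ) : Prop :=
  |x 0 - c₀| ≤ 2 * α ∧ ∀ k < N, |x (k + 1) - (a - x k ^ 2)| ≤ α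

namespace ExpandingOrbit

variable {a μ m W cm p : ℝ} {c w : ℕ → ℝ}

lemma W_pos (h : ExpandingOrbit a c w μ m W cm p) : 0 < W :=
  h.m_pos.trans_le ((h.weight 0).1.trans (h.weight 0).2)

lemma p_pos (h : ExpandingOrbit a c w μ m W cm p) : 0 < p :=
  h.cm_pos.trans_le ((h.away 0).trans (h.bound 0))

lemma exists_tube (h : ExpandingOrbit a c w μ m W cm p) :
    ∃ κ > 0, κ ≤ cm / 4 ∧ ∀ k, ∀ x y : ℝ, |x - c k| ≤ κ → |y - c k| ≤ κ →
      (1 + μ) / 2 * w k ≤ |x + y| * w (k + 1) ∧ cm ≤ |x + y| := by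
  have hW := h.W_pos
  have hm := h.m_pos
  have hμ := h.one_lt
  have hc := h.cm_pos
  refine ⟨min ((μ - 1) * m / (4 * W)) (cm / 4), lt_min ?_ (by linarith), min_le_right _ _, ?_⟩
  · have : 0 < μ - 1 := by linarith
    positivity
  intro k x y hx hy
  set κ := min ((μ - 1) * m / (4 * W)) (cm / 4)
  have k1 : κ ≤ (μ - 1) * m / (4 * W) := min_le_left _ _
  have k2 : κ ≤ cm / 4 := min_le_right _ _
  have h1 : 2 * |c k| - 2 * κ ≤ |x + y| := by
    have e1 : |2 * c k| - |x + y| ≤ |2 * c k - (x + y)| := abs_sub_abs_le_abs_sub _ _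
    have e2 : 2 * c k - (x + y) = -((x - c k) + (y - c k)) := by ring
    have e3 := abs_add_le (x - c k) (y - c k)
    rw [e2, abs_neg, abs_mul, abs_two] at e1
    linarith
  refine ⟨?_, by linarith [h.away k]⟩
  have h2 := h.expand k
  obtain ⟨w1, w2⟩ := h.weight (k + 1)
  obtain ⟨v1, v2⟩ := h.weight k
  rw [le_div_iff₀ (by positivity)] at k1
  have hκ : 0 < κ := lt_min (by have : 0 < μ - 1 := by linarith
                                positivity) (by linarith)
  have h3 : (2 * |c k| - 2 * κ) * w (k + 1) ≤ |x + y| * w (k + 1) := by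
    have : 0 ≤ w (k + 1) := by linarith
    gcongr
  have h4 : 2 * κ * w (k + 1) ≤ (μ - 1) / 2 * w k := by
    calc 2 * κ * w (k + 1) ≤ 2 * κ * W := by gcongr
      _ ≤ (μ - 1) / 2 * m := by linarith
      _ ≤ _ := by
        have : 0 < μ - 1 := by linarith
        gcongr
  linarith

lemma distortion (h : ExpandingOrbit a c w μ m W cm p) {κ s : ℝ} (hκ : κ ≤ cm / 4) {n : ℕ}
    {x y : ℕ → ℝ} (hx : ∀ k < n, |x k - c k| ≤ κ) (hy : ∀ k < n, |y k - c k| ≤ κ)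
    (hsx : ∑ k ∈ Finset.range n, |x k - c k| ≤ s) (hsy : ∑ k ∈ Finset.range n, |y k - c k| ≤ s) :
    (∏ k ∈ Finset.range n, 2 * |c k|) * Real.exp (-(2 * (s / cm))) ≤
        ∏ k ∈ Finset.range n, |x k + y k| ∧
      ∏ k ∈ Finset.range n, |x k + y k| ≤
        (∏ k ∈ Finset.range n, 2 * |c k|) * Real.exp (s / cm) := by
  have hcm := h.cm_pos
  set t : ℕ → ℝ := fun k => ((x k - c k) + (y k - c k)) / (2 * c k) with ht
  have hck : ∀ k, c k ≠ 0 := fun k h0 => by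
    have := h.away k; rw [h0, abs_zero] at this; linarith
  have heq : ∏ k ∈ Finset.range n, |x k + y k| =
      (∏ k ∈ Finset.range n, 2 * |c k|) * ∏ k ∈ Finset.range n, |1 + t k| := by
    rw [← Finset.prod_mul_distrib]
    refine Finset.prod_congr rfl fun k _ => ?_
    rw [← abs_two (α := ℝ), ← abs_mul, ← abs_mul]
    congr 1
    simp only [ht]
    have := hck k
    field_simp
    ring
  have hbd : ∀ k, |t k| ≤ (|x k - c k| + |y k - c k|) / (2 * cm) := fun k => by
    simp only [ht]
    rw [abs_div, abs_mul, abs_two]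
    gcongr
    · exact abs_add_le _ _
    · exact h.away k
  have hsum : ∑ k ∈ Finset.range n, |t k| ≤ s / cm := by
    refine (Finset.sum_le_sum fun k _ => hbd k).trans ?_
    rw [← Finset.sum_div, Finset.sum_add_distrib, div_le_div_iff₀ (by positivity) hcm]
    nlinarith
  have hsmall : ∀ k < n, |t k| ≤ 1 / 2 := fun k hk => by
    refine (hbd k).trans ?_
    rw [div_le_iff₀ (by positivity)]
    linarith [hx k hk, hy k hk]
  have hD : 0 ≤ ∏ k ∈ Finset.range n, 2 * |c k| := Finset.prod_nonneg fun _ _ => by positivity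
  rw [heq]
  exact ⟨mul_le_mul_of_nonneg_left (exp_neg_le_prod_abs_one_add hsmall hsum) hD,
    mul_le_mul_of_nonneg_left (prod_abs_one_add_le hsum) hD⟩

lemma le_prod (h : ExpandingOrbit a c w μ m W cm p) (n : ℕ) :
    μ ^ n * (m / W) ≤ ∏ k ∈ Finset.range n, 2 * |c k| := by
  have hμ := h.one_lt
  have key : μ ^ n * w 0 ≤ (∏ k ∈ Finset.range n, 2 * |c k|) * w n := by
    induction n with
    | zero => simp
    | succ n ih =>
      rw [Finset.prod_range_succ, pow_succ]
      have hD : 0 ≤ ∏ k ∈ Finset.range n, 2 * |c k| :=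
        Finset.prod_nonneg fun _ _ => by positivity
      calc μ ^ n * μ * w 0 = μ * (μ ^ n * w 0) := by ring
        _ ≤ μ * ((∏ k ∈ Finset.range n, 2 * |c k|) * w n) := by gcongr
        _ = (∏ k ∈ Finset.range n, 2 * |c k|) * (μ * w n) := by ring
        _ ≤ (∏ k ∈ Finset.range n, 2 * |c k|) * (2 * |c n| * w (n + 1)) := by
          have := h.expand n
          gcongr
        _ = _ := by ring
  have hD : 0 ≤ ∏ k ∈ Finset.range n, 2 * |c k| := Finset.prod_nonneg fun _ _ => by positivity
  rw [mul_div_assoc', div_le_iff₀ h.W_pos]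
  calc μ ^ n * m ≤ μ ^ n * w 0 := by gcongr; exact (h.weight 0).1
    _ ≤ _ := key
    _ ≤ _ := by gcongr; exact (h.weight n).2

/-- Pseudo-orbits stay in the tube as long as the accumulated expansion is at most `κ' / α`. -/
lemma mem_tube (h : ExpandingOrbit a c w μ m W cm p) {κ α S K : ℝ} {N : ℕ} (hα : 0 < α)
    (hκ4 : κ ≤ cm / 4)
    (htube : ∀ k, ∀ x y : ℝ, |x - c k| ≤ κ → |y - c k| ≤ κ →
      (1 + μ) / 2 * w k ≤ |x + y| * w (k + 1) ∧ cm ≤ |x + y|)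
    (hS : S = W / (m * ((1 + μ) / 2 - 1)) * (κ + 2) + κ)
    (hK : K = 2 + W / ((1 + μ) / 2 - 1) / m)
    (hαN : α * N ≤ 1) (hακ : 2 * α ≤ κ)
    (hD : ∀ n ≤ N, α * (K * Real.exp (S / cm)) * ∏ k ∈ Finset.range n, 2 * |c k| ≤ κ)
    {x : ℕ → ℝ} (hx : PseudoOrbit a α (c 0) N x) :
    ∀ n ≤ N, |x n - c n| ≤ κ := by
  have hμ := h.one_lt
  have hμ' : 0 < (1 + μ) / 2 - 1 := by linarith
  have hm := h.m_pos
  have hW := h.W_pos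
  have hK0 : 0 < K := by rw [hK]; positivity
  set μ' := (1 + μ) / 2 with hμdef
  set b := W / (μ' - 1) with hb
  have hb0 : 0 < b := by positivity
  intro n
  induction n using Nat.strong_induction_on with
  | _ n ih =>
  intro hn
  rcases Nat.eq_zero_or_pos n with rfl | hpos
  · exact hx.1.trans hακ
  have hin : ∀ k < n, |x k - c k| ≤ κ := fun k hk => ih k hk (hk.le.trans hn)
  have hκ0 : 0 ≤ κ := by linarith
  have hck : ∀ k, |c k - c k| ≤ κ := fun k => by simpa using hκ0
  have hest : ∀ j ≤ n, |x j - c j| ≤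
      α * (K * ∏ k ∈ Finset.range j, |x k + c k| - b / w j) := by
    intro j
    induction j with
    | zero =>
      intro _
      refine hx.1.trans ?_
      have : b / w 0 ≤ b / m := by gcongr; exact (h.weight 0).1
      simp only [Finset.range_zero, Finset.prod_empty]
      rw [hK]; nlinarith
    | succ j ihj =>
      intro hj
      have h1 := ihj (by omega)
      have h2 := (htube j _ _ (hin j (by omega)) (hck j)).1
      have h3 := hx.2 j (by omega)
      have w0 : 0 < w j := hm.trans_le (h.weight j).1
      have w1 : 0 < w (j + 1) := hm.trans_le (h.weight (j + 1)).1
      have h4 : |x (j + 1) - c (j + 1)| ≤ |x j + c j| * |x j - c j| + α := by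
        rw [← abs_mul, h.orbit j]
        have : x (j + 1) - (a - c j ^ 2) =
          (x (j + 1) - (a - x j ^ 2)) - (x j + c j) * (x j - c j) := by ring
        rw [this]
        linarith [abs_sub (x (j + 1) - (a - x j ^ 2)) ((x j + c j) * (x j - c j))]
      have h5 : b / w (j + 1) + 1 ≤ |x j + c j| * (b / w j) := by
        have h6 : μ' / w (j + 1) ≤ |x j + c j| / w j := by
          rw [div_le_div_iff₀ w1 w0]; exact h2
        have h7 : 1 ≤ b * (μ' - 1) / w (j + 1) := by
          rw [one_le_div w1, hb, div_mul_cancel₀ _ hμ'.ne']; exact (h.weight _).2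
        calc b / w (j + 1) + 1 ≤ b / w (j + 1) + b * (μ' - 1) / w (j + 1) := by linarith
          _ = b * (μ' / w (j + 1)) := by ring
          _ ≤ b * (|x j + c j| / w j) := by gcongr
          _ = _ := by ring
      rw [Finset.prod_range_succ]
      calc _ ≤ |x j + c j| * |x j - c j| + α := h4
        _ ≤ |x j + c j| * (α * (K * ∏ k ∈ Finset.range j, |x k + c k| - b / w j)) + α := by
          gcongr
        _ = α * (K * ((∏ k ∈ Finset.range j, |x k + c k|) * |x j + c j|) -
            (|x j + c j| * (b / w j) - 1)) := by ring
        _ ≤ _ := by gcongr; linarith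
  have hsum : ∑ k ∈ Finset.range n, |x k - c k| ≤ S := by
    obtain ⟨l, rfl⟩ : ∃ l, n = l + 1 := ⟨n - 1, by omega⟩
    rw [Finset.sum_range_succ]
    have h1 := sum_abs_sub_le (x := x) (X := c) (w := w) (n := l) (show 1 < μ' by linarith) hm
      h.weight hα.le (fun k hk => (htube k _ _ (hin k (by omega)) (hck k)).1) (fun k hk => by
        have h3 := hx.2 k (by omega)
        rw [h.orbit k, show x (k + 1) - (a - c k ^ 2) + (x k ^ 2 - c k ^ 2) =
          x (k + 1) - (a - x k ^ 2) by ring]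
        linarith)
    have h2 := hin l (by omega)
    have h3 : α * l ≤ 1 := by
      refine le_trans ?_ hαN
      gcongr
      omega
    rw [hS]
    refine add_le_add (h1.trans ?_) h2
    gcongr
    linarith
  have hdist := (h.distortion hκ4 hin (fun k _ => hck k) hsum (by
    simp only [sub_self, abs_zero, Finset.sum_const_zero]
    rw [hS]; positivity)).2
  have hwn : 0 < w n := hm.trans_le (h.weight n).1
  calc |x n - c n| ≤ α * (K * ∏ k ∈ Finset.range n, |x k + c k| - b / w n) := hest n le_rfl
    _ ≤ α * (K * ∏ k ∈ Finset.range n, |x k + c k|) := by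
      gcongr
      have : 0 < b / w n := by positivity
      linarith
    _ ≤ α * (K * ((∏ k ∈ Finset.range n, 2 * |c k|) * Real.exp (S / cm))) := by gcongr
    _ = α * (K * Real.exp (S / cm)) * ∏ k ∈ Finset.range n, 2 * |c k| := by ring
    _ ≤ κ := hD n hn

end ExpandingOrbit

lemma sub_eq_prod_mul_sub {x y : ℕ → ℝ} {N : ℕ}
    (h : ∀ k < N, x (k + 1) + x k ^ 2 = y (k + 1) + y k ^ 2) :
    x N - y N = (-1) ^ N * (∏ k ∈ Finset.range N, (x k + y k)) * (x 0 - y 0) := by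
  induction N with
  | zero => simp
  | succ N ih =>
    have h1 := h N (by omega)
    rw [Finset.prod_range_succ, pow_succ]
    have h2 := ih fun k hk => h k (by omega)
    have : x (N + 1) - y (N + 1) = -(x N + y N) * (x N - y N) := by linarith
    rw [this, h2]
    ring

set_option maxHeartbeats 800000 in
lemma ExpandingOrbit.exists_escape_time {a μ m W cm p : ℝ} {c w : ℕ → ℝ}
    (h : ExpandingOrbit a c w μ m W cm p) :
    ∃ C : ℝ, 0 < C ∧ ∀ᶠ α in nhdsWithin (0 : ℝ) (Ioi 0), ∃ N : ℕ, (N : ℝ) ≤ C * Real.log α⁻¹ ∧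
      (∀ x, PseudoOrbit a α (c 0) N x →
        1 / (C * α) ≤ ∏ k ∈ Finset.range N, 2 * |x k|) ∧
      ∀ x y X Y, PseudoOrbit a α (c 0) N x → PseudoOrbit a α (c 0) N y →
        PseudoOrbit a α (c 0) N X → PseudoOrbit a α (c 0) N Y →
        (∀ k < N, x (k + 1) + x k ^ 2 = y (k + 1) + y k ^ 2) →
        (∀ k < N, X (k + 1) + X k ^ 2 = Y (k + 1) + Y k ^ 2) →
        ∀ ε : ℝ, 0 ≤ ε → ε ≤ 1 → |x N - X N| ≤ 2 * ε → |y N - Y N| ≤ 2 * ε →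
          |(x 0 - y 0) - (X 0 - Y 0)| ≤ C * α * (ε + α * N) := by
  obtain ⟨κ, hκ, hκ4, htube⟩ := h.exists_tube
  have hμ := h.one_lt
  have hμ' : 0 < (1 + μ) / 2 - 1 := by linarith
  have hm := h.m_pos
  have hW := h.W_pos
  have hp := h.p_pos
  have hcm := h.cm_pos
  have hlog : 0 < Real.log μ := Real.log_pos hμ
  set Ks := W / (m * ((1 + μ) / 2 - 1)) with hKs
  have hKs0 : 0 < Ks := by positivity
  set S := Ks * (κ + 2) + κ with hS
  set K := 2 + W / ((1 + μ) / 2 - 1) / m with hK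
  have hK0 : 0 < K := by positivity
  set κ' := κ / (K * Real.exp (S / cm)) with hκ'
  have hκ'0 : 0 < κ' := by positivity
  set Ca := 2 * p * Real.exp (2 * (S / cm)) / κ' with hCa
  have hCa0 : 0 < Ca := by positivity
  set C₁ := 2 / Real.log μ with hC₁
  have hC₁0 : 0 < C₁ := by positivity
  set Cb := 16 * Ks / cm * Real.exp (8 * Ks / cm) + 4 * Ca with hCb
  have hCb0 : 0 < Cb := by positivity
  refine ⟨max C₁ (max Ca Cb), by positivity, ?_⟩
  have s1 : Tendsto (fun α : ℝ => Real.log α⁻¹) (nhdsWithin 0 (Ioi 0)) atTop :=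
    Real.tendsto_log_atTop.comp tendsto_inv_nhdsGT_zero
  have s2 : Tendsto (fun α : ℝ => α * (C₁ * Real.log α⁻¹)) (nhdsWithin 0 (Ioi 0)) (nhds 0) := by
    have := (tendsto_log_mul_rpow_nhdsGT_zero (r := 1) one_pos).const_mul (-C₁)
    rw [mul_zero] at this
    refine this.congr fun α => ?_
    rw [Real.log_inv, Real.rpow_one]; ring
  filter_upwards [self_mem_nhdsWithin, Ioo_mem_nhdsGT (show 0 < κ / 2 by positivity),
    Ioo_mem_nhdsGT hκ'0, s1.eventually_ge_atTop (Real.log (κ' * W / m)),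
    s2.eventually_le_const zero_lt_one] with α hα hα1 hα2 hα3 hα4
  rw [mem_Ioi] at hα
  set D : ℕ → ℝ := fun n => ∏ k ∈ Finset.range n, 2 * |c k| with hD
  have hDpos : ∀ n, 0 < D n := fun n =>
    Finset.prod_pos fun k _ => by have := hcm.trans_le (h.away k); positivity
  have hex : ∃ n, κ' / α < D n := by
    have h1 : Tendsto (fun n : ℕ => μ ^ n * (m / W)) atTop atTop :=
      (tendsto_pow_atTop_atTop_of_one_lt hμ).atTop_mul_const (by positivity)
    obtain ⟨n, hn⟩ := (h1.eventually_gt_atTop (κ' / α)).exists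
    exact ⟨n, hn.trans_le (h.le_prod n)⟩
  classical
  have hfind0 : Nat.find hex ≠ 0 := by
    intro h0
    have := Nat.find_spec hex
    rw [h0] at this
    simp only [hD, Finset.range_zero, Finset.prod_empty] at this
    rw [div_lt_one hα] at this
    linarith [hα2.2]
  obtain ⟨N, hN⟩ : ∃ N, Nat.find hex = N + 1 := ⟨Nat.find hex - 1, by omega⟩
  have hN1 : κ' / α < D (N + 1) := hN ▸ Nat.find_spec hex
  have hN2 : ∀ n ≤ N, D n ≤ κ' / α := fun n hn => not_lt.1 (Nat.find_min hex (by omega))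
  have hNlog : (N : ℝ) ≤ C₁ * Real.log α⁻¹ := by
    have h1 := (h.le_prod N).trans (hN2 N le_rfl)
    have h2 : μ ^ N ≤ κ' * W / m * α⁻¹ := by
      rw [mul_div_assoc', div_le_div_iff₀ hW hα] at h1
      rw [← div_eq_mul_inv, div_div, le_div_iff₀ (by positivity)]
      linarith
    have h3 := Real.log_le_log (by positivity) h2
    rw [Real.log_pow, Real.log_mul (by positivity) (by positivity)] at h3
    rw [hC₁, div_mul_eq_mul_div, le_div_iff₀ hlog]
    linarith
  have hαN : α * N ≤ 1 := (mul_le_mul_of_nonneg_left hNlog hα.le).trans hα4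
  have htub : ∀ x, PseudoOrbit a α (c 0) N x → ∀ n ≤ N, |x n - c n| ≤ κ := fun x hx =>
    h.mem_tube hα hκ4 htube hS hK hαN (by linarith [hα1.2]) (fun n hn => by
      have := hN2 n hn
      rw [hκ', div_div, le_div_iff₀ (by positivity)] at this
      simp only [hD] at this
      linarith) hx
  have hsum : ∀ x, PseudoOrbit a α (c 0) N x → ∑ k ∈ Finset.range N, |x k - c k| ≤ S := by
    intro x hx
    have h1 := sum_abs_sub_le (x := x) (X := c) (w := w) (n := N)
      (show 1 < (1 + μ) / 2 by linarith) hm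
      h.weight hα.le (fun k hk => (htube k _ _ (htub x hx k hk.le) (by simpa using hκ.le)).1)
      (fun k hk => by
        have h3 := hx.2 k (by omega)
        rw [h.orbit k, show x (k + 1) - (a - c k ^ 2) + (x k ^ 2 - c k ^ 2) =
          x (k + 1) - (a - x k ^ 2) by ring]
        linarith)
    have h2 := htub x hx N le_rfl
    rw [hS]
    refine h1.trans ?_
    have : Ks * (|x N - c N| + 2 * α * N) ≤ Ks * (κ + 2) := by gcongr; linarith
    linarith
  have hlow : ∀ x y, PseudoOrbit a α (c 0) N x → PseudoOrbit a α (c 0) N y →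
      1 / (Ca * α) ≤ ∏ k ∈ Finset.range N, |x k + y k| := by
    intro x y hx hy
    have h1 := (h.distortion hκ4 (fun k hk => htub x hx k hk.le) (fun k hk => htub y hy k hk.le)
      (hsum x hx) (hsum y hy)).1
    refine le_trans ?_ h1
    have h2 : D (N + 1) ≤ D N * (2 * p) := by
      simp only [hD]
      rw [Finset.prod_range_succ]
      have := (hDpos N).le
      gcongr
      exact h.bound N
    have h3 : κ' / α ≤ D N * (2 * p) := hN1.le.trans h2
    have h4 : 1 / (Ca * α) = κ' / α / (2 * p) * Real.exp (-(2 * (S / cm))) := by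
      rw [hCa, Real.exp_neg]; field_simp
    rw [h4]
    gcongr
    rw [div_le_iff₀ (by positivity)]
    exact h3
  refine ⟨N, hNlog.trans ?_, ?_, ?_⟩
  · have : 0 ≤ Real.log α⁻¹ := by
      by_contra hc
      push Not at hc
      have h1 : C₁ * Real.log α⁻¹ < 0 := mul_neg_of_pos_of_neg hC₁0 hc
      have : (0 : ℝ) ≤ N := Nat.cast_nonneg N
      linarith
    gcongr
    exact le_max_left _ _
  · intro x hx
    have h1 := hlow x x hx hx
    have h2 : ∀ k, |x k + x k| = 2 * |x k| := fun k => by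
      rw [← two_mul, abs_mul, abs_two]
    simp only [h2] at h1
    refine le_trans ?_ h1
    gcongr
    exact (le_max_left _ _).trans (le_max_right _ _)
  · intro x y X Y hx hy hX hY hxy hXY ε hε hε1 hxX hyY
    have haway : ∀ k < N, cm ≤ |X k + Y k| := fun k hk =>
      (htube k _ _ (htub X hX k hk.le) (htub Y hY k hk.le)).2
    have hne : ∀ k < N, X k + Y k ≠ 0 := fun k hk h0 => by
      have := haway k hk; rw [h0, abs_zero] at this; linarith
    have hsd : ∀ z Z, PseudoOrbit a α (c 0) N z → PseudoOrbit a α (c 0) N Z →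
        |z N - Z N| ≤ 2 * ε →
        ∑ k ∈ Finset.range N, |z k - Z k| ≤ Ks * (2 * ε + 2 * α * N) := by
      intro z Z hz hZ hzZ
      have h1 := sum_abs_sub_le (x := z) (X := Z) (w := w) (n := N)
        (show 1 < (1 + μ) / 2 by linarith) hm
        h.weight hα.le (fun k hk => (htube k _ _ (htub z hz k hk.le) (htub Z hZ k hk.le)).1)
        (fun k hk => by
          have h3 := hz.2 k hk
          have h4 := hZ.2 k hk
          rw [show z (k + 1) - Z (k + 1) + (z k ^ 2 - Z k ^ 2) =
            (z (k + 1) - (a - z k ^ 2)) - (Z (k + 1) - (a - Z k ^ 2)) by ring]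
          linarith [abs_sub (z (k + 1) - (a - z k ^ 2)) (Z (k + 1) - (a - Z k ^ 2))])
      exact h1.trans (by gcongr)
    set t : ℕ → ℝ := fun k => if k < N then ((x k - X k) + (y k - Y k)) / (X k + Y k) else 0
      with ht
    have hts : ∑ k ∈ Finset.range N, |t k| ≤ 4 * Ks / cm * (ε + α * N) := by
      have h1 : ∀ k ∈ Finset.range N, |t k| ≤ (|x k - X k| + |y k - Y k|) / cm := by
        intro k hk
        have hk' := Finset.mem_range.1 hk
        simp only [ht, hk', if_true]
        rw [abs_div]
        gcongr
        · exact abs_add_le _ _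
        · exact haway k hk'
      refine (Finset.sum_le_sum h1).trans ?_
      rw [← Finset.sum_div, Finset.sum_add_distrib, div_le_iff₀ hcm]
      have h2 := hsd x X hx hX hxX
      have h3 := hsd y Y hy hY hyY
      have : 4 * Ks / cm * (ε + α * N) * cm = 4 * Ks * (ε + α * N) := by field_simp
      rw [this]
      linarith
    have hprod : (∏ k ∈ Finset.range N, (x k + y k)) =
        (∏ k ∈ Finset.range N, (X k + Y k)) * ∏ k ∈ Finset.range N, (1 + t k) := by
      rw [← Finset.prod_mul_distrib]
      refine Finset.prod_congr rfl fun k hk => ?_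
      have hk' := Finset.mem_range.1 hk
      have := hne k hk'
      simp only [ht, hk', if_true]
      field_simp
      ring
    set R := ∏ k ∈ Finset.range N, (1 + t k)
    set Q := ∏ k ∈ Finset.range N, (X k + Y k) with hQ
    have hR : |R - 1| ≤ 4 * Ks / cm * (ε + α * N) * Real.exp (8 * Ks / cm) := by
      refine (abs_prod_one_add_sub_one_le hts).trans ?_
      have h1 : 4 * Ks / cm * (ε + α * N) ≤ 8 * Ks / cm := by
        calc 4 * Ks / cm * (ε + α * N) ≤ 4 * Ks / cm * 2 := by gcongr; linarith
          _ = _ := by ring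
      gcongr
    have hQlow : 1 / (Ca * α) ≤ |Q| := by
      rw [hQ, Finset.abs_prod]; exact hlow X Y hX hY
    have hQpos : 0 < |Q| := lt_of_lt_of_le (by positivity) hQlow
    have e1 := sub_eq_prod_mul_sub hxy
    have e2 := sub_eq_prod_mul_sub hXY
    rw [hprod] at e1
    set u := x 0 - y 0
    set U := X 0 - Y 0
    have e3 : u - U = -(u * (R - 1)) + (-1) ^ N * ((x N - X N) - (y N - Y N)) / Q := by
      have hQ0 : Q ≠ 0 := abs_pos.1 hQpos
      have : (x N - X N) - (y N - Y N) = (-1) ^ N * Q * (R * u - U) := by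
        linear_combination e1 - e2
      rw [this]
      have hs : ((-1 : ℝ) ^ N) * (-1) ^ N = 1 := by rw [← mul_pow]; simp
      field_simp
      linear_combination (-(R * u - U)) * hs
    have hu : |u| ≤ 4 * α := by
      have : u = (x 0 - c 0) - (y 0 - c 0) := by ring
      rw [this]
      linarith [abs_sub (x 0 - c 0) (y 0 - c 0), hx.1, hy.1]
    have hend : |(x N - X N) - (y N - Y N)| ≤ 4 * ε := by
      linarith [abs_sub (x N - X N) (y N - Y N)]
    have hαN0 : 0 ≤ α * N := by positivity
    rw [e3]
    refine (abs_add_le _ _).trans ?_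
    rw [abs_neg, abs_mul, abs_div, abs_mul, abs_pow, abs_neg, abs_one, one_pow, one_mul]
    have f1 : |u| * |R - 1| ≤
        4 * α * (4 * Ks / cm * (ε + α * N) * Real.exp (8 * Ks / cm)) := by gcongr
    have f2 : |(x N - X N) - (y N - Y N)| / |Q| ≤ 4 * Ca * α * (ε + α * N) := by
      rw [div_le_iff₀ hQpos]
      have h1 : 1 ≤ Ca * α * |Q| := by
        rw [div_le_iff₀ (by positivity)] at hQlow; linarith
      calc _ ≤ 4 * ε := hend
        _ ≤ 4 * (ε + α * N) * 1 := by linarith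
        _ ≤ 4 * (ε + α * N) * (Ca * α * |Q|) := by gcongr
        _ = _ := by ring
    calc _ ≤ _ := add_le_add f1 f2
      _ = Cb * α * (ε + α * N) := by rw [hCb]; ring
      _ ≤ _ := by
        gcongr
        exact (le_max_right _ _).trans (le_max_right _ _)

lemma continuous_qm (a : ℝ) : Continuous (qm a) := by unfold qm; fun_prop

lemma IEnd_succ_bounds {a α : ℝ} (hα : 0 < α) {n : ℕ} {e : ℝ}
    (he : e ∈ Icc (IEnd a α n).1 (IEnd a α n).2) :
    qm a e ∈ Icc (IEnd a α (n + 1)).1 (IEnd a α (n + 1)).2 ∧ 2 * α ≤ len a α (n + 1) := by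
  have hc : IsCompact (qm a '' Icc (IEnd a α n).1 (IEnd a α n).2) :=
    isCompact_Icc.image (continuous_qm a)
  have h1 := csInf_le hc.bddBelow (mem_image_of_mem (qm a) he)
  have h2 := le_csSup hc.bddAbove (mem_image_of_mem (qm a) he)
  refine ⟨⟨?_, ?_⟩, ?_⟩ <;> simp only [IEnd, len] <;> linarith

lemma iterate_mem_IEnd {a α : ℝ} (hα : 0 < α) (n : ℕ) :
    (qm a)^[n + 1] 0 ∈ Icc (IEnd a α n).1 (IEnd a α n).2 := by
  induction n with
  | zero => simp [IEnd]; linarith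
  | succ n ih =>
    rw [Function.iterate_succ_apply']
    exact (IEnd_succ_bounds hα ih).1

lemma two_mul_le_len {a α : ℝ} (hα : 0 < α) (n : ℕ) : 2 * α ≤ len a α n := by
  cases n with
  | zero => simp [len, IEnd]; linarith
  | succ n => exact (IEnd_succ_bounds hα (iterate_mem_IEnd hα n)).2

lemma len_succ_le {a α p : ℝ} (hα : 0 < α) (hp : p ≤ 2) {n : ℕ}
    (hc : |(qm a)^[n + 1] 0| ≤ p) (hl : len a α n ≤ 1) :
    len a α (n + 1) ≤ 6 * len a α n + 2 * α := by
  have hm := iterate_mem_IEnd (a := a) hα n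
  set l := (IEnd a α n).1
  set r := (IEnd a α n).2
  have hlen : len a α n = r - l := rfl
  have hcI : IsCompact (qm a '' Icc l r) := isCompact_Icc.image (continuous_qm a)
  have hne : (qm a '' Icc l r).Nonempty := ⟨_, mem_image_of_mem _ hm⟩
  obtain ⟨x, hx, ex⟩ := hcI.sSup_mem hne
  obtain ⟨y, hy, ey⟩ := hcI.sInf_mem hne
  have e : len a α (n + 1) = qm a x - qm a y + 2 * α := by
    rw [ex, ey]; simp only [len, IEnd]; ring
  rw [e, hlen]
  rw [abs_le] at hc
  have h1 : qm a x - qm a y = (x + y) * (y - x) := by unfold qm; ring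
  have h2 : (x + y) * (y - x) ≤ |x + y| * |y - x| := by
    rw [← abs_mul]; exact le_abs_self _
  have h3 : |x + y| ≤ 6 := by
    rw [abs_le]
    constructor <;> linarith [hx.1, hx.2, hy.1, hy.2, hm.1, hm.2]
  have h4 : |y - x| ≤ r - l := by
    rw [abs_le]; constructor <;> linarith [hx.1, hx.2, hy.1, hy.2]
  have h5 : |x + y| * |y - x| ≤ 6 * (r - l) := by gcongr
  linarith

lemma len_le {a α p : ℝ} (hα : 0 < α) (hp : p ≤ 2)
    (hc : ∀ n, |(qm a)^[n + 1] 0| ≤ p) {N : ℕ} (hN : 4 * α * 7 ^ N ≤ 1) :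
    ∀ n ≤ N, len a α n ≤ 4 * α * 7 ^ n := by
  intro n
  induction n with
  | zero => intro _; simp [len, IEnd]; linarith
  | succ n ih =>
    intro hn
    have h1 := ih (by omega)
    have h2 : 4 * α * 7 ^ n ≤ 4 * α * 7 ^ N := by
      gcongr
      · norm_num
      · omega
    have h3 := len_succ_le hα hp (hc n) (h1.trans (h2.trans hN))
    have h4 : (1 : ℝ) ≤ 7 ^ n := one_le_pow₀ (by norm_num)
    rw [pow_succ]
    nlinarith

lemma le_Nal {a α p ξ₀ : ℝ} (hα : 0 < α) (hp : p ≤ 2)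
    (hc : ∀ n, |(qm a)^[n + 1] 0| ≤ p) {N : ℕ} (hN : 4 * α * 7 ^ N ≤ min ξ₀ 1) :
    N ≤ Nal a ξ₀ α := by
  have hlen := len_le hα hp hc (hN.trans (min_le_right _ _))
  have hξ := hN.trans (min_le_left _ _)
  apply le_csSup
  · refine ⟨⌈ξ₀ / (2 * α)⌉₊, ?_⟩
    rintro n ⟨-, hn⟩
    have h1 : (n : ℝ) * (2 * α) ≤ ∑ k ∈ Finset.range n, len a α k := by
      have := Finset.card_nsmul_le_sum (Finset.range n) (fun k => len a α k) (2 * α)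
        fun k _ => two_mul_le_len hα k
      simpa using this
    have h2 : (n : ℝ) ≤ ξ₀ / (2 * α) := by
      rw [le_div_iff₀ (by positivity)]; linarith
    exact_mod_cast h2.trans (Nat.le_ceil _)
  · refine ⟨fun n h1 hn => ?_, ?_⟩
    · have h2 := hlen (n - 1) (by omega)
      have h3 : (7 : ℝ) ^ (n - 1) < 7 ^ N := pow_lt_pow_right₀ (by norm_num) (by omega)
      nlinarith
    · have h1 : ∑ k ∈ Finset.range N, len a α k ≤ ∑ k ∈ Finset.range N, 4 * α * 7 ^ k :=
        Finset.sum_le_sum fun k hk => hlen k (Finset.mem_range.1 hk).le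
      rw [← Finset.mul_sum] at h1
      have h2 := geom_sum_eq (show (7 : ℝ) ≠ 1 by norm_num) N
      have h3 : (0 : ℝ) < 7 ^ N := by positivity
      have h4 : ∑ k ∈ Finset.range N, (7 : ℝ) ^ k ≤ 7 ^ N := by rw [h2]; linarith
      nlinarith

lemma exists_le_Nal {a p ξ₀ : ℝ} (hξ₀ : 0 < ξ₀) (hp : p ≤ 2)
    (hc : ∀ n, |(qm a)^[n + 1] 0| ≤ p) :
    ∃ c₁ > 0, ∀ᶠ α in nhdsWithin (0 : ℝ) (Ioi 0), c₁ * Real.log α⁻¹ ≤ Nal a ξ₀ α := by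
  have h7 : 0 < Real.log 7 := Real.log_pos (by norm_num)
  refine ⟨1 / (2 * Real.log 7), by positivity, ?_⟩
  have s1 : Tendsto (fun α : ℝ => Real.log α⁻¹) (nhdsWithin 0 (Ioi 0)) atTop :=
    Real.tendsto_log_atTop.comp tendsto_inv_nhdsGT_zero
  set q := min ξ₀ 1 / 4 with hq
  have hq0 : 0 < q := by positivity
  filter_upwards [self_mem_nhdsWithin, Ioo_mem_nhdsGT hq0,
    s1.eventually_ge_atTop (2 * (Real.log 7 - Real.log q))] with α hα hα2 hα3
  rw [mem_Ioi] at hα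
  set t := Real.log (q / α) / Real.log 7 with ht
  have ht0 : 0 ≤ t := div_nonneg (Real.log_nonneg (by rw [one_le_div hα]; exact hα2.2.le)) h7.le
  have h1 : ⌊t⌋₊ ≤ Nal a ξ₀ α := by
    apply le_Nal hα hp hc
    have h2 : (7 : ℝ) ^ ⌊t⌋₊ ≤ q / α := by
      rw [← Real.rpow_natCast]
      calc (7 : ℝ) ^ (⌊t⌋₊ : ℝ) ≤ 7 ^ t :=
            Real.rpow_le_rpow_of_exponent_le (by norm_num) (Nat.floor_le ht0)
        _ = q / α := by
          rw [Real.rpow_def_of_pos (by norm_num), ht, mul_div_cancel₀ _ h7.ne',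
            Real.exp_log (by positivity)]
    rw [le_div_iff₀ hα] at h2
    rw [hq] at h2
    linarith
  have h3 : t - 1 ≤ (⌊t⌋₊ : ℝ) := (Nat.sub_one_lt_floor t).le
  have h4 : (⌊t⌋₊ : ℝ) ≤ Nal a ξ₀ α := by exact_mod_cast h1
  refine le_trans ?_ (h3.trans h4)
  have h5 : t = (Real.log q + Real.log α⁻¹) / Real.log 7 := by
    rw [ht, div_eq_mul_inv q, Real.log_mul hq0.ne' (by positivity)]
  rw [h5, div_mul_eq_mul_div, one_mul, div_sub_one h7.ne', div_le_div_iff₀ (by positivity) h7]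
  nlinarith

section Forcing

variable {φ : ℝ → ℝ}

lemma exists_lipschitz (hφa : ∀ x : ℝ, AnalyticAt ℝ φ x) (hφp : Function.Periodic φ 1) :
    ∃ L : ℝ, 0 < L ∧ ∀ u v, |φ u - φ v| ≤ L * |u - v| := by
  have hd : Function.Periodic (deriv φ) 1 := fun x => by
    have : φ = fun y => φ (y + 1) := funext fun y => (hφp y).symm
    conv_rhs => rw [this]
    rw [deriv_comp_add_const]
  have hc : Continuous (deriv φ) :=
    continuous_iff_continuousAt.2 fun x => (hφa x).deriv.continuousAt
  obtain ⟨C, hC⟩ := (hd.isBounded_of_continuous one_ne_zero hc).exists_norm_le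
  refine ⟨max C 1, by positivity, fun u v => ?_⟩
  have := Convex.norm_image_sub_le_of_norm_deriv_le (s := univ) (f := φ) (C := max C 1)
    (fun x _ => (hφa x).differentiableAt) (fun x _ => (hC _ ⟨x, rfl⟩).trans (le_max_left _ _))
    convex_univ (mem_univ v) (mem_univ u)
  simpa using this

lemma exists_shift {d : ℕ} (hd : 2 ≤ d) (hφa : ∀ x : ℝ, AnalyticAt ℝ φ x)
    (hφp : Function.Periodic φ 1) (hφnc : ∃ s t : ℝ, φ s ≠ φ t) :
    ∃ σ : ℝ, 0 < σ ∧ σ ≤ 1 / 2 ∧ Function.Periodic φ (d * σ) ∧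
      ∃ u v : ℝ, φ (u + σ) - φ u ≠ φ (v + σ) - φ v := by
  classical
  have hd1 : (1 : ℝ) < d := by exact_mod_cast (show 1 < d by omega)
  have hd0 : (0 : ℝ) < d := by linarith
  have hex : ∃ k : ℕ, ¬ Function.Periodic φ (1 / (d : ℝ) ^ k) := by
    by_contra hall
    push Not at hall
    obtain ⟨s, t, hst⟩ := hφnc
    apply hst
    obtain ⟨L, hL, hlip⟩ := exists_lipschitz hφa hφp
    have h1 : ∀ k : ℕ, |φ s - φ t| ≤ L * (1 / d) ^ k := by
      intro k
      set q := (d : ℝ) ^ k with hq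
      have hq0 : 0 < q := by positivity
      set z : ℤ := ⌊(t - s) * q⌋
      have h2 := (hall k).int_mul z s
      have h3 := hlip (s + z * (1 / q)) t
      rw [h2] at h3
      refine h3.trans ?_
      gcongr
      have h4 := Int.floor_le ((t - s) * q)
      have h5 := Int.lt_floor_add_one ((t - s) * q)
      rw [one_div_pow, ← hq]
      have h6 : s + z * (1 / q) - t = (z - (t - s) * q) / q := by field_simp; ring
      rw [h6, abs_div, abs_of_pos hq0]
      gcongr
      rw [abs_le]; constructor <;> linarith
    have h2 : Tendsto (fun k : ℕ => L * (1 / (d : ℝ)) ^ k) atTop (nhds (L * 0)) :=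
      (tendsto_pow_atTop_nhds_zero_of_lt_one (by positivity)
        (by rw [div_lt_one hd0]; exact hd1)).const_mul L
    rw [mul_zero] at h2
    have h3 := ge_of_tendsto' h2 h1
    have h4 := abs_nonneg (φ s - φ t)
    exact sub_eq_zero.1 (abs_eq_zero.1 (le_antisymm h3 h4))
  have hk0 : Nat.find hex ≠ 0 := by
    intro h0
    have := Nat.find_spec hex
    rw [h0] at this
    exact this (by rw [pow_zero, div_one]; exact hφp)
  obtain ⟨k, hk⟩ : ∃ k, Nat.find hex = k + 1 := ⟨Nat.find hex - 1, by omega⟩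
  have hnp : ¬ Function.Periodic φ (1 / (d : ℝ) ^ (k + 1)) := hk ▸ Nat.find_spec hex
  have hp : Function.Periodic φ (1 / (d : ℝ) ^ k) :=
    not_not.1 (Nat.find_min hex (m := k) (by omega))
  set σ := 1 / (d : ℝ) ^ (k + 1) with hσ
  have hdσ : (d : ℝ) * σ = 1 / (d : ℝ) ^ k := by rw [hσ, pow_succ]; field_simp
  refine ⟨σ, by positivity, ?_, hdσ ▸ hp, ?_⟩
  · rw [hσ]
    apply one_div_le_one_div_of_le (by norm_num)
    have h2 : (2 : ℝ) ≤ d := by exact_mod_cast hd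
    calc (2 : ℝ) ≤ d := h2
      _ = (d : ℝ) ^ 1 := (pow_one _).symm
      _ ≤ _ := pow_le_pow_right₀ hd1.le (by omega)
  · by_contra hall
    push Not at hall
    apply hnp
    have h1 : ∀ n : ℕ, ∀ x, φ (x + n * σ) = φ x + n * (φ (0 + σ) - φ 0) := by
      intro n
      induction n with
      | zero => intro x; simp
      | succ n ih =>
        intro x
        have h2 := hall (x + n * σ) 0
        have h3 := ih x
        push_cast
        rw [show x + (n + 1 : ℝ) * σ = x + n * σ + σ by ring]
        linarith
    have h2 := h1 d 0
    have h3 := (hdσ ▸ hp : Function.Periodic φ (d * σ)) 0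
    have h4 : (d : ℝ) * (φ (0 + σ) - φ 0) = 0 := by linarith
    have h5 : φ (0 + σ) - φ 0 = 0 := by
      rcases mul_eq_zero.1 h4 with h | h
      · linarith
      · exact h
    intro x
    have := hall x 0
    linarith

lemma volume_level_eq_zero {h : ℝ → ℝ} (ha : ∀ x, AnalyticAt ℝ h x) (hnc : ∃ u v, h u ≠ h v)
    (y : ℝ) : volume (h ⁻¹' {y}) = 0 := by
  obtain ⟨x, hx⟩ : ∃ x, h x - y ≠ 0 := by
    obtain ⟨u, v, huv⟩ := hnc
    by_contra hc
    push Not at hc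
    exact huv (by linarith [hc u, hc v])
  have h1 := AnalyticOnNhd.preimage_zero_mem_codiscrete (f := fun x => h x - y)
    (fun x _ => (ha x).sub analyticAt_const) hx
  have h2 := ae_restrict_le_codiscreteWithin (μ := volume) (U := (univ : Set ℝ))
    MeasurableSet.univ h1
  rw [Measure.restrict_univ, mem_ae_iff] at h2
  convert h2 using 2
  ext x
  simp [sub_eq_zero]

lemma exists_anticoncentration {h : ℝ → ℝ} (ha : ∀ x, AnalyticAt ℝ h x)
    (hnc : ∃ u v, h u ≠ h v) {τ : ℝ≥0∞} (hτ : 0 < τ) :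
    ∃ η > 0, ∀ U : Set ℝ, U ⊆ Icc 0 1 → (∀ u ∈ U, ∀ v ∈ U, |h u - h v| ≤ η) →
      volume U ≤ τ := by
  have hc : Continuous h := continuous_iff_continuousAt.2 fun x => (ha x).continuousAt
  set μ := Measure.map h (volume.restrict (Icc (0 : ℝ) 1)) with hμ
  have : IsFiniteMeasure (volume.restrict (Icc (0 : ℝ) 1)) := ⟨by simp⟩
  have hμf : IsFiniteMeasure μ := Measure.isFiniteMeasure_map _ _
  have hsing : ∀ y, μ {y} < τ := fun y => by
    rw [hμ, Measure.map_apply hc.measurable (measurableSet_singleton y)]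
    refine lt_of_le_of_lt (Measure.restrict_apply_le _ _) ?_
    rw [volume_level_eq_zero ha hnc]; exact hτ
  choose V hV1 hV2 hV3 using fun y => Set.exists_isOpen_lt_of_lt {y} τ (hsing y)
  have hK : IsCompact (h '' Icc 0 1) := isCompact_Icc.image hc
  obtain ⟨δ, hδ, hδV⟩ := lebesgue_number_lemma_of_metric hK hV2
    (fun y _ => mem_iUnion.2 ⟨y, hV1 y (mem_singleton y)⟩)
  refine ⟨δ / 2, half_pos hδ, fun U hU hosc => ?_⟩
  rcases U.eq_empty_or_nonempty with rfl | ⟨u, hu⟩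
  · simp
  obtain ⟨y, hy⟩ := hδV (h u) (mem_image_of_mem h (hU hu))
  have hsub : U ⊆ h ⁻¹' V y ∩ Icc 0 1 := fun v hv => ⟨hy (by
    rw [Metric.mem_ball, Real.dist_eq]
    linarith [hosc v hv u hu]), hU hv⟩
  calc volume U ≤ volume (h ⁻¹' V y ∩ Icc 0 1) := measure_mono hsub
    _ = μ (V y) := by
      rw [hμ, Measure.map_apply hc.measurable (hV2 y).measurableSet,
        Measure.restrict_apply (hc.measurable (hV2 y).measurableSet)]
    _ ≤ τ := (hV3 y).le

end Forcing

section Fibre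

variable {a : ℝ} {d : ℕ} {φ : ℝ → ℝ} {α : ℝ}

lemma viana_iterate (n : ℕ) (θ x : ℝ) :
    (Viana a d φ α)^[n] (θ, x) = ((d : ℝ) ^ n * θ, fn a d φ α n θ x) := by
  refine Prod.ext ?_ rfl
  induction n with
  | zero => simp
  | succ n ih =>
    rw [Function.iterate_succ_apply']
    simp only [Viana] at ih ⊢
    rw [ih]
    ring

@[simp] lemma fn_zero (θ x : ℝ) : fn a d φ α 0 θ x = x := rfl

lemma fn_succ (n : ℕ) (θ x : ℝ) :
    fn a d φ α (n + 1) θ x = a - fn a d φ α n θ x ^ 2 + α * φ ((d : ℝ) ^ n * θ) := by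
  conv_lhs => rw [fn, Function.iterate_succ_apply', viana_iterate]
  rfl

lemma fn_add (m n : ℕ) (θ x : ℝ) :
    fn a d φ α (m + n) θ x = fn a d φ α m ((d : ℝ) ^ n * θ) (fn a d φ α n θ x) := by
  rw [fn, Function.iterate_add_apply, viana_iterate n, viana_iterate m]

lemma fn_succ' (n : ℕ) (θ x : ℝ) :
    fn a d φ α (n + 1) θ x = fn a d φ α n (d * θ) (a - x ^ 2 + α * φ θ) := by
  rw [fn_add, pow_one, fn_succ]
  simp

lemma fn_add_nat (hφp : Function.Periodic φ 1) (n k : ℕ) (θ x : ℝ) :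
    fn a d φ α n (θ + k) x = fn a d φ α n θ x := by
  induction n with
  | zero => rfl
  | succ n ih =>
    rw [fn_succ, fn_succ, ih]
    have h := hφp.nat_mul (d ^ n * k) ((d : ℝ) ^ n * θ)
    rw [← h]
    push_cast
    ring_nf

lemma continuous_fn (hφ : Continuous φ) (n : ℕ) :
    Continuous fun z : ℝ × ℝ => fn a d φ α n z.1 z.2 := by
  induction n with
  | zero => simpa using continuous_snd
  | succ n ih =>
    simp only [fn_succ]
    fun_prop

lemma differentiable_fn (n : ℕ) (θ : ℝ) : Differentiable ℝ fun x => fn a d φ α n θ x := by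
  induction n with
  | zero => simp
  | succ n ih =>
    simp only [fn_succ]
    fun_prop

lemma fn_mem {β : ℝ} (hφb : ∀ θ, |φ θ| ≤ 1)
    (htrap : ∀ x ∈ Icc (-β) β, ∀ ψ : ℝ, |ψ| ≤ 1 → a - x ^ 2 + α * ψ ∈ Icc (-β) β)
    (n : ℕ) (θ : ℝ) {x : ℝ} (hx : x ∈ Icc (-β) β) : fn a d φ α n θ x ∈ Icc (-β) β := by
  induction n with
  | zero => exact hx
  | succ n ih => rw [fn_succ]; exact htrap _ ih _ (hφb _)

/-- If the vertical derivatives grow at a rate less than `d`, the fibre maps have horizontal slope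
`O(α dⁿ)`. -/
lemma abs_fn_sub_fn_le {β C₁ R₁ L : ℝ} (hα : 0 ≤ α) (hφb : ∀ θ, |φ θ| ≤ 1)
    (htrap : ∀ x ∈ Icc (-β) β, ∀ ψ : ℝ, |ψ| ≤ 1 → a - x ^ 2 + α * ψ ∈ Icc (-β) β)
    (hL : ∀ u v, |φ u - φ v| ≤ L * |u - v|) (hC₁ : 0 ≤ C₁) (hR₁ : 0 ≤ R₁) (hRd : R₁ < d)
    (hder : ∀ θ x, x ∈ Icc (-β) β → ∀ k,
      |deriv (fun y => fn a d φ α k θ y) x| ≤ C₁ * R₁ ^ k)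
    (n : ℕ) (u v : ℝ) {x : ℝ} (hx : x ∈ Icc (-β) β) :
    |fn a d φ α n u x - fn a d φ α n v x| ≤
      C₁ * α * L * (((d : ℝ) ^ n - R₁ ^ n) / (d - R₁)) * |u - v| := by
  induction n generalizing u v x with
  | zero => simp
  | succ n ih =>
    have hd : (d : ℝ) - R₁ ≠ 0 := by linarith
    rw [fn_succ', fn_succ']
    set y := a - x ^ 2 + α * φ u with hy
    set z := a - x ^ 2 + α * φ v with hz
    have hyB : y ∈ Icc (-β) β := htrap x hx _ (hφb _)
    have hzB : z ∈ Icc (-β) β := htrap x hx _ (hφb _)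
    have h1 : |fn a d φ α n (d * u) y - fn a d φ α n (d * u) z| ≤ C₁ * R₁ ^ n * |y - z| :=
      (convex_Icc (-β) β).norm_image_sub_le_of_norm_deriv_le (𝕜 := ℝ)
        (f := fun x => fn a d φ α n (d * u) x)
        (fun w _ => (differentiable_fn n _).differentiableAt)
        (fun w hw => hder _ w hw n) hzB hyB
    have h2 := ih (d * u) (d * v) hzB
    have h3 : |y - z| ≤ α * (L * |u - v|) := by
      have : y - z = α * (φ u - φ v) := by rw [hy, hz]; ring
      rw [this, abs_mul, abs_of_nonneg hα]
      exact mul_le_mul_of_nonneg_left (hL u v) hα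
    have h4 : |(d : ℝ) * u - d * v| = d * |u - v| := by
      rw [← mul_sub, abs_mul, abs_of_nonneg (Nat.cast_nonneg d)]
    rw [h4] at h2
    calc _ ≤ |fn a d φ α n (d * u) y - fn a d φ α n (d * u) z| +
          |fn a d φ α n (d * u) z - fn a d φ α n (d * v) z| := abs_sub_le _ _ _
      _ ≤ C₁ * R₁ ^ n * (α * (L * |u - v|)) +
          C₁ * α * L * (((d : ℝ) ^ n - R₁ ^ n) / (d - R₁)) * (d * |u - v|) :=
        add_le_add (h1.trans (by gcongr)) h2
      _ = _ := by field_simp; ring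

/-- The restriction to `[j/d^m, (j+1)/d^m)` of the image of the curve `X` under `F^m`,
reparametrized over `[0,1)`. -/
def branch (a : ℝ) (d : ℕ) (φ : ℝ → ℝ) (α : ℝ) (m j : ℕ) (X : ℝ → ℝ) (t : ℝ) : ℝ :=
  fn a d φ α m ((t + j) / (d : ℝ) ^ m) (X ((t + j) / (d : ℝ) ^ m))

lemma div_pow_mem_Ico (hd : 0 < d) {m j : ℕ} (hj : j < d ^ m) {t : ℝ} (ht : t ∈ Ico (0 : ℝ) 1) :
    (t + j) / (d : ℝ) ^ m ∈ Ico (0 : ℝ) 1 := by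
  have hd' : (0 : ℝ) < d := by exact_mod_cast hd
  have h1 : (j : ℝ) + 1 ≤ (d : ℝ) ^ m := by exact_mod_cast hj
  have h2 := ht.1
  have h3 := ht.2
  constructor
  · positivity
  · rw [div_lt_one (by positivity)]; linarith

lemma admissible_branch {β : ℝ} {n₀ : ℕ} (hd : 0 < d) {m j : ℕ} (hj : j < d ^ m) {X : ℝ → ℝ}
    (hφp : Function.Periodic φ 1) (hX : Admissible a d φ α β n₀ X) :
    Admissible a d φ α β n₀ (branch a d φ α m j X) := by
  obtain ⟨n, hn, i, hi, x₀, hx₀, h⟩ := hX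
  have hd' : (0 : ℝ) < d := by exact_mod_cast hd
  refine ⟨m + n, by omega, j + d ^ m * i, ?_, x₀, hx₀, fun t ht => ?_⟩
  · calc j + d ^ m * i < d ^ m + d ^ m * i := by omega
      _ = d ^ m * (i + 1) := by ring
      _ ≤ d ^ m * d ^ n := Nat.mul_le_mul_left _ hi
      _ = d ^ (m + n) := (pow_add _ _ _).symm
  · rw [branch, h _ (div_pow_mem_Ico hd hj ht), fn_add]
    have h1 : (t + ((j + d ^ m * i : ℕ) : ℝ)) / (d : ℝ) ^ (m + n) =
        ((t + j) / (d : ℝ) ^ m + i) / (d : ℝ) ^ n := by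
      push_cast
      rw [pow_add]
      field_simp
      ring
    rw [h1, mul_div_cancel₀ _ (by positivity), fn_add_nat hφp]

/-- The truncated vertical derivative of `f_n`. -/
def tder (a : ℝ) (d : ℕ) (φ : ℝ → ℝ) (α : ℝ) (n : ℕ) (θ x : ℝ) : ℝ :=
  ∏ i ∈ Finset.range n, max (2 * |fn a d φ α i θ x|) (2 * α)

lemma tder_add (m n : ℕ) (θ x : ℝ) :
    tder a d φ α (m + n) θ x =
      tder a d φ α m θ x * tder a d φ α n ((d : ℝ) ^ m * θ) (fn a d φ α m θ x) := by
  rw [tder, Finset.prod_range_add]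
  congr 1
  refine Finset.prod_congr rfl fun i _ => ?_
  rw [add_comm m i, fn_add]

lemma tder_add_nat (hφp : Function.Periodic φ 1) (n k : ℕ) (θ x : ℝ) :
    tder a d φ α n (θ + k) x = tder a d φ α n θ x := by
  simp only [tder, fn_add_nat hφp]

lemma tder_branch (hd : 0 < d) (hφp : Function.Periodic φ 1) (m j n : ℕ) (X : ℝ → ℝ) (t : ℝ) :
    tder a d φ α (m + n) ((t + j) / (d : ℝ) ^ m) (X ((t + j) / (d : ℝ) ^ m)) =
      tder a d φ α m ((t + j) / (d : ℝ) ^ m) (X ((t + j) / (d : ℝ) ^ m)) *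
        tder a d φ α n t (branch a d φ α m j X t) := by
  have hd' : (0 : ℝ) < d := by exact_mod_cast hd
  rw [tder_add, mul_div_cancel₀ _ (by positivity), tder_add_nat hφp, branch]

lemma pow_le_tder (hα : 0 ≤ α) (n : ℕ) (θ x : ℝ) : (2 * α) ^ n ≤ tder a d φ α n θ x := by
  rw [tder, ← Finset.card_range n, ← Finset.prod_const, Finset.card_range]
  exact Finset.prod_le_prod (fun _ _ => by positivity) fun _ _ => le_max_right _ _

lemma tder_pos (hα : 0 < α) (n : ℕ) (θ x : ℝ) : 0 < tder a d φ α n θ x :=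
  (pow_pos (by positivity) n).trans_le (pow_le_tder hα.le n θ x)

lemma continuous_tder (hφ : Continuous φ) (n : ℕ) :
    Continuous fun z : ℝ × ℝ => tder a d φ α n z.1 z.2 := by
  have := fun i => continuous_fn (a := a) (d := d) (α := α) hφ i
  unfold tder
  fun_prop

/-- Admissible curves take values in the trapping region and oscillate by `O(α)`. -/
lemma Admissible.mem_and_oscillation {β C₁ R₁ L : ℝ} {n₀ : ℕ} (hd : 0 < d) (hα : 0 ≤ α)
    (hφb : ∀ θ, |φ θ| ≤ 1)
    (htrap : ∀ x ∈ Icc (-β) β, ∀ ψ : ℝ, |ψ| ≤ 1 → a - x ^ 2 + α * ψ ∈ Icc (-β) β)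
    (hL0 : 0 ≤ L) (hL : ∀ u v, |φ u - φ v| ≤ L * |u - v|) (hC₁ : 0 ≤ C₁) (hR₁ : 0 ≤ R₁)
    (hRd : R₁ < d)
    (hder : ∀ θ x, x ∈ Icc (-β) β → ∀ k,
      |deriv (fun y => fn a d φ α k θ y) x| ≤ C₁ * R₁ ^ k)
    {X : ℝ → ℝ} (hX : Admissible a d φ α β n₀ X) :
    (∀ t ∈ Ico (0 : ℝ) 1, X t ∈ Icc (-β) β) ∧
      ∀ t ∈ Ico (0 : ℝ) 1, ∀ u ∈ Ico (0 : ℝ) 1, |X t - X u| ≤ C₁ * L / (d - R₁) * α := by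
  obtain ⟨n, -, i, -, x₀, hx₀, h⟩ := hX
  refine ⟨fun t ht => h t ht ▸ fn_mem hφb htrap n _ hx₀, fun t ht u hu => ?_⟩
  rw [h t ht, h u hu]
  have hd' : (0 : ℝ) < d := by exact_mod_cast hd
  have hq : (0 : ℝ) < (d : ℝ) ^ n := by positivity
  refine (abs_fn_sub_fn_le hα hφb htrap hL hC₁ hR₁ hRd hder n _ _ hx₀).trans ?_
  have h1 : |(t + i) / (d : ℝ) ^ n - (u + i) / (d : ℝ) ^ n| ≤ 1 / (d : ℝ) ^ n := by
    rw [← sub_div, abs_div, abs_of_pos hq]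
    gcongr
    have := ht.1; have := ht.2; have := hu.1; have := hu.2
    rw [abs_le]; constructor <;> linarith
  have h2 : ((d : ℝ) ^ n - R₁ ^ n) / (d - R₁) ≤ (d : ℝ) ^ n / (d - R₁) := by
    have : 0 < (d : ℝ) - R₁ := by linarith
    gcongr
    have := pow_nonneg hR₁ n
    linarith
  have h0 : 0 < (d : ℝ) - R₁ := by linarith
  calc _ ≤ C₁ * α * L * ((d : ℝ) ^ n / (d - R₁)) * (1 / (d : ℝ) ^ n) := by gcongr
    _ = _ := by field_simp

end Fibre

/-- Pseudo-orbits of `x ↦ a - x²` that come close to `0` in less than `L` steps start close to a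
fixed finite set. -/
lemma exists_finset_near (a : ℝ) (L : ℕ) : ∃ S : Finset ℝ, ∀ ε > 0, ∃ δ > 0, ∀ x : ℕ → ℝ,
    (∀ k < L, |x (k + 1) - (a - x k ^ 2)| ≤ δ) → (∃ i < L, |x i| ≤ δ) →
      ∃ s ∈ S, |x 0 - s| ≤ ε := by
  classical
  induction L with
  | zero => exact ⟨∅, fun ε hε => ⟨1, one_pos, fun x _ ⟨i, hi, _⟩ => absurd hi (by omega)⟩⟩
  | succ L ih =>
    obtain ⟨S, hS⟩ := ih
    refine ⟨insert 0 (S.image (fun s => √(a - s)) ∪ S.image fun s => -√(a - s)), fun ε hε => ?_⟩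
    obtain ⟨δ, hδ, h⟩ := hS (ε ^ 2 / 2) (by positivity)
    refine ⟨min δ (min ε (ε ^ 2 / 2)), by positivity, fun x hx ⟨i, hi, hxi⟩ => ?_⟩
    have hm1 : min δ (min ε (ε ^ 2 / 2)) ≤ δ := min_le_left _ _
    have hm2 : min δ (min ε (ε ^ 2 / 2)) ≤ ε := (min_le_right _ _).trans (min_le_left _ _)
    have hm3 : min δ (min ε (ε ^ 2 / 2)) ≤ ε ^ 2 / 2 := (min_le_right _ _).trans (min_le_right _ _)
    rcases i with _ | i
    · exact ⟨0, by simp, by rw [sub_zero]; exact hxi.trans hm2⟩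
    · obtain ⟨s, hs, hsx⟩ := h (fun k => x (k + 1)) (fun k hk => (hx (k + 1) (by omega)).trans hm1)
        ⟨i, by omega, hxi.trans hm1⟩
      have h0 := (hx 0 (by omega)).trans hm3
      simp only [zero_add] at h0 hsx
      have h1 : |x 0 ^ 2 - (a - s)| ≤ ε ^ 2 := by
        rw [abs_le] at *
        constructor <;> linarith
      rcases le_or_gt 0 (a - s) with hp | hn
      · set r := √(a - s) with hr
        have hr2 : r ^ 2 = a - s := Real.sq_sqrt hp
        have h2 : |x 0 - r| * |x 0 + r| ≤ ε ^ 2 := by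
          rw [← abs_mul]
          rw [← hr2] at h1
          rwa [show (x 0 - r) * (x 0 + r) = x 0 ^ 2 - r ^ 2 by ring]
        rcases le_or_gt |x 0 - r| ε with h3 | h3
        · exact ⟨r, by simp only [Finset.mem_insert, Finset.mem_union, Finset.mem_image]
                       exact Or.inr (Or.inl ⟨s, hs, rfl⟩), h3⟩
        · refine ⟨-r, by simp only [Finset.mem_insert, Finset.mem_union, Finset.mem_image]
                         exact Or.inr (Or.inr ⟨s, hs, rfl⟩), ?_⟩
          rw [sub_neg_eq_add]
          by_contra! h4
          nlinarith
      · refine ⟨0, by simp, ?_⟩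
        rw [sub_zero]
        refine abs_le_of_sq_le_sq ?_ hε.le
        have := (abs_le.1 h1).2
        linarith

section Good

variable {a : ℝ} {d : ℕ} {φ : ℝ → ℝ} {α : ℝ}

lemma pseudoOrbit_fn (hφb : ∀ θ, |φ θ| ≤ 1) (hα : 0 ≤ α) (N : ℕ) (θ : ℝ) {x : ℝ}
    (hx : x ^ 2 ≤ α) : PseudoOrbit a α a N fun k => fn a d φ α (k + 1) θ x := by
  have h (ψ : ℝ) : |α * φ ψ| ≤ α := by
    rw [abs_mul, abs_of_nonneg hα]
    exact mul_le_of_le_one_right hα (hφb ψ)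
  refine ⟨?_, fun k _ => ?_⟩
  · have h1 := abs_le.1 (h θ)
    simp only [zero_add, fn_succ, fn_zero, pow_zero, one_mul]
    rw [abs_le]
    constructor <;> nlinarith [sq_nonneg x]
  · have h1 := h ((d : ℝ) ^ (k + 1) * θ)
    simp only
    rw [fn_succ (k + 1)]
    convert h1 using 2
    ring

/-- Along a curve starting near the critical point, a definite proportion of points avoids a
neighbourhood of a given finite set at the escape time. -/
lemma half_le_volume_good {σ C η ε w : ℝ} {τ : ℝ≥0∞} {N : ℕ} (S : Finset ℝ)
    (hφb : ∀ θ, |φ θ| ≤ 1) (hσ : 0 < σ) (hσ2 : σ ≤ 1 / 2) (hφσ : Function.Periodic φ (d * σ))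
    (hanti : ∀ U ⊆ Icc (0 : ℝ) 1, (∀ u ∈ U, ∀ v ∈ U,
      |(φ (u + σ) - φ u) - (φ (v + σ) - φ v)| ≤ η) → volume U ≤ τ)
    (hα : 0 < α)
    (hpair : ∀ x y X Y, PseudoOrbit a α a N x → PseudoOrbit a α a N y →
      PseudoOrbit a α a N X → PseudoOrbit a α a N Y →
      (∀ k < N, x (k + 1) + x k ^ 2 = y (k + 1) + y k ^ 2) →
      (∀ k < N, X (k + 1) + X k ^ 2 = Y (k + 1) + Y k ^ 2) → ∀ ε, 0 ≤ ε → ε ≤ 1 →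
      |x N - X N| ≤ 2 * ε → |y N - Y N| ≤ 2 * ε →
      |(x 0 - y 0) - (X 0 - Y 0)| ≤ C * α * (ε + α * N))
    (hε : 0 ≤ ε) (hε1 : ε ≤ 1) (hwα : w ≤ α) (hη : C * α * (ε + α * N) + 4 * w ≤ α * η)
    {X : ℝ → ℝ} (hX : ∀ t ∈ Ico (0 : ℝ) 1, X t ^ 2 ≤ w) :
    1 / 2 ≤ 2 * volume {t ∈ Ico (0 : ℝ) 1 | ∀ s ∈ S, ε < |fn a d φ α (N + 1) t (X t) - s|} +
      S.card ^ 2 * τ := by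
  set Z : ℝ → ℝ := fun t => fn a d φ α (N + 1) t (X t) with hZ
  set G := {t ∈ Ico (0 : ℝ) 1 | ∀ s ∈ S, ε < |Z t - s|} with hG
  let U : ℝ × ℝ → Set ℝ := fun q => {t ∈ Ico (0 : ℝ) (1 / 2) | |Z t - q.1| ≤ ε ∧
    |Z (t + σ) - q.2| ≤ ε}
  have hcover : Ico (0 : ℝ) (1 / 2) ⊆ (⋃ q ∈ S ×ˢ S, U q) ∪ (G ∪ (fun t => t + σ) ⁻¹' G) := by
    intro t ht
    by_cases h1 : t ∈ G
    · exact Or.inr (Or.inl h1)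
    by_cases h2 : t + σ ∈ G
    · exact Or.inr (Or.inr h2)
    left
    have ht0 := ht.1
    have ht1 := ht.2
    have h3 : ∃ s ∈ S, |Z t - s| ≤ ε := by
      by_contra! h
      exact h1 ⟨⟨ht.1, by linarith⟩, h⟩
    have h4 : ∃ s ∈ S, |Z (t + σ) - s| ≤ ε := by
      by_contra! h
      exact h2 ⟨⟨by linarith, by linarith⟩, h⟩
    obtain ⟨s, hs, hs'⟩ := h3
    obtain ⟨r, hr, hr'⟩ := h4
    simp only [mem_iUnion]
    exact ⟨(s, r), Finset.mem_product.2 ⟨hs, hr⟩, ht, hs', hr'⟩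
  have hU : ∀ q, volume (U q) ≤ τ := by
    intro q
    apply hanti
    · exact fun t ht => ⟨ht.1.1, by linarith [ht.1.2]⟩
    intro u hu v hv
    have hmem : ∀ t ∈ U q, t ∈ Ico (0 : ℝ) 1 ∧ t + σ ∈ Ico (0 : ℝ) 1 := fun t ht =>
      ⟨⟨ht.1.1, by linarith [ht.1.2]⟩, ⟨by linarith [ht.1.1], by linarith [ht.1.2]⟩⟩
    have hps : ∀ t ∈ Ico (0 : ℝ) 1, PseudoOrbit a α a N fun k => fn a d φ α (k + 1) t (X t) :=
      fun t ht => pseudoOrbit_fn hφb hα.le N t ((hX t ht).trans hwα)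
    have hdrive : ∀ t, ∀ k < N, fn a d φ α (k + 1 + 1) t (X t) + fn a d φ α (k + 1) t (X t) ^ 2 =
        fn a d φ α (k + 1 + 1) (t + σ) (X (t + σ)) +
          fn a d φ α (k + 1) (t + σ) (X (t + σ)) ^ 2 := by
      intro t k _
      rw [fn_succ (k + 1), fn_succ (k + 1)]
      have h := hφσ.nat_mul (d ^ k) ((d : ℝ) ^ (k + 1) * t)
      have h' : (d : ℝ) ^ (k + 1) * (t + σ) =
          (d : ℝ) ^ (k + 1) * t + ((d ^ k : ℕ) : ℝ) * (d * σ) := by push_cast; ring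
      rw [h', h]
      ring
    have h1 := hpair _ _ _ _ (hps u (hmem u hu).1) (hps _ (hmem u hu).2) (hps v (hmem v hv).1)
      (hps _ (hmem v hv).2) (hdrive u) (hdrive v) ε hε hε1
      (by
        have := abs_le.1 hu.2.1; have := abs_le.1 hv.2.1
        simp only [hZ] at *
        rw [abs_le]; constructor <;> linarith)
      (by
        have := abs_le.1 hu.2.2; have := abs_le.1 hv.2.2
        simp only [hZ] at *
        rw [abs_le]; constructor <;> linarith)
    simp only [zero_add, fn_succ 0, fn_zero, pow_zero, one_mul] at h1
    have e1 := hX u (hmem u hu).1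
    have e2 := hX _ (hmem u hu).2
    have e3 := hX v (hmem v hv).1
    have e4 := hX _ (hmem v hv).2
    have h2 : |α * ((φ (u + σ) - φ u) - (φ (v + σ) - φ v))| ≤ α * η := by
      rw [abs_le] at h1 ⊢
      constructor <;> nlinarith [sq_nonneg (X u), sq_nonneg (X (u + σ)), sq_nonneg (X v),
        sq_nonneg (X (v + σ))]
    rw [abs_mul, abs_of_pos hα] at h2
    exact le_of_mul_le_mul_left h2 hα
  have htrans : volume ((fun t => t + σ) ⁻¹' G) = volume G := measure_preimage_add_right _ _ _
  calc (1 / 2 : ℝ≥0∞) = volume (Ico (0 : ℝ) (1 / 2)) := by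
        rw [Real.volume_Ico, sub_zero, ENNReal.ofReal_div_of_pos (by norm_num)]
        simp
    _ ≤ volume (⋃ q ∈ S ×ˢ S, U q) + volume (G ∪ (fun t => t + σ) ⁻¹' G) :=
        (measure_mono hcover).trans (measure_union_le _ _)
    _ ≤ ∑ q ∈ S ×ˢ S, volume (U q) + (volume G + volume ((fun t => t + σ) ⁻¹' G)) :=
        add_le_add (measure_biUnion_finset_le _ _) (measure_union_le _ _)
    _ ≤ ∑ q ∈ S ×ˢ S, τ + (volume G + volume G) := by
        rw [htrans]
        gcongr with q _
        exact hU q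
    _ = _ := by
        rw [Finset.sum_const, Finset.card_product, nsmul_eq_mul, ← two_mul, add_comm]
        push_cast
        ring

end Good

lemma exists_nat_Ico_div {m : ℕ} (hm : 0 < m) {θ : ℝ} (hθ : θ ∈ Ico (0 : ℝ) 1) :
    ∃ j < m, ∃ t ∈ Ico (0 : ℝ) 1, θ = (t + j) / m := by
  have hm' : (0 : ℝ) < m := by exact_mod_cast hm
  have h0 : 0 ≤ θ * m := mul_nonneg hθ.1 hm'.le
  have h1 := Nat.floor_le h0
  have h2 := Nat.lt_floor_add_one (θ * m)
  refine ⟨⌊θ * m⌋₊, ?_, θ * m - ⌊θ * m⌋₊, ⟨by linarith, by linarith⟩, by field_simp; ring⟩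
  rw [Nat.floor_lt h0]
  nlinarith [hθ.2]

lemma image_Ico_add_div {m : ℕ} (hm : 0 < m) (j : ℕ) :
    volume ((fun t : ℝ => (t + j) / m) '' Ico (0 : ℝ) 1) = ENNReal.ofReal (1 / m) := by
  have hm' : (0 : ℝ) < m := by exact_mod_cast hm
  have h : (fun t : ℝ => (t + j) / m) '' Ico (0 : ℝ) 1 = Ico ((j : ℝ) / m) ((1 + j) / m) := by
    ext u
    constructor
    · rintro ⟨t, ht, rfl⟩
      have := ht.1; have := ht.2
      exact ⟨by simp only; gcongr; linarith, by simp only; gcongr⟩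
    · intro hu
      refine ⟨u * m - j, ⟨?_, ?_⟩, by field_simp; ring⟩
      · have := (div_le_iff₀ hm').1 hu.1; linarith
      · have := (lt_div_iff₀ hm').1 hu.2; linarith
  rw [h, Real.volume_Ico]
  congr 1
  ring

lemma lintegral_Ico_le_sum {m : ℕ} (hm : 0 < m) (g : ℝ → ℝ≥0∞) :
    ∫⁻ t in Ico (0 : ℝ) 1, g t ≤
      ∑ j ∈ Finset.range m, ENNReal.ofReal (1 / m) * ∫⁻ t in Ico (0 : ℝ) 1, g ((t + j) / m) := by
  have hm' : (0 : ℝ) < m := by exact_mod_cast hm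
  have hcov : Ico (0 : ℝ) 1 ⊆
      ⋃ j : Fin m, (fun t : ℝ => (t + (j : ℕ)) / m) '' Ico (0 : ℝ) 1 := by
    intro θ hθ
    obtain ⟨j, hj, t, ht, h⟩ := exists_nat_Ico_div hm hθ
    exact mem_iUnion.2 ⟨⟨j, hj⟩, t, ht, h.symm⟩
  refine (lintegral_mono_set hcov).trans ((lintegral_iUnion_le _ _).trans ?_)
  rw [tsum_fintype, Finset.sum_range]
  refine Finset.sum_le_sum fun j _ => ?_
  rw [lintegral_image_eq_lintegral_abs_deriv_mul (f' := fun _ => 1 / (m : ℝ)) measurableSet_Ico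
    (fun x _ => (((hasDerivAt_id' x).add_const (j : ℝ)).div_const (m : ℝ)).hasDerivWithinAt),
    lintegral_const_mul' _ _ ENNReal.ofReal_ne_top, abs_of_pos (by positivity)]
  intro x _ y _ h
  have h' := (div_left_inj' hm'.ne').1 h
  simpa using h'

lemma volume_le_card_div {m : ℕ} (hm : 0 < m) (P : Finset ℕ) {G : Set ℝ}
    (hG : ∀ θ ∈ G, ∃ j ∈ P, ∃ t ∈ Ico (0 : ℝ) 1, θ = (t + j) / m) :
    volume G ≤ P.card * ENNReal.ofReal (1 / m) := by
  have hcov : G ⊆ ⋃ j ∈ P, (fun t : ℝ => (t + j) / m) '' Ico (0 : ℝ) 1 := by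
    intro θ hθ
    obtain ⟨j, hj, t, ht, h⟩ := hG θ hθ
    simp only [mem_iUnion]
    exact ⟨j, hj, t, ht, h.symm⟩
  calc volume G ≤ ∑ j ∈ P, volume ((fun t : ℝ => (t + j) / m) '' Ico (0 : ℝ) 1) :=
        (measure_mono hcov).trans (measure_biUnion_finset_le _ _)
    _ = _ := by simp_rw [image_Ico_add_div hm]; rw [Finset.sum_const, nsmul_eq_mul]

section Moment

variable {a : ℝ} {d : ℕ} {φ : ℝ → ℝ} {α : ℝ}

/-- The moment of order `-s` of the truncated derivative along the curve `X`, in the metric `ρ`. -/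
def moment (a : ℝ) (d : ℕ) (φ : ℝ → ℝ) (α : ℝ) (ρ : ℝ → ℝ) (s r : ℝ) (n : ℕ) (X : ℝ → ℝ) :
    ℝ≥0∞ :=
  ∫⁻ t in Ico (0 : ℝ) 1,
    ENNReal.ofReal ((ρ (X t) * Real.exp (n * r) / tder a d φ α n t (X t)) ^ s)

/-- Along the curve `X`, the inverse of the truncated derivative of `f_m` in the metric `ρ` is at
most `Q e^{-mr}`. -/
def MultBound (a : ℝ) (d : ℕ) (φ : ℝ → ℝ) (α : ℝ) (ρ : ℝ → ℝ) (r : ℝ) (m : ℕ) (Q : ℝ)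
    (X : ℝ → ℝ) : Prop :=
  ∀ t ∈ Ico (0 : ℝ) 1, ρ (X t) * Real.exp (m * r) ≤
    Q * (tder a d φ α m t (X t) * ρ (fn a d φ α m t (X t)))

lemma moment_add_le {ρ : ℝ → ℝ} {s r Q : ℝ} {m n : ℕ} {X : ℝ → ℝ} (hd : 0 < d)
    (hφp : Function.Periodic φ 1) (hα : 0 < α) (hs : 0 ≤ s) (hQ : 0 ≤ Q)
    (hρ : ∀ t ∈ Ico (0 : ℝ) 1, 0 ≤ ρ (X t))
    (hρ' : ∀ j < d ^ m, ∀ t ∈ Ico (0 : ℝ) 1, 0 ≤ ρ (branch a d φ α m j X t))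
    (h : MultBound a d φ α ρ r m Q X) :
    moment a d φ α ρ s r (m + n) X ≤ ∑ j ∈ Finset.range (d ^ m),
      ENNReal.ofReal (1 / (d : ℝ) ^ m) *
        (ENNReal.ofReal (Q ^ s) * moment a d φ α ρ s r n (branch a d φ α m j X)) := by
  refine (lintegral_Ico_le_sum (pow_pos hd m) _).trans ?_
  push_cast
  refine Finset.sum_le_sum fun j hj => ?_
  rw [Finset.mem_range] at hj
  refine mul_le_mul_right ?_ _
  rw [moment, ← lintegral_const_mul' _ _ ENNReal.ofReal_ne_top]
  refine setLIntegral_mono' measurableSet_Ico fun t ht => ?_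
  rw [← ENNReal.ofReal_mul (by positivity)]
  set θ := (t + j) / (d : ℝ) ^ m with hθ
  have hθI : θ ∈ Ico (0 : ℝ) 1 := div_pow_mem_Ico hd hj ht
  have h1 := h θ hθI
  have hb : fn a d φ α m θ (X θ) = branch a d φ α m j X t := rfl
  rw [hb] at h1
  have hp1 := tder_pos (a := a) (d := d) (φ := φ) hα m θ (X θ)
  have hp2 := tder_pos (a := a) (d := d) (φ := φ) hα n t (branch a d φ α m j X t)
  have h2 := hρ' j hj t ht
  have h3 := hρ θ hθI
  rw [tder_branch hd hφp]
  apply ENNReal.ofReal_le_ofReal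
  rw [← Real.mul_rpow hQ (by positivity)]
  apply Real.rpow_le_rpow (by positivity) _ hs
  rw [← hθ, div_le_iff₀ (by positivity)]
  have e1 : Real.exp (((m : ℝ) + n) * r) = Real.exp (m * r) * Real.exp (n * r) := by
    rw [← Real.exp_add]; ring_nf
  rw [e1]
  calc _ = (ρ (X θ) * Real.exp (m * r)) * Real.exp (n * r) := by ring
    _ ≤ (Q * (tder a d φ α m θ (X θ) * ρ (branch a d φ α m j X t))) * Real.exp (n * r) := by
      gcongr
    _ = _ := by field_simp

lemma sum_ofReal_le_of_card {m : ℕ} (hm : 0 < m) (P : Finset ℕ) (hP : P ⊆ Finset.range m)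
    (hcard : m ≤ 8 * P.card) {A B κ : ℝ} (hA : 0 ≤ A) (hB : 0 ≤ B) (hκ : 0 ≤ κ)
    (hB1 : B ≤ 15 / 14) (hAB : B * A ≤ 1 / 2) {u : ℕ → ℝ≥0∞}
    (hu : ∀ j < m, u j ≤ ENNReal.ofReal κ) (huP : ∀ j ∈ P, u j ≤ ENNReal.ofReal (A * κ)) :
    ∑ j ∈ Finset.range m, ENNReal.ofReal (1 / m) * (ENNReal.ofReal B * u j) ≤
      ENNReal.ofReal κ := by
  classical
  have hm' : (0 : ℝ) < m := by exact_mod_cast hm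
  have h1 : ∀ j ∈ Finset.range m, ENNReal.ofReal (1 / m) * (ENNReal.ofReal B * u j) ≤
      ENNReal.ofReal (1 / m * (B * (if j ∈ P then A * κ else κ))) := by
    intro j hj
    rw [ENNReal.ofReal_mul (by positivity), ENNReal.ofReal_mul hB]
    gcongr
    split_ifs with h
    · exact huP j h
    · exact hu j (Finset.mem_range.1 hj)
  refine (Finset.sum_le_sum h1).trans ?_
  rw [← ENNReal.ofReal_sum_of_nonneg]
  swap
  · intro j _
    split_ifs <;> positivity
  apply ENNReal.ofReal_le_ofReal
  rw [← Finset.mul_sum, ← Finset.mul_sum]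
  have h2 : ∑ j ∈ Finset.range m, (if j ∈ P then A * κ else κ) =
      P.card * (A * κ) + (m - P.card) * κ := by
    rw [Finset.sum_ite, Finset.sum_const, Finset.sum_const, Finset.filter_mem_eq_inter,
      Finset.inter_eq_right.2 hP, ← Finset.sdiff_eq_filter, Finset.card_sdiff_of_subset hP,
      Finset.card_range, nsmul_eq_mul, nsmul_eq_mul, Nat.cast_sub]
    simpa using Finset.card_le_card hP
  rw [h2, one_div, inv_mul_le_iff₀ hm']
  have hc : (m : ℝ) ≤ 8 * P.card := by exact_mod_cast hcard
  have hc2 : (P.card : ℝ) ≤ m := by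
    have := Finset.card_le_card hP
    rw [Finset.card_range] at this
    exact_mod_cast this
  have h3 : B * (P.card * A + (m - P.card)) ≤ m := by
    nlinarith [mul_nonneg (sub_nonneg.2 hc2) (sub_nonneg.2 hB1),
      mul_nonneg (Nat.cast_nonneg (α := ℝ) P.card) (sub_nonneg.2 hAB)]
  nlinarith [mul_le_mul_of_nonneg_right h3 hκ]

/-- Moments are bounded as soon as every curve of a class stable under branching either does not
lose any derivative in one step, or loses a bounded factor in `T` steps and then gains a definite
factor on a definite proportion of its branches. -/
lemma moment_bounded {ρ : ℝ → ℝ} {s r A B κ : ℝ} {T L : ℕ} (Adm : (ℝ → ℝ) → Prop) (hd : 0 < d)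
    (hφp : Function.Periodic φ 1) (hα : 0 < α) (hs : 0 ≤ s) (hA : 0 ≤ A) (hB : 0 ≤ B)
    (hκ : 0 ≤ κ) (hT : 0 < T) (hB1 : B ^ s ≤ 15 / 14) (hAB : B ^ s * A ^ s ≤ 1 / 2)
    (hρ : ∀ X, Adm X → ∀ t ∈ Ico (0 : ℝ) 1, 0 ≤ ρ (X t))
    (hbr : ∀ X, Adm X → ∀ m, ∀ j < d ^ m, Adm (branch a d φ α m j X))
    (hstep : ∀ X, Adm X → MultBound a d φ α ρ r 1 1 X ∨
      (MultBound a d φ α ρ r T B X ∧ ∃ P ⊆ Finset.range (d ^ T), d ^ T ≤ 8 * P.card ∧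
        ∀ j ∈ P, MultBound a d φ α ρ r L A (branch a d φ α T j X)))
    (hinit : ∀ X, Adm X → ∀ n < T + L, moment a d φ α ρ s r n X ≤ ENNReal.ofReal κ)
    (n : ℕ) {X : ℝ → ℝ} (hX : Adm X) : moment a d φ α ρ s r n X ≤ ENNReal.ofReal κ := by
  have hconst : ∀ m, ∑ j ∈ Finset.range (d ^ m), ENNReal.ofReal (1 / (d : ℝ) ^ m) *
      ENNReal.ofReal κ = ENNReal.ofReal κ := by
    intro m
    have hdm : (0 : ℝ) < (d : ℝ) ^ m := by have : (0 : ℝ) < d := by exact_mod_cast hd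
                                           positivity
    rw [Finset.sum_const, Finset.card_range, nsmul_eq_mul, ← mul_assoc,
      ← ENNReal.ofReal_natCast, ← ENNReal.ofReal_mul (by positivity)]
    push_cast
    rw [mul_one_div_cancel hdm.ne', ENNReal.ofReal_one, one_mul]
  induction n using Nat.strong_induction_on generalizing X with
  | _ n ih =>
  rcases lt_or_ge n (T + L) with hn | hn
  · exact hinit X hX n hn
  rcases hstep X hX with h1 | ⟨h1, P, hP, hcard, h2⟩
  · obtain ⟨k, rfl⟩ : ∃ k, n = 1 + k := ⟨n - 1, by omega⟩
    refine (moment_add_le hd hφp hα hs zero_le_one (hρ X hX)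
      (fun j hj => hρ _ (hbr X hX 1 j hj)) h1).trans ?_
    rw [← hconst 1]
    refine Finset.sum_le_sum fun j hj => ?_
    rw [Real.one_rpow, ENNReal.ofReal_one, one_mul]
    gcongr
    exact ih k (by omega) (hbr X hX 1 j (Finset.mem_range.1 hj))
  · obtain ⟨k, rfl⟩ : ∃ k, n = T + (L + k) := ⟨n - T - L, by omega⟩
    refine (moment_add_le hd hφp hα hs hB (hρ X hX)
      (fun j hj => hρ _ (hbr X hX T j hj)) h1).trans ?_
    have hT' : (1 : ℝ) / (d : ℝ) ^ T = 1 / ((d ^ T : ℕ) : ℝ) := by push_cast; rfl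
    rw [hT']
    refine sum_ofReal_le_of_card (A := A ^ s) (pow_pos hd T) P hP hcard (by positivity)
      (by positivity) hκ hB1 hAB (fun j hj => ih _ (by omega) (hbr X hX T j hj)) ?_
    intro j hj
    have hj' := Finset.mem_range.1 (hP hj)
    have hXj := hbr X hX T j hj'
    refine (moment_add_le hd hφp hα hs hA (hρ _ hXj)
      (fun i hi => hρ _ (hbr _ hXj L i hi)) (h2 j hj)).trans ?_
    rw [ENNReal.ofReal_mul (by positivity), ← hconst L, Finset.mul_sum]
    refine Finset.sum_le_sum fun i hi => ?_
    rw [mul_left_comm]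
    gcongr
    exact ih k (by omega) (hbr _ hXj L i (Finset.mem_range.1 hi))

lemma moment_le {ρ : ℝ → ℝ} {s r K : ℝ} {n : ℕ} {X : ℝ → ℝ} (hα : 0 < α) (hs : 0 ≤ s)
    (hρ : ∀ t ∈ Ico (0 : ℝ) 1, 0 ≤ ρ (X t) ∧ ρ (X t) ≤ K) :
    moment a d φ α ρ s r n X ≤
      ENNReal.ofReal ((K * Real.exp (n * r) / (2 * α) ^ n) ^ s) := by
  calc _ ≤ ∫⁻ t in Ico (0 : ℝ) 1,
        ENNReal.ofReal ((K * Real.exp (n * r) / (2 * α) ^ n) ^ s) := by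
        refine setLIntegral_mono' measurableSet_Ico fun t ht => ?_
        have h0 := tder_pos (a := a) (d := d) (φ := φ) hα n t (X t)
        have h1 := (hρ t ht).1
        have h2 := (hρ t ht).2
        have h3 := pow_le_tder (a := a) (d := d) (φ := φ) hα.le n t (X t)
        have h4 : 0 ≤ K := h1.trans h2
        gcongr
    _ = _ := by simp

/-- Away from the critical region the metric `ρ` is uniformly expanded. -/
lemma pow_mul_le_tder_mul {ρ : ℝ → ℝ} {β lam δ : ℝ} (hα : 0 < α) (hlam : 0 ≤ lam)
    (hφb : ∀ θ, |φ θ| ≤ 1) (hρ0 : ∀ x ∈ Icc (-β) β, 0 ≤ ρ x)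
    (htrap : ∀ x ∈ Icc (-β) β, ∀ ψ : ℝ, |ψ| ≤ 1 → a - x ^ 2 + α * ψ ∈ Icc (-β) β)
    (hρ : ∀ x ∈ Icc (-β) β, ∀ ψ, |ψ| ≤ 1 → δ ≤ |x| →
      lam * ρ x ≤ 2 * |x| * ρ (a - x ^ 2 + α * ψ))
    {θ x : ℝ} (hx : x ∈ Icc (-β) β) (L : ℕ) (hL : ∀ i < L, δ ≤ |fn a d φ α i θ x|) :
    lam ^ L * ρ x ≤ tder a d φ α L θ x * ρ (fn a d φ α L θ x) := by
  induction L with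
  | zero => simp [tder]
  | succ L ih =>
    have h1 := ih fun i hi => hL i (by omega)
    have hy := fn_mem (d := d) hφb htrap L θ hx
    have h2 := hρ _ hy (φ ((d : ℝ) ^ L * θ)) (hφb _) (hL L (by omega))
    have h3 := tder_pos (a := a) (d := d) (φ := φ) hα L θ x
    have h4 : tder a d φ α (L + 1) θ x =
        tder a d φ α L θ x * max (2 * |fn a d φ α L θ x|) (2 * α) := by
      rw [tder, Finset.prod_range_succ]; rfl
    rw [← fn_succ] at h2
    have h5 := hρ0 _ (fn_mem (d := d) hφb htrap (L + 1) θ hx)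
    rw [h4]
    calc lam ^ (L + 1) * ρ x = lam * (lam ^ L * ρ x) := by ring
      _ ≤ lam * (tder a d φ α L θ x * ρ (fn a d φ α L θ x)) := by gcongr
      _ = tder a d φ α L θ x * (lam * ρ (fn a d φ α L θ x)) := by ring
      _ ≤ tder a d φ α L θ x * (max (2 * |fn a d φ α L θ x|) (2 * α) *
          ρ (fn a d φ α (L + 1) θ x)) := by
        refine mul_le_mul_of_nonneg_left (h2.trans ?_) h3.le
        exact mul_le_mul_of_nonneg_right (le_max_left _ _) h5
      _ = _ := by ring

end Moment

section Step

variable {a : ℝ} {d : ℕ} {φ : ℝ → ℝ} {α : ℝ}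

lemma exists_good_branches {σ C η ε w δ : ℝ} {τ : ℝ≥0∞} {N : ℕ} (S : Finset ℝ) (L : ℕ)
    (hd : 0 < d)
    (hφb : ∀ θ, |φ θ| ≤ 1) (hσ : 0 < σ) (hσ2 : σ ≤ 1 / 2) (hφσ : Function.Periodic φ (d * σ))
    (hanti : ∀ U ⊆ Icc (0 : ℝ) 1, (∀ u ∈ U, ∀ v ∈ U,
      |(φ (u + σ) - φ u) - (φ (v + σ) - φ v)| ≤ η) → volume U ≤ τ)
    (hα : 0 < α)
    (hpair : ∀ x y X Y, PseudoOrbit a α a N x → PseudoOrbit a α a N y →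
      PseudoOrbit a α a N X → PseudoOrbit a α a N Y →
      (∀ k < N, x (k + 1) + x k ^ 2 = y (k + 1) + y k ^ 2) →
      (∀ k < N, X (k + 1) + X k ^ 2 = Y (k + 1) + Y k ^ 2) → ∀ ε, 0 ≤ ε → ε ≤ 1 →
      |x N - X N| ≤ 2 * ε → |y N - Y N| ≤ 2 * ε →
      |(x 0 - y 0) - (X 0 - Y 0)| ≤ C * α * (ε + α * N))
    (hε : 0 ≤ ε) (hε1 : ε ≤ 1) (hwα : w ≤ α) (hη : C * α * (ε + α * N) + 4 * w ≤ α * η)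
    (hτ : S.card ^ 2 * τ ≤ ENNReal.ofReal (1 / 4)) (hαδ : α ≤ δ)
    (hnear : ∀ x : ℕ → ℝ, (∀ k < L, |x (k + 1) - (a - x k ^ 2)| ≤ δ) →
      (∃ i < L, |x i| ≤ δ) → ∃ s ∈ S, |x 0 - s| ≤ ε / 2)
    {X : ℝ → ℝ} (hX : ∀ t ∈ Ico (0 : ℝ) 1, X t ^ 2 ≤ w)
    (hosc : ∀ j < d ^ (N + 1), ∀ t ∈ Ico (0 : ℝ) 1, ∀ u ∈ Ico (0 : ℝ) 1,
      |branch a d φ α (N + 1) j X t - branch a d φ α (N + 1) j X u| ≤ ε / 2) :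
    ∃ P ⊆ Finset.range (d ^ (N + 1)), d ^ (N + 1) ≤ 8 * P.card ∧
      ∀ j ∈ P, ∀ t ∈ Ico (0 : ℝ) 1, ∀ i < L,
        δ ≤ |fn a d φ α i t (branch a d φ α (N + 1) j X t)| := by
  classical
  have hG := half_le_volume_good S hφb hσ hσ2 hφσ hanti hα hpair hε hε1 hwα hη hX
  set G := {t ∈ Ico (0 : ℝ) 1 | ∀ s ∈ S, ε < |fn a d φ α (N + 1) t (X t) - s|} with hGdef
  refine ⟨(Finset.range (d ^ (N + 1))).filter fun j : ℕ =>
    ∃ t ∈ Ico (0 : ℝ) 1, (t + j) / ((d ^ (N + 1) : ℕ) : ℝ) ∈ G, Finset.filter_subset _ _, ?_, ?_⟩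
  · set P := (Finset.range (d ^ (N + 1))).filter fun j : ℕ =>
      ∃ t ∈ Ico (0 : ℝ) 1, (t + j) / ((d ^ (N + 1) : ℕ) : ℝ) ∈ G with hP
    have hm : 0 < d ^ (N + 1) := pow_pos hd _
    have h1 : volume G ≤ P.card * ENNReal.ofReal (1 / ((d ^ (N + 1) : ℕ) : ℝ)) := by
      refine volume_le_card_div hm P fun θ hθ => ?_
      obtain ⟨j, hj, t, ht, h⟩ := exists_nat_Ico_div hm hθ.1
      exact ⟨j, Finset.mem_filter.2 ⟨Finset.mem_range.2 hj, t, ht, h ▸ hθ⟩, t, ht, h⟩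
    have hm' : (0 : ℝ) < ((d ^ (N + 1) : ℕ) : ℝ) := by exact_mod_cast hm
    have h2 : ENNReal.ofReal (1 / 2) ≤
        ENNReal.ofReal (2 * (P.card * (1 / ((d ^ (N + 1) : ℕ) : ℝ))) + 1 / 4) := by
      rw [ENNReal.ofReal_add (by positivity) (by norm_num), ENNReal.ofReal_mul (by norm_num),
        ENNReal.ofReal_mul (by positivity), ENNReal.ofReal_natCast, ENNReal.ofReal_ofNat]
      have h3 : ENNReal.ofReal (1 / 2) = 1 / 2 := by
        rw [ENNReal.ofReal_div_of_pos (by norm_num)]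
        simp
      rw [h3]
      exact hG.trans (add_le_add (mul_le_mul_right h1 _) hτ)
    have h3 := (ENNReal.ofReal_le_ofReal_iff (by positivity)).1 h2
    have h4 : (1 : ℝ) / 8 ≤ P.card * (1 / ((d ^ (N + 1) : ℕ) : ℝ)) := by linarith
    rw [mul_one_div, le_div_iff₀ hm'] at h4
    have h5 : ((d ^ (N + 1) : ℕ) : ℝ) ≤ 8 * P.card := by linarith
    exact_mod_cast h5
  · intro j hj t ht i hi
    obtain ⟨hj, u, hu, huG⟩ := Finset.mem_filter.1 hj
    rw [Finset.mem_range] at hj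
    push_cast at huG
    by_contra! hlt
    obtain ⟨s, hs, hsx⟩ := hnear (fun i => fn a d φ α i t (branch a d φ α (N + 1) j X t))
      (fun k _ => by
        rw [fn_succ, add_sub_cancel_left, abs_mul, abs_of_pos hα]
        exact (mul_le_of_le_one_right hα.le (hφb _)).trans hαδ)
      ⟨i, hi, hlt.le⟩
    have h1 := huG.2 s hs
    have h2 : fn a d φ α (N + 1) ((u + j) / (d : ℝ) ^ (N + 1)) (X ((u + j) / (d : ℝ) ^ (N + 1))) =
      branch a d φ α (N + 1) j X u := rfl
    rw [h2] at h1
    simp only [fn_zero] at hsx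
    have h3 := abs_sub_le (branch a d φ α (N + 1) j X u) (branch a d φ α (N + 1) j X t) s
    linarith [hosc j hj u hu t ht]

/-- Starting near the critical point, the derivative lost at the first step is recovered at the
escape time up to a bounded factor. -/
lemma multBound_escape {ρ : ℝ → ℝ} {β r c C C' E : ℝ} {N : ℕ} (hα : 0 < α) (hc : 0 < c)
    (hC : 0 < C) (hφb : ∀ θ, |φ θ| ≤ 1)
    (htrap : ∀ x ∈ Icc (-β) β, ∀ ψ : ℝ, |ψ| ≤ 1 → a - x ^ 2 + α * ψ ∈ Icc (-β) β)
    (hρc : ∀ x ∈ Icc (-β) β, c ≤ ρ x)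
    (hesc : ∀ x, PseudoOrbit a α a N x → 1 / (C * α) ≤ ∏ k ∈ Finset.range N, 2 * |x k|)
    (hE : Real.exp ((N + 1 : ℕ) * r) ≤ E) {X : ℝ → ℝ}
    (hX : ∀ t ∈ Ico (0 : ℝ) 1, X t ∈ Icc (-β) β) (hX2 : ∀ t ∈ Ico (0 : ℝ) 1, X t ^ 2 ≤ α)
    (hρC : ∀ t ∈ Ico (0 : ℝ) 1, ρ (X t) ≤ C') :
    MultBound a d φ α ρ r (N + 1) (C' * E * C / (2 * c)) X := by
  intro t ht
  have h1 := hesc _ (pseudoOrbit_fn (d := d) hφb hα.le N t (hX2 t ht))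
  have h2 : 2 / C ≤ tder a d φ α (N + 1) t (X t) := by
    rw [tder, Finset.prod_range_succ']
    calc 2 / C = 1 / (C * α) * (2 * α) := by field_simp
      _ ≤ _ := by
        refine mul_le_mul (h1.trans ?_) (le_max_right _ _) (by positivity)
          (Finset.prod_nonneg fun _ _ => le_max_of_le_right (by positivity))
        exact Finset.prod_le_prod (fun _ _ => by positivity) fun _ _ => le_max_left _ _
  have h3 := hρc _ (fn_mem (d := d) hφb htrap (N + 1) t (hX t ht))
  have h4 : 0 ≤ ρ (X t) := hc.le.trans (hρc _ (hX t ht))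
  have h5 := h4.trans (hρC t ht)
  have h6 : 0 ≤ E := (Real.exp_pos _).le.trans hE
  calc ρ (X t) * Real.exp ((N + 1 : ℕ) * r) ≤ C' * E := by
        gcongr
        exact hρC t ht
    _ = C' * E * C / (2 * c) * (2 / C * c) := by field_simp
    _ ≤ _ := by
        have := (tder_pos (a := a) (d := d) (φ := φ) hα (N + 1) t (X t)).le
        gcongr

lemma multBound_of_far {ρ : ℝ → ℝ} {β r lam δ : ℝ} {L : ℕ} (hα : 0 < α) (hlam : 0 < lam)
    (hφb : ∀ θ, |φ θ| ≤ 1) (hρ0 : ∀ x ∈ Icc (-β) β, 0 ≤ ρ x)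
    (htrap : ∀ x ∈ Icc (-β) β, ∀ ψ : ℝ, |ψ| ≤ 1 → a - x ^ 2 + α * ψ ∈ Icc (-β) β)
    (hρ : ∀ x ∈ Icc (-β) β, ∀ ψ, |ψ| ≤ 1 → δ ≤ |x| →
      lam * ρ x ≤ 2 * |x| * ρ (a - x ^ 2 + α * ψ))
    {X : ℝ → ℝ} (hX : ∀ t ∈ Ico (0 : ℝ) 1, X t ∈ Icc (-β) β)
    (hL : ∀ t ∈ Ico (0 : ℝ) 1, ∀ i < L, δ ≤ |fn a d φ α i t (X t)|) :
    MultBound a d φ α ρ r L ((Real.exp r / lam) ^ L) X := by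
  intro t ht
  have h := pow_mul_le_tder_mul hα hlam.le hφb hρ0 htrap hρ (hX t ht) L (hL t ht)
  rw [Real.exp_nat_mul]
  calc ρ (X t) * Real.exp r ^ L = (Real.exp r / lam) ^ L * (lam ^ L * ρ (X t)) := by
        rw [div_pow]; field_simp
    _ ≤ _ := by gcongr

lemma MultBound.mono {ρ : ℝ → ℝ} {β r Q Q' : ℝ} {m : ℕ} (hα : 0 < α) (hφb : ∀ θ, |φ θ| ≤ 1)
    (htrap : ∀ x ∈ Icc (-β) β, ∀ ψ : ℝ, |ψ| ≤ 1 → a - x ^ 2 + α * ψ ∈ Icc (-β) β)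
    (hρ0 : ∀ x ∈ Icc (-β) β, 0 ≤ ρ x) {X : ℝ → ℝ}
    (hX : ∀ t ∈ Ico (0 : ℝ) 1, X t ∈ Icc (-β) β) (hQ : Q ≤ Q')
    (h : MultBound a d φ α ρ r m Q X) : MultBound a d φ α ρ r m Q' X := by
  intro t ht
  refine (h t ht).trans ?_
  have h1 := tder_pos (a := a) (d := d) (φ := φ) hα m t (X t)
  have h2 := hρ0 _ (fn_mem (d := d) hφb htrap m t (hX t ht))
  gcongr

/-- Bounded moments give almost sure growth. -/
lemma ae_eventually_le_tder {c s r b κ : ℝ} {X Y : ℝ → ℝ} (hα : 0 < α) (hc : 0 < c) (hs : 0 < s)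
    (hr : b < r) (hφ : Continuous φ) (hY : Continuous Y) (hXY : ∀ t ∈ Ico (0 : ℝ) 1, X t = Y t)
    (h : ∀ n : ℕ, ∫⁻ t in Ico (0 : ℝ) 1,
      ENNReal.ofReal ((c * Real.exp (n * r) / tder a d φ α n t (X t)) ^ s) ≤ ENNReal.ofReal κ) :
    ∀ᵐ t ∂(volume.restrict (Ico (0 : ℝ) 1)), ∀ᶠ n : ℕ in atTop,
      Real.exp (n * b) ≤ tder a d φ α n t (X t) := by
  have hXY' : ∀ᵐ t ∂(volume.restrict (Ico (0 : ℝ) 1)), X t = Y t :=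
    (ae_restrict_mem measurableSet_Ico).mono hXY
  have hcont : ∀ n, Continuous fun t => tder a d φ α n t (Y t) := fun n =>
    (continuous_tder hφ n).comp (continuous_id.prodMk hY)
  have hmeas : ∀ n : ℕ, Measurable fun t =>
      ENNReal.ofReal ((c * Real.exp (n * r) / tder a d φ α n t (Y t)) ^ s) := by
    intro n
    have := (hcont n).measurable
    fun_prop
  have hbound : ∀ n : ℕ, (volume.restrict (Ico (0 : ℝ) 1))
      {t | tder a d φ α n t (Y t) < Real.exp (n * b)} ≤
        ENNReal.ofReal (κ / c ^ s) * ENNReal.ofReal (Real.exp (-(s * (r - b)))) ^ n := by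
    intro n
    have h1 := mul_meas_ge_le_lintegral (μ := volume.restrict (Ico (0 : ℝ) 1)) (hmeas n)
      (ENNReal.ofReal ((c * Real.exp (n * (r - b))) ^ s))
    have h2 : ∫⁻ t in Ico (0 : ℝ) 1,
        ENNReal.ofReal ((c * Real.exp (n * r) / tder a d φ α n t (Y t)) ^ s) ≤
          ENNReal.ofReal κ := by
      refine le_trans (le_of_eq ?_) (h n)
      exact setLIntegral_congr_fun measurableSet_Ico fun t ht => by simp only [hXY t ht]
    have h3 : {t | tder a d φ α n t (Y t) < Real.exp (n * b)} ⊆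
        {t | ENNReal.ofReal ((c * Real.exp (n * (r - b))) ^ s) ≤
          ENNReal.ofReal ((c * Real.exp (n * r) / tder a d φ α n t (Y t)) ^ s)} := by
      intro t ht
      have h4 := tder_pos (a := a) (d := d) (φ := φ) hα n t (Y t)
      apply ENNReal.ofReal_le_ofReal
      apply Real.rpow_le_rpow (by positivity) _ hs.le
      rw [le_div_iff₀ h4]
      calc _ ≤ c * Real.exp (n * (r - b)) * Real.exp (n * b) := by
            gcongr
            exact le_of_lt ht
        _ = _ := by rw [mul_assoc, ← Real.exp_add]; ring_nf
    have hpos : (0 : ℝ) < (c * Real.exp (n * (r - b))) ^ s := by positivity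
    have h5 := ((mul_le_mul_right (measure_mono h3) _).trans h1).trans h2
    rw [mul_comm, ← ENNReal.le_div_iff_mul_le (Or.inl (by simpa using hpos))
      (Or.inl ENNReal.ofReal_ne_top), ← ENNReal.ofReal_div_of_pos hpos] at h5
    refine h5.trans (le_of_eq ?_)
    rw [← ENNReal.ofReal_pow (Real.exp_pos _).le, ← ENNReal.ofReal_mul' (by positivity),
      Real.mul_rpow hc.le (Real.exp_pos _).le, ← Real.exp_nat_mul, ← Real.exp_mul]
    congr 1
    have e1 : (n : ℝ) * -(s * (r - b)) = -(n * (r - b) * s) := by ring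
    rw [e1, Real.exp_neg]
    field_simp
  have hsum : ∑' n : ℕ, (volume.restrict (Ico (0 : ℝ) 1))
      {t | tder a d φ α n t (Y t) < Real.exp (n * b)} ≠ ∞ := by
    refine ne_top_of_le_ne_top ?_ (ENNReal.tsum_le_tsum hbound)
    rw [ENNReal.tsum_mul_left, ENNReal.tsum_geometric]
    refine ENNReal.mul_ne_top ENNReal.ofReal_ne_top (ENNReal.inv_ne_top.2 ?_)
    rw [Ne, tsub_eq_zero_iff_le, not_le, ENNReal.ofReal_lt_one, Real.exp_lt_one_iff]
    have := mul_pos hs (sub_pos.2 hr)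
    linarith
  filter_upwards [ae_eventually_notMem hsum, hXY'] with t ht hXt
  filter_upwards [ht] with n hn
  rw [hXt]
  exact not_lt.1 hn

end Step

section Assembly

variable {a : ℝ} {d : ℕ} {φ : ℝ → ℝ} {α : ℝ}

lemma moment_admissible_bounded {ρ : ℝ → ℝ} {β r c K lam δ s B : ℝ} {T L n₀ : ℕ} (hd : 0 < d)
    (hφp : Function.Periodic φ 1) (hφb : ∀ θ, |φ θ| ≤ 1) (hα : 0 < α)
    (htrap : ∀ x ∈ Icc (-β) β, ∀ ψ : ℝ, |ψ| ≤ 1 → a - x ^ 2 + α * ψ ∈ Icc (-β) β)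
    (hmem : ∀ X, Admissible a d φ α β n₀ X → ∀ t ∈ Ico (0 : ℝ) 1, X t ∈ Icc (-β) β)
    (hosc : ∀ X, Admissible a d φ α β n₀ X → ∀ t ∈ Ico (0 : ℝ) 1, ∀ u ∈ Ico (0 : ℝ) 1,
      |X t - X u| ≤ δ)
    (hc : 0 < c) (hρc : ∀ x ∈ Icc (-β) β, c ≤ ρ x) (hρK : ∀ x ∈ Icc (-β) β, ρ x ≤ K)
    (hlam : 1 < lam)
    (hρ : ∀ x ∈ Icc (-β) β, ∀ ψ, |ψ| ≤ 1 → δ ≤ |x| →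
      lam * ρ x ≤ 2 * |x| * ρ (a - x ^ 2 + α * ψ))
    (hr : Real.exp r ≤ √lam) (hs : 0 < s) (hB : 0 ≤ B) (hT : 0 < T) (hBs : B ^ s ≤ 15 / 14)
    (hL : B ^ s * ((1 / √lam) ^ L) ^ s ≤ 1 / 2)
    (hnear : ∀ X, Admissible a d φ α β n₀ X → (∀ t ∈ Ico (0 : ℝ) 1, |X t| ≤ 2 * δ) →
      MultBound a d φ α ρ r T B X ∧ ∃ P ⊆ Finset.range (d ^ T), d ^ T ≤ 8 * P.card ∧
        ∀ j ∈ P, ∀ t ∈ Ico (0 : ℝ) 1, ∀ i < L, δ ≤ |fn a d φ α i t (branch a d φ α T j X t)|) :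
    ∃ κ : ℝ, ∀ n X, Admissible a d φ α β n₀ X →
      moment a d φ α ρ s r n X ≤ ENNReal.ofReal κ := by
  have hlam0 : 0 < lam := by linarith
  have hsl : 1 < √lam := by rw [Real.lt_sqrt zero_le_one]; simpa using hlam
  have hsl2 : √lam * √lam = lam := Real.mul_self_sqrt hlam0.le
  have hρ0 : ∀ x ∈ Icc (-β) β, 0 ≤ ρ x := fun x hx => hc.le.trans (hρc x hx)
  have hq : Real.exp r / lam ≤ 1 / √lam := by
    rw [div_le_div_iff₀ hlam0 (by positivity), one_mul]
    nlinarith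
  have hq1 : Real.exp r / lam ≤ 1 := hq.trans (by rw [div_le_one (by positivity)]; exact hsl.le)
  have hbr : ∀ X, Admissible a d φ α β n₀ X → ∀ m, ∀ j < d ^ m,
      Admissible a d φ α β n₀ (branch a d φ α m j X) :=
    fun X hX m j hj => admissible_branch hd hj hφp hX
  let κ : ℝ := ∑ n ∈ Finset.range (T + L), (max K 0 * Real.exp (n * r) / (2 * α) ^ n) ^ s
  refine ⟨κ, fun n X hX => moment_bounded (A := (1 / √lam) ^ L) (B := B) (T := T) (L := L)
    (Admissible a d φ α β n₀) hd hφp hα hs.le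
    (by positivity) hB (Finset.sum_nonneg fun _ _ => by positivity) hT hBs hL
    (fun X hX t ht => hρ0 _ (hmem X hX t ht)) hbr ?_ ?_ n hX⟩
  · intro X hX
    by_cases hfar : ∀ t ∈ Ico (0 : ℝ) 1, δ ≤ |X t|
    · left
      refine (multBound_of_far hα hlam0 hφb hρ0 htrap hρ (hmem X hX) (L := 1) ?_).mono hα hφb
        htrap hρ0 (hmem X hX) (by rwa [pow_one])
      intro t ht i hi
      obtain rfl : i = 0 := by omega
      exact hfar t ht
    · right
      push Not at hfar
      obtain ⟨t₀, ht₀, hlt⟩ := hfar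
      obtain ⟨h1, P, hP, hcard, h2⟩ := hnear X hX fun t ht => by
        have h3 := hosc X hX t ht t₀ ht₀
        have h4 := abs_sub_abs_le_abs_sub (X t) (X t₀)
        linarith
      refine ⟨h1, P, hP, hcard, fun j hj => ?_⟩
      have hXj := hmem _ (hbr X hX T j (Finset.mem_range.1 (hP hj)))
      exact (multBound_of_far hα hlam0 hφb hρ0 htrap hρ hXj (h2 j hj)).mono hα hφb htrap hρ0 hXj
        (pow_le_pow_left₀ (by positivity) hq L)
  · intro X hX n hn
    refine (moment_le (K := max K 0) hα hs.le fun t ht => ⟨hρ0 _ (hmem X hX t ht),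
      (hρK _ (hmem X hX t ht)).trans (le_max_left _ _)⟩).trans ?_
    apply ENNReal.ofReal_le_ofReal
    exact Finset.single_le_sum (f := fun n : ℕ =>
      (max K 0 * Real.exp (n * r) / (2 * α) ^ n) ^ s) (fun _ _ => by positivity)
      (Finset.mem_range.2 hn)

lemma Admissible.exists_continuous {β : ℝ} {n₀ : ℕ} {X : ℝ → ℝ} (hφ : Continuous φ)
    (hX : Admissible a d φ α β n₀ X) :
    ∃ Y : ℝ → ℝ, Continuous Y ∧ ∀ t ∈ Ico (0 : ℝ) 1, X t = Y t := by
  obtain ⟨n, -, j, -, x₀, -, h⟩ := hX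
  have h1 : Continuous fun t : ℝ => ((t + j) / (d : ℝ) ^ n, x₀) := by fun_prop
  exact ⟨_, (continuous_fn (a := a) (d := d) (α := α) hφ n).comp h1, h⟩

lemma exists_rpow_le {B : ℝ} (hB : 0 < B) : ∃ s : ℝ, 0 < s ∧ B ^ s ≤ 15 / 14 := by
  have h : Tendsto (fun s : ℝ => B ^ s) (nhdsWithin 0 (Ioi 0)) (nhds (B ^ (0 : ℝ))) :=
    ((Real.continuous_const_rpow hB.ne').tendsto 0).mono_left nhdsWithin_le_nhds
  rw [Real.rpow_zero] at h
  obtain ⟨s, h1, h2⟩ := ((h.eventually (gt_mem_nhds (show (1 : ℝ) < 15 / 14 by norm_num))).and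
    self_mem_nhdsWithin).exists
  exact ⟨s, h2, h1.le⟩

lemma exists_pow_rpow_le {q s b : ℝ} (hq : 0 ≤ q) (hq1 : q < 1) (hs : 0 < s) :
    ∃ L : ℕ, b * (q ^ L) ^ s ≤ 1 / 2 := by
  have h : Tendsto (fun L : ℕ => b * (q ^ L) ^ s) atTop (nhds (b * 0 ^ s)) :=
    ((tendsto_pow_atTop_nhds_zero_of_lt_one hq hq1).rpow_const (Or.inr hs.le)).const_mul b
  rw [Real.zero_rpow hs.ne', mul_zero] at h
  obtain ⟨L, hL⟩ := (h.eventually (gt_mem_nhds (show (0 : ℝ) < 1 / 2 by norm_num))).exists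
  exact ⟨L, hL.le⟩

lemma tendsto_mul_log_inv :
    Tendsto (fun α : ℝ => α * Real.log α⁻¹) (nhdsWithin 0 (Ioi 0)) (nhds 0) := by
  have h := tendsto_log_mul_rpow_nhdsGT_zero one_pos
  have h2 := h.neg
  rw [neg_zero] at h2
  refine h2.congr fun α => ?_
  rw [Real.rpow_one, Real.log_inv]
  ring

end Assembly

lemma eventually_mul_rpow_le {q K e : ℝ} (hq : 0 < q) (he : 0 < e) :
    ∀ᶠ α in nhdsWithin (0 : ℝ) (Ioi 0), K * α ^ q ≤ e := by
  have h : Tendsto (fun α : ℝ => K * α ^ q) (nhdsWithin 0 (Ioi 0)) (nhds (K * 0 ^ q)) :=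
    (((Real.continuousAt_rpow_const 0 q (Or.inr hq.le)).tendsto).mono_left
      nhdsWithin_le_nhds).const_mul K
  rw [Real.zero_rpow hq.ne', mul_zero] at h
  exact (h.eventually (gt_mem_nhds he)).mono fun _ h => h.le

lemma eventually_mul_le_rpow (K : ℝ) :
    ∀ᶠ α in nhdsWithin (0 : ℝ) (Ioi 0), K * α ≤ α ^ (0.6 : ℝ) := by
  filter_upwards [self_mem_nhdsWithin,
    eventually_mul_rpow_le (q := 0.4) (K := K) (by norm_num) one_pos] with α hα h
  have hα : 0 < α := hα
  have h1 : α = α ^ (0.4 : ℝ) * α ^ (0.6 : ℝ) := by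
    rw [← Real.rpow_add hα]
    norm_num
  calc K * α = K * α ^ (0.4 : ℝ) * α ^ (0.6 : ℝ) := by rw [mul_assoc, ← h1]
    _ ≤ 1 * α ^ (0.6 : ℝ) := by gcongr
    _ = _ := one_mul _

lemma eventually_mul_rpow_sq_le {e : ℝ} (K : ℝ) (he : 0 < e) :
    ∀ᶠ α in nhdsWithin (0 : ℝ) (Ioi 0), K * (α ^ (0.6 : ℝ)) ^ 2 ≤ e * α := by
  filter_upwards [self_mem_nhdsWithin,
    eventually_mul_rpow_le (q := 0.2) (K := K) (by norm_num) he] with α hα h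
  have hα : 0 < α := hα
  have h1 : (α ^ (0.6 : ℝ)) ^ 2 = α ^ (0.2 : ℝ) * α := by
    rw [← Real.rpow_natCast, ← Real.rpow_mul hα.le]
    nth_rw 3 [← Real.rpow_one α]
    rw [← Real.rpow_add hα]
    norm_num
  rw [h1, ← mul_assoc]
  gcongr

lemma tendsto_log_inv_atTop :
    Tendsto (fun α : ℝ => Real.log α⁻¹) (nhdsWithin 0 (Ioi 0)) atTop :=
  Real.tendsto_log_atTop.comp tendsto_inv_nhdsGT_zero

lemma ae_eventually_le_tder_of_moment {a : ℝ} {d : ℕ} {φ : ℝ → ℝ} {α c s r b κ : ℝ}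
    {ρ X Y : ℝ → ℝ} (hα : 0 < α) (hc : 0 < c) (hs : 0 < s) (hr : b < r) (hφ : Continuous φ)
    (hY : Continuous Y) (hXY : ∀ t ∈ Ico (0 : ℝ) 1, X t = Y t)
    (hρ : ∀ t ∈ Ico (0 : ℝ) 1, c ≤ ρ (X t))
    (h : ∀ n, moment a d φ α ρ s r n X ≤ ENNReal.ofReal κ) :
    ∀ᵐ t ∂(volume.restrict (Ico (0 : ℝ) 1)), ∀ᶠ n : ℕ in atTop,
      Real.exp (n * b) ≤ tder a d φ α n t (X t) := by
  refine ae_eventually_le_tder hα hc hs hr hφ hY hXY fun n => le_trans ?_ (h n)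
  refine setLIntegral_mono' measurableSet_Ico fun t ht => ENNReal.ofReal_le_ofReal ?_
  have h1 := tder_pos (a := a) (d := d) (φ := φ) hα n t (X t)
  have h2 := hρ t ht
  gcongr

/-- There is `λ₁ > 1` such that for each `M ≥ 1`, for `α > 0` small enough:
for every admissible curve `X : [0,1) → B_α` and a.e. `θ ∈ [0,1)`, the truncated vertical
derivative `∂̂f_n(θ,X(θ))/∂x = ∏_{i<n} max(2|f_i(θ,X(θ))|, 2α)` satisfies
`∂̂f_n(θ,X(θ))/∂x ≥ λ₁^{nM/N(α)}` for all large `n`. -/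
theorem truncated_derivative_growth
    (a : ℝ) (ha : a ∈ Set.Ioo (1 : ℝ) 2) (hpre : StrictlyPreperiodic a)
    (d : ℕ) (hd : 2 ≤ d)
    (φ : ℝ → ℝ) (hφa : ∀ x : ℝ, AnalyticAt ℝ φ x) (hφp : Function.Periodic φ 1)
    (hφnc : ∃ s t : ℝ, φ s ≠ φ t) (hφb : ∀ θ : ℝ, |φ θ| ≤ 1)
    (β : ℝ) (hβ1 : 1 < β) (hβ2 : β < |(-1 - Real.sqrt (1 + 4 * a)) / 2|)
    (hβmap : ∀ x ∈ Set.Icc (-β) β, qm a x ∈ Set.Ioo (-β) β)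
    (hβder : ∀ x : ℝ, β ≤ |x| → 2 * β ≤ |deriv (qm a) x|)
    (n₀ : ℕ)
    (hdom : ∃ C₁ R₁ : ℝ, 0 < C₁ ∧ R₁ ∈ Set.Ioo (0 : ℝ) 2 ∧ ∃ α₁ > 0, ∀ α : ℝ, 0 < α → α < α₁ →
      ∀ θ x : ℝ, x ∈ Set.Icc (-β) β → ∀ k : ℕ,
        |deriv (fun y => fn a d φ α k θ y) x| ≤ C₁ * R₁ ^ k ∧
        (n₀ ≤ k → |deriv (fun y => fn a d φ α k θ y) x| ≤ R₁ ^ k ∧ R₁ ^ k ≤ (d : ℝ) ^ k / 6))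
    (ξ₀ : ℝ) (hξ₀ : 0 < ξ₀)
    (hcrit : ∀ i : ℕ, 1 ≤ i → (qm a)^[i] 0 ∉ Set.Ioo (-(2 * ξ₀)) (2 * ξ₀))
    :
    ∃ lam₁ : ℝ, 1 < lam₁ ∧ ∀ M : ℕ, 0 < M → ∃ α₀ > 0, ∀ α : ℝ, 0 < α → α < α₀ → α ≤ ξ₀ →
      ∀ X : ℝ → ℝ, Admissible a d φ α β n₀ X →
        Set.MapsTo X (Set.Ico (0 : ℝ) 1)
          (Set.Icc (-(2 * α ^ (0.6 : ℝ))) (2 * α ^ (0.6 : ℝ))) →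
        ∀ᵐ θ ∂(volume.restrict (Set.Ico (0 : ℝ) 1)),
          ∀ᶠ n : ℕ in Filter.atTop,
            lam₁ ^ (((n : ℝ) * M) / (Nal a ξ₀ α : ℝ)) ≤
              ∏ i ∈ Finset.range n, max (2 * |fn a d φ α i θ (X θ)|) (2 * α) := by
  have hφ : Continuous φ := continuous_iff_continuousAt.2 fun x => (hφa x).continuousAt
  obtain ⟨p, hp⟩ : ∃ p, p = (1 + √(1 + 4 * a)) / 2 := ⟨_, rfl⟩
  have hβp : β < p := by
    have h : (-1 - √(1 + 4 * a)) / 2 = -((1 + √(1 + 4 * a)) / 2) := by ring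
    rwa [h, abs_neg, abs_of_pos (by positivity), ← hp] at hβ2
  have hp2 : p ≤ 2 := by
    have h : √(1 + 4 * a) ≤ 3 := Real.sqrt_le_iff.2 ⟨by norm_num, by linarith [ha.2]⟩
    linarith
  obtain ⟨E₀, hE₀, hcE, hcp⟩ := exists_postcritSet ha hpre hp
  have htr := exists_trap hβ1 hβmap
  obtain ⟨lam, c, Cρ, hlam, hc, hCρ, hmetric⟩ := hE₀.exists_expanding_metric hβp htr
  obtain ⟨_, _, _, _, _, hexp⟩ := hE₀.expandingOrbit (c := fun k => (qm a)^[k + 1] 0) hcE hcp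
    fun k => Function.iterate_succ_apply' _ _ _
  obtain ⟨C, hC, hescape⟩ := hexp.exists_escape_time
  have hc0 : (qm a)^[0 + 1] 0 = a := by simp [qm]
  simp only [hc0] at hescape
  obtain ⟨c₁, hc₁, hNal⟩ := exists_le_Nal hξ₀ hp2 fun n => (hcp n).le
  obtain ⟨Lφ, hLφ, hlip⟩ := exists_lipschitz hφa hφp
  obtain ⟨σ, hσ, hσ2, hφσ, hσnc⟩ := exists_shift hd hφa hφp hφnc
  obtain ⟨C₁, R₁, hC₁, ⟨hR₁, hR₁2⟩, α₁, hα₁, hder⟩ := hdom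
  obtain ⟨α₂, hα₂, htr⟩ := htr
  have hdR : R₁ < d := hR₁2.trans_le (by exact_mod_cast hd)
  have hd0 : 0 < d := by omega
  have hsl : 1 < √lam := by rw [Real.lt_sqrt zero_le_one]; simpa using hlam
  have hlogsl := Real.log_pos hsl
  refine ⟨Real.exp 1, Real.one_lt_exp_iff.2 one_pos, fun M hM => ?_⟩
  set E := Real.exp ((M + 1) * (C + 1) / c₁) with hE
  set B := Cρ * E * C / (2 * c) with hB
  have hB0 : 0 < B := by positivity
  obtain ⟨s, hs, hBs⟩ := exists_rpow_le hB0
  obtain ⟨L, hL⟩ := exists_pow_rpow_le (q := 1 / √lam) (b := B ^ s) (by positivity)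
    (by rw [div_lt_one (by positivity)]; exact hsl) hs
  obtain ⟨S, hS⟩ := exists_finset_near a L
  set τ : ℝ≥0∞ := ENNReal.ofReal (1 / (4 * ((S.card : ℝ) ^ 2 + 1))) with hτdef
  have hτ : S.card ^ 2 * τ ≤ ENNReal.ofReal (1 / 4) := by
    rw [← ENNReal.ofReal_natCast, ← ENNReal.ofReal_pow (by positivity),
      ← ENNReal.ofReal_mul (by positivity)]
    apply ENNReal.ofReal_le_ofReal
    rw [mul_one_div, div_le_div_iff₀ (by positivity) (by norm_num)]
    linarith
  have hτ0 : 0 < τ := ENNReal.ofReal_pos.2 (by positivity)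
  have hshift : ∀ x, AnalyticAt ℝ (fun u => φ (u + σ)) x := fun x =>
    (hφa (x + σ)).comp (f := fun u => u + σ) (by fun_prop)
  obtain ⟨η, hη, hanti⟩ := exists_anticoncentration (h := fun u => φ (u + σ) - φ u)
    (fun x => (hshift x).sub (hφa x)) hσnc hτ0
  obtain ⟨ε, hε⟩ : ∃ ε, ε = min 1 (η / (4 * C)) := ⟨_, rfl⟩
  have hε0 : 0 < ε := hε ▸ lt_min one_pos (by positivity)
  have hε1 : ε ≤ 1 := hε ▸ min_le_left _ _
  have hεη : C * ε ≤ η / 4 := by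
    have h : ε ≤ η / (4 * C) := hε ▸ min_le_right _ _
    rw [le_div_iff₀ (by positivity)] at h
    linarith
  obtain ⟨δ, hδ, hnear⟩ := hS (ε / 2) (by positivity)
  set C₀ := C₁ * Lφ / (d - R₁) with hC₀
  have hloginv := tendsto_log_inv_atTop
  have hev : ∀ᶠ α in nhdsWithin (0 : ℝ) (Ioi 0), ∀ X : ℝ → ℝ, Admissible a d φ α β n₀ X →
      ∀ᵐ θ ∂(volume.restrict (Set.Ico (0 : ℝ) 1)), ∀ᶠ n : ℕ in Filter.atTop,
        Real.exp 1 ^ (((n : ℝ) * M) / (Nal a ξ₀ α : ℝ)) ≤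
          ∏ i ∈ Finset.range n, max (2 * |fn a d φ α i θ (X θ)|) (2 * α) := by
    filter_upwards [self_mem_nhdsWithin, hmetric, hescape, hNal,
      Ioo_mem_nhdsGT hα₁, Ioo_mem_nhdsGT hα₂,
      Ioo_mem_nhdsGT hδ, eventually_mul_rpow_le (q := 0.6) (K := 1) (by norm_num) hδ,
      eventually_mul_rpow_le (K := C₀) one_pos (half_pos hε0), eventually_mul_le_rpow C₀,
      eventually_mul_rpow_sq_le 4 one_pos, eventually_mul_rpow_sq_le 16 (half_pos hη),
      (tendsto_mul_log_inv.const_mul (C * C)).eventually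
        (gt_mem_nhds (show C * C * 0 < η / 4 by rw [mul_zero]; positivity)),
      hloginv.eventually_ge_atTop 1,
      hloginv.eventually_ge_atTop ((M + 1) / (Real.log √lam * c₁))] with
      α hα ⟨ρ, hρc, ⟨K, hρK⟩, hρC, hρ⟩ ⟨N, hN, hesc, hpair⟩ hNal hα₁ hα₂ hαδ hαδ' hosc₁ hosc₂
      hw₁ hw₂ hCN hlog1 hlogM X hX
    have hα : 0 < α := hα
    rw [Real.rpow_one] at hosc₁
    rw [one_mul] at hαδ' hw₁
    have htrap := htr α hα hα₂.2
    have hadm := fun X (hX : Admissible a d φ α β n₀ X) =>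
      hX.mem_and_oscillation hd0 hα.le hφb htrap hLφ.le hlip hC₁.le hR₁.le hdR
        fun θ x hx k => (hder α hα hα₁.2 θ x hx k).1
    set l := Real.log α⁻¹
    have hl0 : 0 < l := by linarith
    have hNal0 : 0 < (Nal a ξ₀ α : ℝ) := (mul_pos hc₁ hl0).trans_le hNal
    obtain ⟨r, hr⟩ : ∃ r, r = (M + 1) / (Nal a ξ₀ α : ℝ) := ⟨_, rfl⟩
    have hrlam : Real.exp r ≤ √lam := by
      rw [← Real.le_log_iff_exp_le (by positivity), hr, div_le_iff₀ hNal0]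
      rw [div_le_iff₀ (by positivity)] at hlogM
      calc (M + 1 : ℝ) ≤ Real.log √lam * (c₁ * l) := by linarith
        _ ≤ _ := by gcongr
    have hrE : Real.exp ((N + 1 : ℕ) * r) ≤ E := by
      rw [hE, Real.exp_le_exp, hr, mul_div_assoc', div_le_div_iff₀ hNal0 hc₁]
      push_cast
      calc (N + 1 : ℝ) * (M + 1) * c₁ ≤ ((C + 1) * l) * (M + 1) * c₁ := by
            gcongr
            linarith
        _ = (M + 1) * (C + 1) * (c₁ * l) := by ring
        _ ≤ _ := by gcongr
    have hηN : C * α * (ε + α * N) + 4 * (4 * (α ^ (0.6 : ℝ)) ^ 2) ≤ α * η := by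
      have h1 : C * (α * N) ≤ η / 4 := by
        calc C * (α * N) ≤ C * (α * (C * l)) := by gcongr
          _ = C * C * (α * l) := by ring
          _ ≤ _ := hCN.le
      have h2 := mul_le_mul_of_nonneg_left (add_le_add hεη h1) hα.le
      linarith
    have hstep : ∀ X, Admissible a d φ α β n₀ X →
        (∀ t ∈ Ico (0 : ℝ) 1, |X t| ≤ 2 * α ^ (0.6 : ℝ)) →
        MultBound a d φ α ρ r (N + 1) B X ∧ ∃ P ⊆ Finset.range (d ^ (N + 1)),
          d ^ (N + 1) ≤ 8 * P.card ∧ ∀ j ∈ P, ∀ t ∈ Ico (0 : ℝ) 1, ∀ i < L,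
            α ^ (0.6 : ℝ) ≤ |fn a d φ α i t (branch a d φ α (N + 1) j X t)| := by
      intro X hX hX2
      have hXw : ∀ t ∈ Ico (0 : ℝ) 1, X t ^ 2 ≤ 4 * (α ^ (0.6 : ℝ)) ^ 2 := fun t ht => by
        calc X t ^ 2 = |X t| ^ 2 := (sq_abs _).symm
          _ ≤ (2 * α ^ (0.6 : ℝ)) ^ 2 := pow_le_pow_left₀ (abs_nonneg _) (hX2 t ht) 2
          _ = _ := by ring
      refine ⟨multBound_escape hα hc hC hφb htrap hρc hesc hrE (hadm X hX).1
        (fun t ht => (hXw t ht).trans hw₁)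
        fun t ht => hρC _ ((hadm X hX).1 t ht) (hX2 t ht), ?_⟩
      obtain ⟨P, hP, hcard, h⟩ := exists_good_branches S L hd0 hφb hσ hσ2 hφσ hanti hα hpair
        hε0.le hε1 hw₁ hηN hτ hαδ.2.le hnear hXw fun j hj t ht u hu =>
          ((hadm _ (admissible_branch hd0 hj hφp hX)).2 t ht u hu).trans hosc₁
      exact ⟨P, hP, hcard, fun j hj t ht i hi => hαδ'.trans (h j hj t ht i hi)⟩
    obtain ⟨κ, hκ⟩ := moment_admissible_bounded hd0 hφp hφb hα htrap (fun X hX => (hadm X hX).1)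
      (fun X hX t ht u hu => ((hadm X hX).2 t ht u hu).trans hosc₂) hc hρc hρK hlam hρ hrlam hs
      hB0.le N.succ_pos hBs hL hstep
    obtain ⟨Y, hY, hXY⟩ := hX.exists_continuous hφ
    have hbr : (M : ℝ) / Nal a ξ₀ α < r := by
      rw [hr]
      gcongr
      linarith
    filter_upwards [ae_eventually_le_tder_of_moment hα hc hs hbr hφ hY hXY
      (fun t ht => hρc _ ((hadm X hX).1 t ht)) fun n => hκ n X hX] with t ht
    filter_upwards [ht] with n hn
    rwa [Real.exp_one_rpow, mul_div_assoc]
  obtain ⟨α₀, hα₀, h⟩ := mem_nhdsGT_iff_exists_Ioo_subset.1 hev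
  exact ⟨α₀, hα₀, fun α hα hα' _ X hX _ => h ⟨hα, hα'⟩ X hX⟩
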